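/- For every integer b ≥ 2 and every α ∈ (1/b, 1), the Weierstrass function W_{α,b}(x) = Σ_{n=0}^∞ α^n·cos(2π·b^n·x) satisfies dim_H{(x, W_{α,b}(x)) : x ∈ [0,1]} = 2 + log α / log b, where dim_H denotes Hausdorff dimension of a subset of ℝ². -/

import Mathlib

/-- The Weierstrass function `W_{α,b}(x) = Σ_{n=0}^∞ α^n · cos(2π b^n x)`. -/
noncomputable def weierstrass (α : ℝ) (b : ℕ) (x : ℝ) : ℝ :=
  ∑' n : ℕ, α ^ n * Real.cos (2 * Real.pi * (b : ℝ) ^ n * x)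

namespace WeierstrassGraph

open Finset

/-- The contraction rate of the `l`-th derivative. -/
noncomputable def rate (b : ℕ) (γ : ℝ) (l : ℕ) : ℝ := γ / (b : ℝ) ^ l

/-- The `l`-th derivative of `v ↦ sin (2πv)`, divided by `(2π) ^ l`. -/
noncomputable def wave (l : ℕ) (v : ℝ) : ℝ := Real.sin (2 * Real.pi * v + l * (Real.pi / 2))

/-- The `l`-th derivative, divided by `(2π) ^ l`, of the truncated slope function
`v ↦ ∑_{j=1}^n γ^j sin (2πv / b^j)`. -/
noncomputable def jet (b : ℕ) (γ : ℝ) (l n : ℕ) (v : ℝ) : ℝ :=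
  ∑ j ∈ range n, rate b γ l ^ (j + 1) * wave l (v / (b : ℝ) ^ (j + 1))

/-- The jets of order `i` at `v` and `w` agree up to the natural error of depth `n`. -/
def Close (b : ℕ) (γ : ℝ) (i n : ℕ) (A v w : ℝ) : Prop :=
  ∀ l ≤ i, |jet b γ l n v - jet b γ l n w| ≤ A * rate b γ l ^ n

lemma wave_add_nat (l : ℕ) (v : ℝ) (m : ℕ) : wave l (v + m) = wave l v := by
  unfold wave
  rw [show 2 * Real.pi * (v + m) + l * (Real.pi / 2)
    = (2 * Real.pi * v + l * (Real.pi / 2)) + m * (2 * Real.pi) by ring]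
  exact Real.sin_add_nat_mul_two_pi _ _

lemma abs_wave_le (l : ℕ) (v : ℝ) : |wave l v| ≤ 1 := Real.abs_sin_le_one _

lemma hasDerivAt_wave (l : ℕ) (v : ℝ) :
    HasDerivAt (wave l) (2 * Real.pi * wave (l + 1) v) v := by
  have h : HasDerivAt (fun v : ℝ => 2 * Real.pi * v + l * (Real.pi / 2)) (2 * Real.pi * 1) v :=
    ((hasDerivAt_id v).const_mul _).add_const _
  refine h.sin.congr_deriv ?_
  unfold wave
  rw [show 2 * Real.pi * v + ((l + 1 : ℕ) : ℝ) * (Real.pi / 2)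
    = (2 * Real.pi * v + l * (Real.pi / 2)) + Real.pi / 2 by push_cast; ring,
    Real.sin_add_pi_div_two]
  ring

lemma wave_sq_add_sq (l : ℕ) (u v : ℝ) :
    (wave l u - wave l v) ^ 2 + (wave (l + 1) u - wave (l + 1) v) ^ 2
      = 2 - 2 * Real.cos (2 * Real.pi * (u - v)) := by
  unfold wave
  have h : ∀ v : ℝ, 2 * Real.pi * v + ((l + 1 : ℕ) : ℝ) * (Real.pi / 2)
    = (2 * Real.pi * v + l * (Real.pi / 2)) + Real.pi / 2 := by intro v; push_cast; ring
  rw [h u, h v, Real.sin_add_pi_div_two, Real.sin_add_pi_div_two,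
    show 2 * Real.pi * (u - v) = (2 * Real.pi * u + l * (Real.pi / 2))
      - (2 * Real.pi * v + l * (Real.pi / 2)) by ring, Real.cos_sub]
  have h1 := Real.sin_sq_add_cos_sq (2 * Real.pi * u + l * (Real.pi / 2))
  have h2 := Real.sin_sq_add_cos_sq (2 * Real.pi * v + l * (Real.pi / 2))
  linear_combination h1 + h2

section
variable {b : ℕ} {γ : ℝ}

lemma rate_pos (hb : 2 ≤ b) (hγ : 0 < γ) (l : ℕ) : 0 < rate b γ l := by
  unfold rate; positivity

lemma rate_le (hb : 2 ≤ b) (hγ : 0 < γ) (l : ℕ) : rate b γ l ≤ γ := by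
  unfold rate
  apply div_le_self hγ.le
  exact one_le_pow₀ (by exact_mod_cast (by omega : 1 ≤ b))

lemma rate_succ (b : ℕ) (γ : ℝ) (l : ℕ) : rate b γ (l + 1) = rate b γ l / b := by
  unfold rate
  rw [pow_succ, div_div]

lemma one_le_rate_mul (hb : 2 ≤ b) (hbγ : 1 < γ * b) (l : ℕ) :
    1 ≤ rate b γ l * (b : ℝ) ^ (l + 1) := by
  unfold rate
  have : (0 : ℝ) < b := by positivity
  rw [pow_succ, div_mul_eq_mul_div, le_div_iff₀ (by positivity)]
  nlinarith [pow_pos this l]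

lemma jet_add (b : ℕ) (γ : ℝ) (l q m : ℕ) (v : ℝ) :
    jet b γ l (q + m) v = jet b γ l q v + rate b γ l ^ q * jet b γ l m (v / (b : ℝ) ^ q) := by
  unfold jet
  rw [sum_range_add, mul_sum]
  congr 1
  refine sum_congr rfl fun j _ => ?_
  rw [div_div, ← pow_add, ← mul_assoc, ← pow_add]
  rfl

lemma jet_add_mul (hb : 2 ≤ b) (l n : ℕ) (v : ℝ) (m : ℕ) :
    jet b γ l n (v + (b : ℝ) ^ n * m) = jet b γ l n v := by
  unfold jet
  refine sum_congr rfl fun j hj => ?_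
  have hb0 : (b : ℝ) ≠ 0 := by positivity
  have hj' : j + 1 ≤ n := by simpa using hj
  have : (v + (b : ℝ) ^ n * m) / (b : ℝ) ^ (j + 1)
      = v / (b : ℝ) ^ (j + 1) + ((b ^ (n - (j + 1)) * m : ℕ) : ℝ) := by
    have h : (b : ℝ) ^ n = (b : ℝ) ^ (j + 1) * (b : ℝ) ^ (n - (j + 1)) := by
      rw [← pow_add]; congr 1; omega
    rw [h]; push_cast; field_simp
  rw [this, wave_add_nat]

lemma abs_jet_le (hb : 2 ≤ b) (hγ : 0 < γ) (hγ1 : γ < 1) (l n : ℕ) (v : ℝ) :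
    |jet b γ l n v| ≤ rate b γ l / (1 - rate b γ l) := by
  have hr := rate_pos hb hγ l
  have hr1 : rate b γ l < 1 := (rate_le hb hγ l).trans_lt hγ1
  calc |jet b γ l n v| ≤ ∑ j ∈ range n, |rate b γ l ^ (j + 1) * wave l (v / (b : ℝ) ^ (j + 1))| :=
        abs_sum_le_sum_abs _ _
    _ ≤ ∑ j ∈ range n, rate b γ l * rate b γ l ^ j := by
        refine sum_le_sum fun j _ => ?_
        rw [abs_mul, abs_of_pos (by positivity), pow_succ']
        exact mul_le_of_le_one_right (by positivity) (abs_wave_le _ _)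
    _ = rate b γ l * ∑ j ∈ range n, rate b γ l ^ j := by rw [mul_sum]
    _ ≤ rate b γ l * (1 / (1 - rate b γ l)) := by
        gcongr
        rw [geom_sum_eq hr1.ne, ← neg_div_neg_eq]
        have := pow_pos hr n
        apply div_le_div₀ <;> linarith
    _ = _ := by ring

lemma abs_jet_le' (hb : 2 ≤ b) (hγ : 0 < γ) (hγ1 : γ < 1) (l n : ℕ) (v : ℝ) :
    |jet b γ l n v| ≤ 1 / (1 - γ) := by
  refine (abs_jet_le hb hγ hγ1 l n v).trans ?_
  have h := rate_le hb hγ l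
  apply div_le_div₀ <;> linarith

lemma hasDerivAt_jet (b : ℕ) (γ : ℝ) (l n : ℕ) (v : ℝ) :
    HasDerivAt (jet b γ l n) (2 * Real.pi * jet b γ (l + 1) n v) v := by
  unfold jet
  rw [mul_sum]
  apply HasDerivAt.fun_sum
  intro j _
  have h1 : HasDerivAt (fun v : ℝ => v / (b : ℝ) ^ (j + 1)) (1 / (b : ℝ) ^ (j + 1)) v :=
    (hasDerivAt_id v).div_const _
  have h2 := ((hasDerivAt_wave l (v / (b : ℝ) ^ (j + 1))).comp v h1).const_mul
    (rate b γ l ^ (j + 1))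
  refine h2.congr_deriv ?_
  rw [rate_succ, div_pow]
  ring

lemma abs_jet_sub_le (hb : 2 ≤ b) (hγ : 0 < γ) (hγ1 : γ < 1) (l n : ℕ) (v w : ℝ) :
    |jet b γ l n v - jet b γ l n w| ≤ 2 * Real.pi * (1 / (1 - γ)) * |v - w| := by
  have := Convex.norm_image_sub_le_of_norm_hasDerivWithin_le (𝕜 := ℝ) (s := Set.univ)
    (f := jet b γ l n) (f' := fun v => 2 * Real.pi * jet b γ (l + 1) n v)
    (C := 2 * Real.pi * (1 / (1 - γ))) (x := w) (y := v)
    (fun x _ => (hasDerivAt_jet b γ l n x).hasDerivWithinAt)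
    (fun x _ => by
      rw [Real.norm_eq_abs, abs_mul, abs_of_pos (by positivity)]
      gcongr
      exact abs_jet_le' hb hγ hγ1 _ _ _) convex_univ trivial trivial
  simpa [Real.norm_eq_abs] using this

lemma Close.symm {i n : ℕ} {A v w : ℝ} (h : Close b γ i n A v w) : Close b γ i n A w v :=
  fun l hl => by rw [abs_sub_comm]; exact h l hl

end

/-- A constant factor is absorbed by a strictly larger geometric rate. -/
lemma exists_mul_pow_le (C : ℝ) {x y : ℝ} (hx : 0 ≤ x) (hxy : x < y) :
    ∃ n₀ : ℕ, ∀ n ≥ n₀, C * x ^ n ≤ y ^ n := by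
  have hy : 0 < y := hx.trans_lt hxy
  have h1 : x / y < 1 := (div_lt_one hy).2 hxy
  have h := (tendsto_pow_atTop_nhds_zero_of_lt_one (by positivity) h1).const_mul C
  rw [mul_zero] at h
  obtain ⟨n₀, hn₀⟩ := Filter.eventually_atTop.1 (h.eventually (gt_mem_nhds one_pos))
  refine ⟨n₀, fun n hn => ?_⟩
  have := hn₀ n hn
  rw [div_pow, ← mul_div_assoc, div_lt_one (by positivity)] at this
  exact this.le

section pairs
variable {ι β : Type*} [DecidableEq β]

lemma two_mul_sum_pairs_eq_le (S T : Finset ι) (p : ι → ℝ) (u w : ι → β) :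
    2 * ∑ s ∈ S, ∑ t ∈ T, (if u s = w t then p s * p t else 0)
      ≤ (∑ s ∈ S, ∑ t ∈ S, if u s = u t then p s * p t else 0)
        + ∑ s ∈ T, ∑ t ∈ T, if w s = w t then p s * p t else 0 := by
  set F := S.image u ∪ T.image w with hF
  have key : ∀ (X Y : Finset ι) (f g : ι → β), (∀ s ∈ X, f s ∈ F) →
      ∑ s ∈ X, ∑ t ∈ Y, (if f s = g t then p s * p t else 0)
        = ∑ x ∈ F, (∑ s ∈ X, if f s = x then p s else 0) * ∑ t ∈ Y, if g t = x then p t else 0 := by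
    intro X Y f g hf
    simp_rw [sum_mul_sum]
    rw [sum_comm (s := F)]
    refine sum_congr rfl fun s hs => ?_
    rw [sum_comm (s := F)]
    refine sum_congr rfl fun t _ => ?_
    rw [sum_eq_single_of_mem (f s) (hf s hs)]
    · by_cases h : f s = g t
      · simp [h]
      · simp [h, Ne.symm h]
    · intro x _ hx
      simp [Ne.symm hx]
  have hS : ∀ s ∈ S, u s ∈ F := fun s hs => mem_union_left _ (mem_image_of_mem _ hs)
  have hT : ∀ s ∈ T, w s ∈ F := fun s hs => mem_union_right _ (mem_image_of_mem _ hs)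
  rw [key S T u w hS, key S S u u hS, key T T w w hT, mul_sum, ← sum_add_distrib]
  refine sum_le_sum fun x _ => ?_
  nlinarith [sq_nonneg ((∑ s ∈ S, if u s = x then p s else 0) -
    ∑ t ∈ T, if w t = x then p t else 0)]

/-- Cross correlations between two clouds of points are controlled by the self correlations. -/
lemma two_mul_sum_pairs_close_le (i : ℕ) (S T : Finset ι) (p : ι → ℝ) (hp : ∀ s, 0 ≤ p s)
    (f : ℕ → ι → ℝ) (c r : ℕ → ℝ) (hr : ∀ l, 0 < r l) (R : ι → ι → Prop)
    (hR : ∀ s ∈ S, ∀ t ∈ T, R s t → ∀ l ≤ i, |f l s - f l t + c l| ≤ r l) [∀ s t, Decidable (R s t)]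
    (Q : ι → ι → Prop) [∀ s t, Decidable (Q s t)]
    (hQS : ∀ s ∈ S, ∀ t ∈ S, (∀ l ≤ i, |f l s - f l t| ≤ r l) → Q s t)
    (hQT : ∀ s ∈ T, ∀ t ∈ T, (∀ l ≤ i, |f l s - f l t| ≤ r l) → Q s t) :
    2 * ∑ s ∈ S, ∑ t ∈ T, (if R s t then p s * p t else 0)
      ≤ 3 ^ (i + 1) * ((∑ s ∈ S, ∑ t ∈ S, if Q s t then p s * p t else 0)
        + ∑ s ∈ T, ∑ t ∈ T, if Q s t then p s * p t else 0) := by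
  classical
  let u : ι → Fin (i + 1) → ℤ := fun s l => ⌊f l s / r l⌋
  let v : ι → Fin (i + 1) → ℤ := fun s l => ⌊(f l s - c l) / r l⌋
  let D : Finset (Fin (i + 1) → ℤ) := Fintype.piFinset fun _ => Icc (-1) 1
  have hD : (D.card : ℝ) = 3 ^ (i + 1) := by
    simp [D, Fintype.card_piFinset]
  have habs : ∀ (x y a : ℝ), 0 < a → ⌊x / a⌋ = ⌊y / a⌋ → |x - y| ≤ a := by
    intro x y a ha h
    have := Int.abs_sub_lt_one_of_floor_eq_floor h
    rw [← sub_div, abs_div, abs_of_pos ha, div_lt_one ha] at this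
    exact this.le
  have hself : ∀ (X : Finset ι) (f' : ℕ → ι → ℝ) (δ : Fin (i + 1) → ℤ),
      (∀ s ∈ X, ∀ t ∈ X, (∀ l ≤ i, |f' l s - f' l t| ≤ r l) → Q s t) →
      ∑ s ∈ X, ∑ t ∈ X, (if (fun l : Fin (i + 1) => ⌊f' l s / r l⌋ + δ l)
          = (fun l : Fin (i + 1) => ⌊f' l t / r l⌋ + δ l) then p s * p t else 0)
        ≤ ∑ s ∈ X, ∑ t ∈ X, if Q s t then p s * p t else 0 := by
    intro X f' δ hX
    refine sum_le_sum fun s hs => sum_le_sum fun t ht => ?_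
    have h0 := mul_nonneg (hp s) (hp t)
    by_cases h : (fun l : Fin (i + 1) => ⌊f' l s / r l⌋ + δ l)
          = (fun l : Fin (i + 1) => ⌊f' l t / r l⌋ + δ l)
    · rw [if_pos h, if_pos]
      refine hX s hs t ht fun l hl => habs _ _ _ (hr l) ?_
      have := congrFun h ⟨l, by omega⟩
      simpa using this
    · rw [if_neg h]
      split_ifs <;> simp [h0]
  have step : ∀ δ ∈ D, 2 * ∑ s ∈ S, ∑ t ∈ T,
      (if u s = (fun l => v t l + δ l) then p s * p t else 0)
      ≤ (∑ s ∈ S, ∑ t ∈ S, if Q s t then p s * p t else 0)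
        + ∑ s ∈ T, ∑ t ∈ T, if Q s t then p s * p t else 0 := by
    intro δ _
    refine (two_mul_sum_pairs_eq_le S T p u (fun t l => v t l + δ l)).trans (add_le_add ?_ ?_)
    · simpa [u] using hself S f 0 hQS
    · refine hself T (fun l s => f l s - c l) δ ?_
      intro s hs t ht h
      exact hQT s hs t ht fun l hl => by simpa using h l hl
  calc 2 * ∑ s ∈ S, ∑ t ∈ T, (if R s t then p s * p t else 0)
      ≤ 2 * ∑ s ∈ S, ∑ t ∈ T, ∑ δ ∈ D,
          (if u s = (fun l => v t l + δ l) then p s * p t else 0) := by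
        gcongr with s hs t ht
        have h0 := mul_nonneg (hp s) (hp t)
        by_cases h : R s t
        · rw [if_pos h]
          have hmem : (fun l => u s l - v t l) ∈ D := by
            rw [Fintype.mem_piFinset]
            intro l
            have h1 := hR s hs t ht h l (by omega)
            have h2 : |f l s / r l - (f l t - c l) / r l| ≤ 1 := by
              rw [← sub_div, abs_div, abs_of_pos (hr l), div_le_one (hr l)]
              rwa [sub_sub_eq_add_sub, add_sub_right_comm]
            have h3 := abs_le.1 h2
            have a1 := Int.floor_le (f l s / r l)
            have a2 := Int.lt_floor_add_one (f l s / r l)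
            have a3 := Int.floor_le ((f l t - c l) / r l)
            have a4 := Int.lt_floor_add_one ((f l t - c l) / r l)
            have a5 : (-2 : ℝ) < ((u s l - v t l : ℤ) : ℝ) := by
              simp only [u, v]; push_cast; linarith
            have a6 : ((u s l - v t l : ℤ) : ℝ) < 2 := by
              simp only [u, v]; push_cast; linarith
            have a7 : -2 < u s l - v t l := by exact_mod_cast a5
            have a8 : u s l - v t l < 2 := by exact_mod_cast a6
            rw [mem_Icc]; omega
          refine le_trans (le_of_eq ?_) (single_le_sum
            (f := fun δ => if u s = (fun l => v t l + δ l) then p s * p t else 0) ?_ hmem)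
          · simp
          · intro δ _
            split_ifs <;> simp [h0]
        · rw [if_neg h]
          refine sum_nonneg fun δ _ => ?_
          split_ifs <;> simp [h0]
    _ = ∑ δ ∈ D, 2 * ∑ s ∈ S, ∑ t ∈ T, (if u s = (fun l => v t l + δ l) then p s * p t else 0) := by
        rw [← mul_sum]
        congr 1
        rw [sum_comm (s := D)]
        refine sum_congr rfl fun s _ => ?_
        rw [sum_comm (s := D)]
    _ ≤ ∑ _δ ∈ D, ((∑ s ∈ S, ∑ t ∈ S, if Q s t then p s * p t else 0)
        + ∑ s ∈ T, ∑ t ∈ T, if Q s t then p s * p t else 0) := sum_le_sum step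
    _ = _ := by rw [sum_const, nsmul_eq_mul, hD]

end pairs

lemma card_le_of_forall_sub_le (S : Finset ℕ) (m : ℝ) (hm : 0 ≤ m)
    (h : ∀ x ∈ S, ∀ y ∈ S, (y : ℝ) - x ≤ m) : (S.card : ℝ) ≤ m + 1 := by
  rcases S.eq_empty_or_nonempty with rfl | hS
  · simp; linarith
  have hsub : S ⊆ Icc (S.min' hS) (S.min' hS + ⌊m⌋₊) := by
    intro y hy
    rw [mem_Icc]
    refine ⟨S.min'_le y hy, ?_⟩
    have h1 := h _ (S.min'_mem hS) y hy
    have h2 := S.min'_le y hy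
    have : y - S.min' hS ≤ ⌊m⌋₊ := Nat.le_floor (by rw [Nat.cast_sub h2]; exact h1)
    omega
  have h1 := card_le_card hsub
  rw [Nat.card_Icc] at h1
  have h2 : S.card ≤ ⌊m⌋₊ + 1 := by omega
  have h3 : (S.card : ℝ) ≤ ⌊m⌋₊ + 1 := by exact_mod_cast h2
  linarith [Nat.floor_le hm]

/-- Number of grid points in a sublevel set away from the critical points. -/
lemma card_sublevel_le (f f' : ℝ → ℝ) (hf : ∀ y, HasDerivAt f (f' y) y) (K : ℝ)
    (hK : ∀ y z, |f' y - f' z| ≤ K * |y - z|) (c r : ℝ) (hc : 0 < c) (hr : 0 ≤ r)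
    (P N : ℕ) (hP : 2 * K ≤ c * P) (hP0 : 0 < P) (hN : 0 < N) (S : Finset ℕ)
    (hS : ∀ x ∈ S, x < N ∧ |f (x / N)| ≤ r ∧ c ≤ |f' (x / N)|) :
    (S.card : ℝ) ≤ P * (4 * r * N / c + 1) := by
  have hN' : (0 : ℝ) < N := by exact_mod_cast hN
  have hP' : (0 : ℝ) < P := by exact_mod_cast hP0
  have hfib : ∀ p ∈ range P, ((S.filter fun x => x * P / N = p).card : ℝ) ≤ 4 * r * N / c + 1 := by
    intro p _
    refine card_le_of_forall_sub_le _ _ (by positivity) fun x hx y hy => ?_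
    simp only [mem_filter] at hx hy
    rcases le_or_gt (y : ℝ) x with hyx | hxy
    · have : 0 ≤ 4 * r * N / c := by positivity
      linarith
    have hlt : (x : ℝ) / N < y / N := by gcongr
    obtain ⟨ξ, hξ, hξ'⟩ := exists_hasDerivAt_eq_slope f f' hlt
      (fun z _ => (hf z).continuousAt.continuousWithinAt) (fun z _ => hf z)
    have hd : ((y : ℝ) - x) * P ≤ N := by
      have e1 := Nat.div_add_mod (x * P) N
      have e2 := Nat.div_add_mod (y * P) N
      have e3 := Nat.mod_lt (y * P) hN
      rw [hx.2] at e1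
      rw [hy.2] at e2
      have : y * P ≤ x * P + N := by omega
      have : (y : ℝ) * P ≤ x * P + N := by exact_mod_cast this
      linarith
    have hdist : |ξ - x / N| ≤ 1 / P := by
      rw [abs_of_pos (by linarith [hξ.1])]
      have : (y : ℝ) / N - x / N ≤ 1 / P := by
        rw [← sub_div, div_le_div_iff₀ hN' hP']; linarith
      linarith [hξ.2]
    have hslope : c / 2 ≤ |f' ξ| := by
      have h1 := hK ξ (x / N)
      have h2 := (hS x hx.1).2.2
      have h3 : |f' (x / N)| ≤ |f' ξ| + |f' ξ - f' (x / N)| := by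
        have := abs_sub_abs_le_abs_sub (f' (x / N)) (f' ξ)
        rw [abs_sub_comm] at this
        linarith
      have h4 : K * |ξ - x / N| ≤ c / 2 := by
        have hK0 : 0 ≤ K := by
          have := hK 0 1
          simp at this
          exact (abs_nonneg _).trans this
        calc K * |ξ - x / N| ≤ K * (1 / P) := by gcongr
          _ ≤ c / 2 := by
            rw [mul_one_div, div_le_div_iff₀ hP' two_pos]; linarith
      linarith
    have hsub : |f (y / N) - f (x / N)| ≤ 2 * r := by
      have h1 := (hS x hx.1).2.1
      have h2 := (hS y hy.1).2.1
      have := abs_sub (f (y / N)) (f (x / N))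
      linarith
    have hw : 0 < (y : ℝ) / N - x / N := by linarith
    rw [hξ', abs_div, abs_of_pos hw, div_le_div_iff₀ two_pos hw] at hslope
    have h5 : c * (((y : ℝ) - x) / N) ≤ 4 * r := by
      rw [sub_div]; linarith
    rw [le_div_iff₀ hc]
    rw [← mul_div_assoc, div_le_iff₀ hN'] at h5
    linarith
  have hmaps : ∀ x ∈ S, x * P / N ∈ range P := by
    intro x hx
    rw [mem_range, Nat.div_lt_iff_lt_mul hN, mul_comm P N]
    exact Nat.mul_lt_mul_of_pos_right (hS x hx).1 hP0
  rw [card_eq_sum_card_fiberwise hmaps]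
  push_cast
  calc _ ≤ ∑ _p ∈ range P, (4 * r * N / c + 1) := sum_le_sum hfib
    _ = _ := by rw [sum_const, nsmul_eq_mul, card_range]

section
variable {b : ℕ} {γ : ℝ}

lemma jet_eq_jet_mod (hb : 2 ≤ b) (γ : ℝ) (l q L z : ℕ) :
    jet b γ l q ((z : ℝ) / (b : ℝ) ^ L)
      = jet b γ l q (((z % b ^ (L + q) : ℕ) : ℝ) / (b : ℝ) ^ L) := by
  have h : (z : ℝ) / (b : ℝ) ^ L = ((z % b ^ (L + q) : ℕ) : ℝ) / (b : ℝ) ^ L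
      + (b : ℝ) ^ q * (z / b ^ (L + q) : ℕ) := by
    have h1 : ((z % b ^ (L + q) + b ^ (L + q) * (z / b ^ (L + q)) : ℕ) : ℝ) = z := by
      rw [Nat.mod_add_div]
    have hb0 : (b : ℝ) ≠ 0 := by positivity
    rw [← h1, pow_add]
    push_cast
    field_simp
  rw [h, jet_add_mul hb]

lemma jet_div_pow_add (hb : 2 ≤ b) (γ : ℝ) (l q n L z : ℕ) :
    jet b γ l (q + n) ((z : ℝ) / (b : ℝ) ^ L)
      = jet b γ l q (((z % b ^ (L + q) : ℕ) : ℝ) / (b : ℝ) ^ L)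
        + rate b γ l ^ q * jet b γ l n ((z : ℝ) / (b : ℝ) ^ (L + q)) := by
  rw [jet_add, jet_eq_jet_mod hb, div_div, pow_add (b : ℝ) L q]

lemma rate_lt_one (hb : 2 ≤ b) (hγ : 0 < γ) (hγ1 : γ < 1) (l : ℕ) : rate b γ l < 1 :=
  (rate_le hb hγ l).trans_lt hγ1

lemma exists_card_nontangent_le (hb : 2 ≤ b) (hγ : 0 < γ) (hγ1 : γ < 1) (i : ℕ) (A : ℝ) (hA : 0 ≤ A)
    (c : ℝ) (hc : 0 < c) :
    ∃ C : ℝ, 0 ≤ C ∧ ∀ L n : ℕ, 1 ≤ rate b γ i ^ n * (b : ℝ) ^ L → ∀ S : Finset (ℕ × ℕ),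
      (∀ p ∈ S, p.1 < b ^ (L + n) ∧ p.2 < b ^ (L + n) ∧ p.1 % b ^ L = p.2 % b ^ L ∧
        |jet b γ i n (p.1 / (b : ℝ) ^ L) - jet b γ i n (p.2 / (b : ℝ) ^ L)| ≤ A * rate b γ i ^ n ∧
        c ≤ |jet b γ (i + 1) n (p.1 / (b : ℝ) ^ L) - jet b γ (i + 1) n (p.2 / (b : ℝ) ^ L)|) →
      (S.card : ℝ) ≤ C * ((b : ℝ) ^ (L + n) * (b * rate b γ i) ^ n) := by
  have hπ := Real.pi_pos
  have hM : 0 < 1 / (1 - γ) := by apply div_pos one_pos; linarith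
  set M := 1 / (1 - γ)
  set K := 2 * Real.pi * (2 * (2 * Real.pi * M)) with hKdef
  obtain ⟨P, hP⟩ := exists_nat_ge (2 * K / (2 * Real.pi * c) + 1)
  have hP0 : 0 < P := by
    have : 0 ≤ 2 * K / (2 * Real.pi * c) := by positivity
    have : (0 : ℝ) < P := by linarith
    exact_mod_cast this
  have hPK : 2 * K ≤ 2 * Real.pi * c * P := by
    have : 2 * K / (2 * Real.pi * c) ≤ P := by linarith
    rw [div_le_iff₀ (by positivity)] at this
    linarith
  have hb0 : 0 < b := by omega
  have hbR : (0 : ℝ) < b := by exact_mod_cast hb0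
  refine ⟨P * (4 * A / (2 * Real.pi * c) + 1), by positivity, fun L n hLn S hS => ?_⟩
  have hη := rate_pos hb hγ i
  set η := rate b γ i
  have hmaps : ∀ p ∈ S, (p.1 / b ^ L, p.2 / b ^ L) ∈ range (b ^ n) ×ˢ range (b ^ n) := by
    intro p hp
    obtain ⟨h1, h2, -⟩ := hS p hp
    rw [pow_add] at h1 h2
    rw [mem_product, mem_range, mem_range]
    exact ⟨Nat.div_lt_of_lt_mul h1, Nat.div_lt_of_lt_mul h2⟩
  have hfib : ∀ k ∈ range (b ^ n) ×ˢ range (b ^ n),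
      ((S.filter fun p => (p.1 / b ^ L, p.2 / b ^ L) = k).card : ℝ)
        ≤ P * (4 * A / (2 * Real.pi * c) + 1) * (η ^ n * (b : ℝ) ^ L) := by
    intro k _
    set T := S.filter fun p => (p.1 / b ^ L, p.2 / b ^ L) = k with hT
    have hdec : ∀ p ∈ T, p.1 = p.1 % b ^ L + b ^ L * k.1 ∧ p.2 = p.1 % b ^ L + b ^ L * k.2 := by
      intro p hp
      obtain ⟨hpS, hpk⟩ := mem_filter.1 hp
      rw [← hpk]
      have h3 := (hS p hpS).2.2.1
      exact ⟨(Nat.mod_add_div _ _).symm, by rw [h3]; exact (Nat.mod_add_div _ _).symm⟩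
    have hinj : Set.InjOn (fun p : ℕ × ℕ => p.1 % b ^ L) T := by
      intro p hp p' hp' h
      obtain ⟨h1, h2⟩ := hdec p hp
      obtain ⟨h1', h2'⟩ := hdec p' hp'
      simp only at h
      ext
      · rw [h1, h1', h]
      · rw [h2, h2', h]
    rw [← card_image_of_injOn hinj]
    have hL : (((b ^ L : ℕ) : ℝ)) = (b : ℝ) ^ L := by push_cast; rfl
    have h := card_sublevel_le
      (fun y => jet b γ i n (y + k.1) - jet b γ i n (y + k.2))
      (fun y => 2 * Real.pi * jet b γ (i + 1) n (y + k.1) -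
        2 * Real.pi * jet b γ (i + 1) n (y + k.2))
      (fun y => by
        have h1 := (hasDerivAt_jet b γ i n (y + k.1)).comp_add_const y (k.1 : ℝ)
        have h2 := (hasDerivAt_jet b γ i n (y + k.2)).comp_add_const y (k.2 : ℝ)
        exact h1.sub h2) K
      (fun y z => by
        have h1 := abs_jet_sub_le hb hγ hγ1 (i + 1) n (y + k.1) (z + k.1)
        have h2 := abs_jet_sub_le hb hγ hγ1 (i + 1) n (y + k.2) (z + k.2)
        rw [add_sub_add_right_eq_sub] at h1 h2
        have h3 := abs_sub (jet b γ (i + 1) n (y + k.1) - jet b γ (i + 1) n (z + k.1))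
          (jet b γ (i + 1) n (y + k.2) - jet b γ (i + 1) n (z + k.2))
        rw [show 2 * Real.pi * jet b γ (i + 1) n (y + k.1) -
          2 * Real.pi * jet b γ (i + 1) n (y + k.2)
          - (2 * Real.pi * jet b γ (i + 1) n (z + k.1) - 2 * Real.pi * jet b γ (i + 1) n (z + k.2))
          = 2 * Real.pi * ((jet b γ (i + 1) n (y + k.1) - jet b γ (i + 1) n (z + k.1))
            - (jet b γ (i + 1) n (y + k.2) - jet b γ (i + 1) n (z + k.2))) by ring,
          abs_mul, abs_of_pos (by positivity : 0 < 2 * Real.pi), hKdef, mul_assoc (2 * Real.pi)]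
        gcongr
        linarith)
      (2 * Real.pi * c) (A * η ^ n) (by positivity) (by positivity) P (b ^ L) hPK hP0
      (by positivity)
      (T.image fun p => p.1 % b ^ L) (by
        intro x hx
        obtain ⟨p, hp, rfl⟩ := mem_image.1 hx
        obtain ⟨h1, h2⟩ := hdec p hp
        obtain ⟨-, -, -, h3, h4⟩ := hS p (mem_filter.1 hp).1
        have e1 : (p.1 : ℝ) / (b : ℝ) ^ L = ((p.1 % b ^ L : ℕ) : ℝ) / (b ^ L : ℕ) + k.1 := by
          have : (p.1 : ℝ) = ((p.1 % b ^ L + b ^ L * k.1 : ℕ) : ℝ) := by rw [← h1]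
          rw [this]; push_cast; field_simp
        have e2 : (p.2 : ℝ) / (b : ℝ) ^ L = ((p.1 % b ^ L : ℕ) : ℝ) / (b ^ L : ℕ) + k.2 := by
          have : (p.2 : ℝ) = ((p.1 % b ^ L + b ^ L * k.2 : ℕ) : ℝ) := by rw [← h2]
          rw [this]; push_cast; field_simp
        rw [e1, e2] at h3 h4
        refine ⟨Nat.mod_lt _ (by positivity), h3, ?_⟩
        rw [← mul_sub, abs_mul, abs_of_pos (by positivity : 0 < 2 * Real.pi)]
        gcongr)
    refine h.trans ?_
    rw [hL, mul_assoc (P : ℝ)]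
    gcongr
    rw [add_mul, one_mul]
    apply add_le_add _ hLn
    apply le_of_eq
    ring
  rw [card_eq_sum_card_fiberwise hmaps]
  push_cast
  calc _ ≤ ∑ _p ∈ range (b ^ n) ×ˢ range (b ^ n),
        P * (4 * A / (2 * Real.pi * c) + 1) * (η ^ n * (b : ℝ) ^ L) := sum_le_sum hfib
    _ = _ := by
      rw [sum_const, nsmul_eq_mul, card_product, card_range, pow_add, mul_pow]
      push_cast
      ring

open Classical in
/-- Weighted number of pairs of words over a common base point whose jets agree. -/
noncomputable def energy (b : ℕ) (γ : ℝ) (i : ℕ) (A : ℝ) (ω : ℕ → ℝ) (L n : ℕ) : ℝ :=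
  ∑ z ∈ range (b ^ (L + n)), ∑ z' ∈ range (b ^ (L + n)),
    if z % b ^ L = z' % b ^ L ∧ Close b γ i n A (z / (b : ℝ) ^ L) (z' / (b : ℝ) ^ L)
      then ω z * ω z' else 0

lemma sum_range_eq_sum_fiber (hb : 2 ≤ b) (D L : ℕ) (F : ℕ → ℝ) :
    ∑ z ∈ range (b ^ D), F z
      = ∑ c ∈ range (b ^ L), ∑ z ∈ range (b ^ D) with z % b ^ L = c, F z := by
  rw [sum_fiberwise_of_maps_to]
  intro z _
  rw [mem_range]
  exact Nat.mod_lt _ (by positivity)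

open Classical in
lemma energy_eq_sum_fiber (hb : 2 ≤ b) (i : ℕ) (A : ℝ) (ω : ℕ → ℝ) (L n : ℕ) :
    energy b γ i A ω L n = ∑ c ∈ range (b ^ L),
      ∑ z ∈ range (b ^ (L + n)) with z % b ^ L = c, ∑ z' ∈ range (b ^ (L + n)) with z' % b ^ L = c,
        if Close b γ i n A (z / (b : ℝ) ^ L) (z' / (b : ℝ) ^ L) then ω z * ω z' else 0 := by
  unfold energy
  rw [sum_range_eq_sum_fiber hb (L + n) L]
  refine sum_congr rfl fun c _ => sum_congr rfl fun z hz => ?_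
  rw [sum_filter]
  refine sum_congr rfl fun z' _ => ?_
  rw [(mem_filter.1 hz).2]
  by_cases h : z' % b ^ L = c
  · simp [h]
  · simp [h, Ne.symm h]

end

section
variable {b : ℕ} {γ : ℝ}

/-- Closeness at depth `q + n` forces tangency at depth `q`, or else the next derivative of the
difference is large. -/
lemma Close.tangent_or (hb : 2 ≤ b) (hγ : 0 < γ) (hγ1 : γ < 1) {i q n L z z' : ℕ} {A : ℝ}
    (hA : 0 ≤ A)
    (h : Close b γ i (q + n) A (z / (b : ℝ) ^ L) (z' / (b : ℝ) ^ L)) :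
    Close b γ (i + 1) q (A + 2 * (1 / (1 - γ)) + 1) ((z % b ^ (L + q) : ℕ) / (b : ℝ) ^ L)
      ((z' % b ^ (L + q) : ℕ) / (b : ℝ) ^ L) ∨
    rate b γ (i + 1) ^ q ≤ |jet b γ (i + 1) (q + n) (z / (b : ℝ) ^ L)
      - jet b γ (i + 1) (q + n) (z' / (b : ℝ) ^ L)| := by
  by_contra! hcon
  obtain ⟨h1, h2⟩ := hcon
  apply h1
  have hM : 0 < 1 / (1 - γ) := by apply div_pos one_pos; linarith
  have key : ∀ l, ∀ B : ℝ, |jet b γ l (q + n) (z / (b : ℝ) ^ L)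
      - jet b γ l (q + n) (z' / (b : ℝ) ^ L)| ≤ B * rate b γ l ^ q →
      |jet b γ l q ((z % b ^ (L + q) : ℕ) / (b : ℝ) ^ L)
        - jet b γ l q ((z' % b ^ (L + q) : ℕ) / (b : ℝ) ^ L)|
        ≤ (B + 2 * (1 / (1 - γ))) * rate b γ l ^ q := by
    intro l B hB
    rw [jet_div_pow_add hb, jet_div_pow_add hb] at hB
    have hη := pow_pos (rate_pos hb hγ l) q
    have e1 := abs_jet_le' hb hγ hγ1 l n (z / (b : ℝ) ^ (L + q))
    have e2 := abs_jet_le' hb hγ hγ1 l n (z' / (b : ℝ) ^ (L + q))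
    have e3 : |rate b γ l ^ q * (jet b γ l n (z / (b : ℝ) ^ (L + q))
        - jet b γ l n (z' / (b : ℝ) ^ (L + q)))| ≤ 2 * (1 / (1 - γ)) * rate b γ l ^ q := by
      rw [abs_mul, abs_of_pos hη, mul_comm]
      gcongr
      have := abs_sub (jet b γ l n (z / (b : ℝ) ^ (L + q))) (jet b γ l n (z' / (b : ℝ) ^ (L + q)))
      linarith
    rw [abs_le] at *
    constructor <;> linarith
  intro l hl
  have hη := pow_pos (rate_pos hb hγ l) q
  rcases Nat.lt_or_ge i l with hil | hil
  · obtain rfl : l = i + 1 := by omega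
    refine (key (i + 1) 1 (by rw [one_mul]; exact h2.le)).trans ?_
    exact mul_le_mul_of_nonneg_right (by linarith) hη.le
  · refine (key l A ((h l hil).trans ?_)).trans ?_
    · rw [pow_add]
      have : rate b γ l ^ n ≤ 1 := pow_le_one₀ (rate_pos hb hγ l).le (rate_lt_one hb hγ hγ1 l).le
      gcongr
      exact mul_le_of_le_one_right hη.le this
    · exact mul_le_mul_of_nonneg_right (by linarith) hη.le

open Classical in
lemma exists_energy_add_le (hb : 2 ≤ b) (hγ : 0 < γ) (hγ1 : γ < 1) (i : ℕ) (A : ℝ) (hA : 0 < A)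
    (q : ℕ) :
    ∃ C : ℝ, 0 ≤ C ∧ ∀ L n : ℕ, 1 ≤ rate b γ i ^ (q + n) * (b : ℝ) ^ L → ∀ ω e : ℕ → ℝ,
      (∀ z, 0 ≤ ω z) → (∀ z, ω z ≤ 1) → (∀ z, 0 ≤ e z) → (∀ z, e z ≤ 1) →
      (∀ c < b ^ (L + q), ∑ c' ∈ range (b ^ (L + q)),
        (if c % b ^ L = c' % b ^ L ∧ Close b γ (i + 1) q (A + 2 * (1 / (1 - γ)) + 1)
          (c / (b : ℝ) ^ L) (c' / (b : ℝ) ^ L) then e c * e c' else 0) ≤ 2) →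
      energy b γ i A (fun z => ω z * e (z % b ^ (L + q))) L (q + n)
        ≤ 2 * 3 ^ (i + 1) * energy b γ i A ω (L + q) n
          + C * ((b : ℝ) ^ (L + (q + n)) * (b * rate b γ i) ^ (q + n)) := by
  obtain ⟨C, hC0, hC⟩ := exists_card_nontangent_le hb hγ hγ1 i A hA.le (rate b γ (i + 1) ^ q)
    (pow_pos (rate_pos hb hγ _) _)
  refine ⟨C, hC0, fun L n hLn ω e hω0 hω1 he0 he1 ht2 => ?_⟩
  set A2 := A + 2 * (1 / (1 - γ)) + 1 with hA2
  set D := L + (q + n) with hD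
  set t : ℕ → ℕ → ℝ := fun c c' => if c % b ^ L = c' % b ^ L ∧ Close b γ (i + 1) q A2
          (c / (b : ℝ) ^ L) (c' / (b : ℝ) ^ L) then e c * e c' else 0 with ht
  have ht0 : ∀ c c', 0 ≤ t c c' := by
    intro c c'
    simp only [ht]
    split_ifs
    · exact mul_nonneg (he0 _) (he0 _)
    · exact le_rfl
  have htsymm : ∀ c c', t c c' = t c' c := by
    intro c c'
    simp only [ht]
    refine if_congr ⟨fun h => ⟨h.1.symm, h.2.symm⟩, fun h => ⟨h.1.symm, h.2.symm⟩⟩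
      (mul_comm _ _) rfl
  set NT : ℕ → ℕ → Prop := fun z z' => z % b ^ L = z' % b ^ L ∧
    |jet b γ i (q + n) (z / (b : ℝ) ^ L) - jet b γ i (q + n) (z' / (b : ℝ) ^ L)|
      ≤ A * rate b γ i ^ (q + n) ∧
    rate b γ (i + 1) ^ q ≤ |jet b γ (i + 1) (q + n) (z / (b : ℝ) ^ L)
      - jet b γ (i + 1) (q + n) (z' / (b : ℝ) ^ L)| with hNT
  set R : ℕ → ℕ → Prop := fun z z' =>
    Close b γ i (q + n) A (z / (b : ℝ) ^ L) (z' / (b : ℝ) ^ L) with hR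
  set m : ℕ → ℕ := fun z => z % b ^ (L + q) with hm
  have hpt : ∀ z z', (if z % b ^ L = z' % b ^ L ∧ R z z' then
      (ω z * e (m z)) * (ω z' * e (m z')) else 0)
      ≤ t (m z) (m z') * (if R z z' then ω z * ω z' else 0) + if NT z z' then (1 : ℝ) else 0 := by
    intro z z'
    have hdvd : b ^ L ∣ b ^ (L + q) := pow_dvd_pow _ (by omega)
    by_cases h : z % b ^ L = z' % b ^ L ∧ R z z'
    · rw [if_pos h, if_pos h.2]
      rcases h.2.tangent_or hb hγ hγ1 hA.le with hT | hN
      · have : t (m z) (m z') = e (m z) * e (m z') := by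
          simp only [ht]
          rw [if_pos]
          refine ⟨?_, hT⟩
          simp only [hm]
          rw [Nat.mod_mod_of_dvd _ hdvd, Nat.mod_mod_of_dvd _ hdvd, h.1]
        rw [this]
        have : (0 : ℝ) ≤ if NT z z' then (1 : ℝ) else 0 := by split_ifs <;> norm_num
        nlinarith
      · rw [if_pos (show NT z z' from ⟨h.1, h.2 i le_rfl, hN⟩)]
        have h1 : ω z * e (m z) * (ω z' * e (m z')) ≤ 1 := by
          have h3 := mul_le_one₀ (hω1 z) (he0 (m z)) (he1 (m z))
          have h4 := mul_le_one₀ (hω1 z') (he0 (m z')) (he1 (m z'))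
          exact mul_le_one₀ h3 (mul_nonneg (hω0 _) (he0 _)) h4
        have := mul_nonneg (ht0 (m z) (m z')) (mul_nonneg (hω0 z) (hω0 z'))
        linarith
    · rw [if_neg h]
      have h1 : (0 : ℝ) ≤ if NT z z' then (1 : ℝ) else 0 := by split_ifs <;> norm_num
      have h2 : (0 : ℝ) ≤ if R z z' then ω z * ω z' else 0 := by
        split_ifs
        · exact mul_nonneg (hω0 _) (hω0 _)
        · exact le_rfl
      have := mul_nonneg (ht0 (m z) (m z')) h2
      linarith
  have hsumNT : ∑ z ∈ range (b ^ D), ∑ z' ∈ range (b ^ D), (if NT z z' then (1 : ℝ) else 0)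
      ≤ C * ((b : ℝ) ^ D * (b * rate b γ i) ^ (q + n)) := by
    rw [← sum_product' (f := fun z z' => if NT z z' then (1 : ℝ) else 0), ← sum_filter, sum_const,
      nsmul_eq_mul, mul_one]
    apply hC L (q + n) hLn
    intro p hp
    rw [mem_filter, mem_product, mem_range, mem_range] at hp
    exact ⟨hp.1.1, hp.1.2, hp.2⟩
  set S : ℕ → Finset ℕ := fun c => {z ∈ range (b ^ D) | z % b ^ (L + q) = c} with hS
  set E : ℕ → ℝ := fun c => ∑ z ∈ S c, ∑ z' ∈ S c,
    if Close b γ i n A (z / (b : ℝ) ^ (L + q)) (z' / (b : ℝ) ^ (L + q)) then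
      ω z * ω z' else 0 with hE
  have hE0 : ∀ c, 0 ≤ E c := by
    intro c
    refine sum_nonneg fun z _ => sum_nonneg fun z' _ => ?_
    split_ifs
    · exact mul_nonneg (hω0 _) (hω0 _)
    · exact le_rfl
  have hsumE : ∑ c ∈ range (b ^ (L + q)), E c = energy b γ i A ω (L + q) n := by
    rw [energy_eq_sum_fiber hb, add_assoc]
  have hcs : ∀ c c', ∑ z ∈ S c, ∑ z' ∈ S c', t c c' * (if R z z' then ω z * ω z' else 0)
      ≤ 3 ^ (i + 1) / 2 * (t c c' * E c + t c c' * E c') := by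
    intro c c'
    simp_rw [← mul_sum]
    have hη : ∀ l, 0 < rate b γ l := rate_pos hb hγ
    have := two_mul_sum_pairs_close_le i (S c) (S c') ω hω0
      (fun l z => jet b γ l n (z / (b : ℝ) ^ (L + q)))
      (fun l => (jet b γ l q (c / (b : ℝ) ^ L) - jet b γ l q (c' / (b : ℝ) ^ L)) / rate b γ l ^ q)
      (fun l => A * rate b γ l ^ n) (fun l => mul_pos hA (pow_pos (hη l) _)) R (by
        intro z hz z' hz' h l hl
        have h1 := h l hl
        have hz1 := (mem_filter.1 hz).2
        have hz1' := (mem_filter.1 hz').2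
        rw [jet_div_pow_add hb, jet_div_pow_add hb, hz1, hz1'] at h1
        have hq := pow_pos (hη l) q
        have e1 : jet b γ l n (z / (b : ℝ) ^ (L + q)) - jet b γ l n (z' / (b : ℝ) ^ (L + q))
            + (jet b γ l q (c / (b : ℝ) ^ L) - jet b γ l q (c' / (b : ℝ) ^ L)) / rate b γ l ^ q
            = (jet b γ l q (c / (b : ℝ) ^ L) + rate b γ l ^ q * jet b γ l n (z / (b : ℝ) ^ (L + q))
              - (jet b γ l q (c' / (b : ℝ) ^ L)
                + rate b γ l ^ q * jet b γ l n (z' / (b : ℝ) ^ (L + q)))) / rate b γ l ^ q := by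
          rw [eq_div_iff hq.ne', add_mul, div_mul_cancel₀ _ hq.ne']
          ring
        rw [e1, abs_div, abs_of_pos hq, div_le_iff₀ hq]
        exact h1.trans_eq (by rw [pow_add]; ring))
      (fun z z' => Close b γ i n A (z / (b : ℝ) ^ (L + q)) (z' / (b : ℝ) ^ (L + q)))
      (fun z _ z' _ h => h) (fun z _ z' _ h => h)
    have h2 := mul_le_mul_of_nonneg_left this (ht0 c c')
    simp only [hE]
    linarith
  calc energy b γ i A (fun z => ω z * e (z % b ^ (L + q))) L (q + n)
      ≤ ∑ z ∈ range (b ^ D), ∑ z' ∈ range (b ^ D),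
          (t (m z) (m z') * (if R z z' then ω z * ω z' else 0) + if NT z z' then (1 : ℝ) else 0) :=
        sum_le_sum fun z _ => sum_le_sum fun z' _ => hpt z z'
    _ = (∑ z ∈ range (b ^ D), ∑ z' ∈ range (b ^ D),
          t (m z) (m z') * (if R z z' then ω z * ω z' else 0))
        + ∑ z ∈ range (b ^ D), ∑ z' ∈ range (b ^ D), if NT z z' then (1 : ℝ) else 0 := by
        simp_rw [sum_add_distrib]
    _ ≤ 2 * 3 ^ (i + 1) * energy b γ i A ω (L + q) n
          + C * ((b : ℝ) ^ D * (b * rate b γ i) ^ (q + n)) := by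
        refine add_le_add ?_ hsumNT
        calc _ = ∑ c ∈ range (b ^ (L + q)), ∑ c' ∈ range (b ^ (L + q)),
              ∑ z ∈ S c, ∑ z' ∈ S c', t c c' * (if R z z' then ω z * ω z' else 0) := by
              rw [sum_range_eq_sum_fiber hb D (L + q)]
              refine sum_congr rfl fun c _ => ?_
              rw [sum_comm (s := range (b ^ (L + q)))]
              refine sum_congr rfl fun z hz => ?_
              rw [sum_range_eq_sum_fiber hb D (L + q)]
              refine sum_congr rfl fun c' _ => sum_congr rfl fun z' hz' => ?_
              simp only [hm]
              rw [(mem_filter.1 hz).2, (mem_filter.1 hz').2]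
          _ ≤ ∑ c ∈ range (b ^ (L + q)), ∑ c' ∈ range (b ^ (L + q)),
              3 ^ (i + 1) / 2 * (t c c' * E c + t c c' * E c') :=
              sum_le_sum fun c _ => sum_le_sum fun c' _ => hcs c c'
          _ = 3 ^ (i + 1) / 2 * (∑ c ∈ range (b ^ (L + q)), ∑ c' ∈ range (b ^ (L + q)), t c c' * E c
              + ∑ c ∈ range (b ^ (L + q)), ∑ c' ∈ range (b ^ (L + q)), t c c' * E c') := by
              simp_rw [← mul_sum, sum_add_distrib]
          _ = 3 ^ (i + 1) * ∑ c ∈ range (b ^ (L + q)),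
                (∑ c' ∈ range (b ^ (L + q)), t c c') * E c := by
              rw [sum_comm (f := fun c c' => t c c' * E c')]
              have h1 : ∑ c' ∈ range (b ^ (L + q)), ∑ c ∈ range (b ^ (L + q)), t c c' * E c'
                  = ∑ c ∈ range (b ^ (L + q)), ∑ c' ∈ range (b ^ (L + q)), t c c' * E c :=
                sum_congr rfl fun c _ => sum_congr rfl fun c' _ => by rw [htsymm]
              rw [h1]
              simp_rw [sum_mul]
              ring
          _ ≤ 3 ^ (i + 1) * ∑ c ∈ range (b ^ (L + q)), 2 * E c := by
              gcongr with c hc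
              · exact hE0 c
              · exact ht2 c (mem_range.1 hc)
          _ = _ := by rw [← mul_sum, hsumE]; ring

end

lemma sum_range_mul_eq {M : Type*} [AddCommMonoid M] (A B : ℕ) (F : ℕ → M) :
    ∑ z ∈ range (A * B), F z = ∑ u ∈ range A, ∑ v ∈ range B, F (u + A * v) := by
  rw [sum_comm]
  induction B with
  | zero => simp
  | succ B ih => rw [Nat.mul_succ, sum_range_add, sum_range_succ, ih]; simp [add_comm]

lemma sum_prod_digits (b : ℕ) (hb : 0 < b) (Q R : ℕ) (φ : ℕ → ℕ) (m a : ℕ) :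
    ∑ z ∈ range (b ^ (a + (Q * m + R))), ∏ k ∈ range m, φ (z / b ^ (a + Q * k) % b ^ Q)
      = b ^ a * (∑ w ∈ range (b ^ Q), φ w) ^ m * b ^ R := by
  have hstrip : ∀ (a N : ℕ) (G : ℕ → ℕ), ∑ z ∈ range (b ^ (a + N)), G (z / b ^ a)
      = b ^ a * ∑ v ∈ range (b ^ N), G v := by
    intro a N G
    rw [pow_add, sum_range_mul_eq]
    have : ∀ u ∈ range (b ^ a), ∑ v ∈ range (b ^ N), G ((u + b ^ a * v) / b ^ a)
        = ∑ v ∈ range (b ^ N), G v := by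
      intro u hu
      refine sum_congr rfl fun v _ => ?_
      rw [Nat.add_mul_div_left _ _ (by positivity), Nat.div_eq_of_lt (mem_range.1 hu), zero_add]
    rw [sum_congr rfl this, sum_const, card_range, smul_eq_mul]
  have hdiv : ∀ a z k, z / b ^ (a + Q * k) % b ^ Q = z / b ^ a / b ^ (Q * k) % b ^ Q := by
    intro a z k
    rw [Nat.div_div_eq_div_mul, pow_add]
  have hzero : ∀ m, ∑ z ∈ range (b ^ (Q * m + R)), ∏ k ∈ range m, φ (z / b ^ (Q * k) % b ^ Q)
      = (∑ w ∈ range (b ^ Q), φ w) ^ m * b ^ R := by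
    intro m
    induction m with
    | zero => simp
    | succ m ih =>
      rw [show Q * (m + 1) + R = Q + (Q * m + R) by ring, pow_add, sum_range_mul_eq]
      have : ∀ u ∈ range (b ^ Q), ∀ v ∈ range (b ^ (Q * m + R)),
          ∏ k ∈ range (m + 1), φ ((u + b ^ Q * v) / b ^ (Q * k) % b ^ Q)
          = φ u * ∏ k ∈ range m, φ (v / b ^ (Q * k) % b ^ Q) := by
        intro u hu v _
        rw [prod_range_succ', mul_comm]
        congr 1
        · simp [Nat.mod_eq_of_lt (mem_range.1 hu)]
        · refine prod_congr rfl fun k _ => ?_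
          rw [show Q * (k + 1) = Q + Q * k by ring, pow_add, ← Nat.div_div_eq_div_mul,
            Nat.add_mul_div_left _ _ (by positivity), Nat.div_eq_of_lt (mem_range.1 hu), zero_add]
      rw [sum_congr rfl fun u hu => sum_congr rfl (this u hu)]
      simp_rw [← mul_sum]
      rw [ih, ← sum_mul, pow_succ]
      ring
  simp_rw [hdiv]
  rw [hstrip a _ fun z => ∏ k ∈ range m, φ (z / b ^ (Q * k) % b ^ Q), hzero, mul_assoc]

lemma card_frequent_class_le (b : ℕ) (hb : 0 < b) (Q m a D M : ℕ) (hD : a + Q * m ≤ D)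
    (B : Finset ℕ) (hB : 4 ^ M * B.card ≤ b ^ Q) :
    #{z ∈ range (b ^ D) | m < M * #{k ∈ range m | z / b ^ (a + Q * k) % b ^ Q ∈ B}} * 2 ^ m
      ≤ b ^ D := by
  obtain ⟨R, rfl⟩ := Nat.exists_eq_add_of_le hD
  set φ : ℕ → ℕ := fun w => if w ∈ B then 4 ^ M else 1 with hφ
  have h1 := sum_prod_digits b hb Q R φ m a
  rw [← add_assoc] at h1
  have hφsum : ∑ w ∈ range (b ^ Q), φ w ≤ 2 * b ^ Q := by
    calc ∑ w ∈ range (b ^ Q), φ w ≤ ∑ w ∈ range (b ^ Q), ((if w ∈ B then 4 ^ M else 0) + 1) := by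
          refine sum_le_sum fun w _ => ?_
          simp only [hφ]; split_ifs <;> simp
      _ = #{w ∈ range (b ^ Q) | w ∈ B} * 4 ^ M + b ^ Q := by
          rw [sum_add_distrib, ← sum_filter, sum_const]; simp
      _ ≤ B.card * 4 ^ M + b ^ Q := by
          gcongr
          exact fun w hw => (mem_filter.1 hw).2
      _ ≤ _ := by rw [mul_comm]; omega
  have h2 : #{z ∈ range (b ^ (a + Q * m + R)) |
      m < M * #{k ∈ range m | z / b ^ (a + Q * k) % b ^ Q ∈ B}} * 4 ^ m
      ≤ ∑ z ∈ range (b ^ (a + Q * m + R)), ∏ k ∈ range m, φ (z / b ^ (a + Q * k) % b ^ Q) := by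
    rw [← smul_eq_mul, ← sum_const, sum_filter]
    refine sum_le_sum fun z _ => ?_
    split_ifs with h
    · simp only [hφ]
      rw [prod_ite, prod_const, prod_const_one, mul_one, ← pow_mul]
      exact Nat.pow_le_pow_right (by norm_num) h.le
    · exact Nat.zero_le _
  rw [h1] at h2
  have h3 : b ^ a * (∑ w ∈ range (b ^ Q), φ w) ^ m * b ^ R ≤ 2 ^ m * b ^ (a + Q * m + R) := by
    calc _ ≤ b ^ a * (2 * b ^ Q) ^ m * b ^ R := by gcongr
      _ = _ := by rw [mul_pow, ← pow_mul, pow_add, pow_add]; ring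
  have h4 := h2.trans h3
  rw [show (4 : ℕ) ^ m = 2 ^ m * 2 ^ m by rw [← mul_pow]; norm_num, ← mul_assoc,
    mul_comm (2 ^ m) (b ^ _)] at h4
  exact Nat.le_of_mul_le_mul_right h4 (by positivity)

/-- Few words have many occurrences of a rare pattern. -/
lemma card_frequent_le (b : ℕ) (hb : 0 < b) (q H m a D M : ℕ)
    (hD : a + H * q + (H + 1) * q * m ≤ D)
    (B : Finset ℕ) (hB : 4 ^ M * B.card ≤ b ^ ((H + 1) * q)) :
    #{z ∈ range (b ^ D) | (H + 1) * m
        < M * #{j ∈ range ((H + 1) * m) | z / b ^ (a + q * j) % b ^ ((H + 1) * q) ∈ B}} * 2 ^ m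
      ≤ (H + 1) * b ^ D := by
  have hsub : {z ∈ range (b ^ D) | (H + 1) * m
        < M * #{j ∈ range ((H + 1) * m) | z / b ^ (a + q * j) % b ^ ((H + 1) * q) ∈ B}}
      ⊆ (range (H + 1)).biUnion fun c => {z ∈ range (b ^ D) | m
        < M * #{k ∈ range m | z / b ^ (a + q * c + (H + 1) * q * k) % b ^ ((H + 1) * q) ∈ B}} := by
    intro z hz
    rw [mem_filter] at hz
    rw [mem_biUnion]
    by_contra! hcon
    have h1 : ∀ c ∈ range (H + 1),
        M * #{k ∈ range m | z / b ^ (a + q * c + (H + 1) * q * k) % b ^ ((H + 1) * q) ∈ B} ≤ m := by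
      intro c hc
      by_contra! h
      exact hcon c hc (mem_filter.2 ⟨hz.1, h⟩)
    have h2 := sum_le_sum h1
    rw [← mul_sum, sum_const, card_range, smul_eq_mul] at h2
    refine absurd hz.2 (not_lt.2 (le_trans (le_of_eq ?_) h2))
    congr 1
    rw [card_filter, sum_range_mul_eq]
    refine sum_congr rfl fun c _ => ?_
    rw [card_filter]
    refine sum_congr rfl fun k _ => ?_
    rw [show a + q * (c + (H + 1) * k) = a + q * c + (H + 1) * q * k by ring]
  calc _ ≤ (∑ c ∈ range (H + 1), #{z ∈ range (b ^ D) | m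
        < M * #{k ∈ range m | z / b ^ (a + q * c + (H + 1) * q * k) % b ^ ((H + 1) * q) ∈ B}})
          * 2 ^ m := by
        gcongr
        exact (card_le_card hsub).trans card_biUnion_le
    _ ≤ ∑ _c ∈ range (H + 1), b ^ D := by
        rw [sum_mul]
        refine sum_le_sum fun c hc => card_frequent_class_le b hb _ m _ D M ?_ B hB
        have : q * c ≤ H * q := by
          rw [mul_comm]; exact Nat.mul_le_mul_right _ (by simpa [Nat.lt_succ_iff] using hc)
        omega
    _ = _ := by simp

open Classical in
/-- Outside the exceptional words `B`, every word has at most `T` good words close to it. -/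
def FewClose (b : ℕ) (γ : ℝ) (H i n : ℕ) (A : ℝ) (B : Finset ℕ) (T : ℝ) : Prop :=
  ∀ y : ℝ, 0 ≤ y → y < 1 → ∀ k < b ^ n, ⌊(b : ℝ) ^ (H * n) * (y + k)⌋₊ ∉ B →
    (#{k' ∈ range (b ^ n) | ⌊(b : ℝ) ^ (H * n) * (y + (k' : ℕ))⌋₊ ∉ B ∧
      Close b γ i n A (y + k) (y + (k' : ℕ))} : ℝ) ≤ T

/-- Product over the letters of a word of the weights of the blocks seen from them. -/
noncomputable def blockWeight (b q Q : ℕ) (e : ℕ → ℝ) (a J z : ℕ) : ℝ :=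
  ∏ j ∈ range J, e (z / b ^ (a + q * j) % b ^ Q)

section
variable {b : ℕ} {γ : ℝ}

open Classical in
lemma sum_tangent_le (hb : 2 ≤ b) {H i q : ℕ} {A s : ℝ} (hs : 1 ≤ s) {B : Finset ℕ}
    (hB : FewClose b γ H i q A B ((s ^ 2) ^ q)) {L : ℕ} (hL : H * q ≤ L) (e : ℕ → ℝ)
    (he : ∀ w, e w = if w ∈ B then ((b : ℝ) ^ q)⁻¹ else (s ^ q)⁻¹) (c : ℕ) (hc : c < b ^ (L + q)) :
    ∑ c' ∈ range (b ^ (L + q)),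
        (if c % b ^ L = c' % b ^ L ∧ Close b γ i q A (c / (b : ℝ) ^ L) (c' / (b : ℝ) ^ L)
        then e (c / b ^ (L - H * q)) * e (c' / b ^ (L - H * q)) else 0) ≤ 2 := by
  have hb0 : (0 : ℝ) < b := by positivity
  have hbn : 0 < b := by omega
  have hbq : (1 : ℝ) ≤ (b : ℝ) ^ q := one_le_pow₀ (by exact_mod_cast hbn)
  have hsq : (1 : ℝ) ≤ s ^ q := one_le_pow₀ hs
  have hbi : ((b : ℝ) ^ q)⁻¹ ≤ 1 := inv_le_one_of_one_le₀ hbq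
  have hsi : (s ^ q)⁻¹ ≤ 1 := inv_le_one_of_one_le₀ hsq
  have hbi0 : 0 < ((b : ℝ) ^ q)⁻¹ := by positivity
  have hsi0 : 0 < (s ^ q)⁻¹ := by positivity
  set a := L - H * q with ha
  have hLa : L = a + H * q := by omega
  set y : ℝ := ((c % b ^ L : ℕ) : ℝ) / (b : ℝ) ^ L with hy
  have hy0 : 0 ≤ y := by positivity
  have hy1 : y < 1 := by
    rw [hy, div_lt_one (by positivity)]
    exact_mod_cast Nat.mod_lt c (by positivity)
  have hpt : ∀ c', c' % b ^ L = c % b ^ L → (c' : ℝ) / (b : ℝ) ^ L = y + (c' / b ^ L : ℕ) := by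
    intro c' h
    have h1 : ((c' % b ^ L + b ^ L * (c' / b ^ L) : ℕ) : ℝ) = c' := by rw [Nat.mod_add_div]
    rw [← h1, h, hy]
    push_cast
    field_simp
  have hfl : ∀ c', c' % b ^ L = c % b ^ L →
      ⌊(b : ℝ) ^ (H * q) * (y + (c' / b ^ L : ℕ))⌋₊ = c' / b ^ a := by
    intro c' h
    rw [← hpt c' h, ← Nat.floor_div_eq_div (K := ℝ)]
    congr 1
    rw [hLa, pow_add]
    push_cast
    field_simp
  set S : Finset ℕ := {c' ∈ range (b ^ (L + q)) | c % b ^ L = c' % b ^ L ∧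
    Close b γ i q A (c / (b : ℝ) ^ L) (c' / (b : ℝ) ^ L)} with hS
  have hinj : ∀ S' ⊆ S, Set.InjOn (fun c' => c' / b ^ L) S' := by
    intro S' hS' c1 h1 c2 h2 h
    have e1 := (mem_filter.1 (hS' h1)).2.1
    have e2 := (mem_filter.1 (hS' h2)).2.1
    simp only at h
    rw [← Nat.mod_add_div c1 (b ^ L), ← Nat.mod_add_div c2 (b ^ L), ← e1, ← e2, h]
  have hlt : ∀ c' < b ^ (L + q), c' / b ^ L < b ^ q := by
    intro c' h
    rw [pow_add] at h
    exact Nat.div_lt_of_lt_mul h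
  have hScard : (S.card : ℝ) ≤ (b : ℝ) ^ q := by
    have : S.card ≤ b ^ q := by
      rw [← card_range (b ^ q)]
      refine card_le_card_of_injOn _ ?_ (hinj S subset_rfl)
      intro c' h
      simp only [coe_range, Set.mem_Iio]
      exact hlt c' (mem_range.1 (mem_filter.1 h).1)
    exact_mod_cast this
  set G : Finset ℕ := {c' ∈ S | c / b ^ a ∉ B ∧ c' / b ^ a ∉ B} with hG
  have hGcard : (G.card : ℝ) ≤ (s ^ 2) ^ q := by
    by_cases hcB : c / b ^ a ∈ B
    · have : G = ∅ := by
        rw [hG, filter_eq_empty_iff]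
        tauto
      rw [this, card_empty, Nat.cast_zero]
      positivity
    have h1 := hB y hy0 hy1 (c / b ^ L) (hlt c hc) (by rwa [hfl c rfl])
    refine le_trans ?_ h1
    refine Nat.cast_le.2 (card_le_card_of_injOn (fun c' => c' / b ^ L) ?_
      (hinj G (filter_subset _ _)))
    intro c' h
    simp only
    obtain ⟨h2, -, h3⟩ := mem_filter.1 h
    obtain ⟨h4, h5, h6⟩ := mem_filter.1 h2
    rw [hpt c rfl, hpt c' h5.symm] at h6
    rw [mem_coe, mem_filter, mem_range]
    exact ⟨hlt c' (mem_range.1 h4), by rwa [hfl c' h5.symm], h6⟩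
  have hterm : ∀ c' ∈ S, e (c / b ^ a) * e (c' / b ^ a)
      ≤ ((b : ℝ) ^ q)⁻¹ + if (c / b ^ a ∉ B ∧ c' / b ^ a ∉ B) then ((s ^ 2) ^ q)⁻¹ else 0 := by
    intro c' _
    rw [he, he]
    by_cases h1 : c / b ^ a ∈ B
    · rw [if_pos h1,
          if_neg (c := c / b ^ a ∉ B ∧ c' / b ^ a ∉ B) fun h => h.1 h1, add_zero]
      refine mul_le_of_le_one_right hbi0.le ?_
      split_ifs <;> assumption
    · by_cases h2 : c' / b ^ a ∈ B
      · rw [if_neg h1, if_pos h2,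
          if_neg (c := c / b ^ a ∉ B ∧ c' / b ^ a ∉ B) fun h => h.2 h2, add_zero]
        exact mul_le_of_le_one_left hbi0.le hsi
      · rw [if_neg h1, if_neg h2, if_pos ⟨h1, h2⟩, ← mul_inv, ← mul_pow, ← sq]
        linarith
  rw [← sum_filter]
  calc _ ≤ ∑ c' ∈ S, (((b : ℝ) ^ q)⁻¹
        + if (c / b ^ a ∉ B ∧ c' / b ^ a ∉ B) then ((s ^ 2) ^ q)⁻¹ else 0) := sum_le_sum hterm
    _ = S.card * ((b : ℝ) ^ q)⁻¹ + G.card * ((s ^ 2) ^ q)⁻¹ := by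
        rw [sum_add_distrib, ← sum_filter, sum_const, sum_const, nsmul_eq_mul, nsmul_eq_mul]
    _ ≤ (b : ℝ) ^ q * ((b : ℝ) ^ q)⁻¹ + (s ^ 2) ^ q * ((s ^ 2) ^ q)⁻¹ := by gcongr
    _ = 2 := by
        rw [mul_inv_cancel₀ (by positivity), mul_inv_cancel₀ (by positivity)]
        norm_num

lemma blockWeight_nonneg {q Q : ℕ} {e : ℕ → ℝ} (he : ∀ w, 0 ≤ e w) (a J z : ℕ) :
    0 ≤ blockWeight b q Q e a J z := prod_nonneg fun _ _ => he _

lemma blockWeight_le_one {q Q : ℕ} {e : ℕ → ℝ} (he : ∀ w, 0 ≤ e w) (he1 : ∀ w, e w ≤ 1)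
    (a J z : ℕ) : blockWeight b q Q e a J z ≤ 1 := prod_le_one (fun _ _ => he _) fun _ _ => he1 _

lemma blockWeight_succ (q Q : ℕ) (e : ℕ → ℝ) (a J z : ℕ) :
    blockWeight b q Q e a (J + 1) z
      = blockWeight b q Q e (a + q) J z * e (z % b ^ (a + Q) / b ^ a) := by
  unfold blockWeight
  rw [prod_range_succ']
  congr 1
  · refine prod_congr rfl fun j _ => ?_
    rw [show a + q * (j + 1) = a + q + q * j by ring]
  · rw [mul_zero, add_zero, pow_add, Nat.mod_mul_right_div_self]

lemma energy_le_trivial (hb : 2 ≤ b) (i : ℕ) (A : ℝ) (ω : ℕ → ℝ) (h0 : ∀ z, 0 ≤ ω z)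
    (h1 : ∀ z, ω z ≤ 1) (L n : ℕ) : energy b γ i A ω L n ≤ (b : ℝ) ^ (L + n) * (b : ℝ) ^ n := by
  classical
  rw [energy_eq_sum_fiber hb]
  have hfib : ∀ c ∈ range (b ^ L), #{z ∈ range (b ^ (L + n)) | z % b ^ L = c} ≤ b ^ n := by
    intro c _
    rw [← card_range (b ^ n)]
    refine card_le_card_of_injOn (fun z => z / b ^ L) ?_ ?_
    · intro z hz
      have := (mem_filter.1 hz).1
      rw [mem_range, pow_add] at this
      simp only [coe_range, Set.mem_Iio]
      exact Nat.div_lt_of_lt_mul this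
    · intro z1 hz1 z2 hz2 h
      simp only at h
      rw [← Nat.mod_add_div z1 (b ^ L), ← Nat.mod_add_div z2 (b ^ L), (mem_filter.1 hz1).2,
        (mem_filter.1 hz2).2, h]
  calc _ ≤ ∑ c ∈ range (b ^ L), ∑ z ∈ range (b ^ (L + n)) with z % b ^ L = c,
        ∑ z' ∈ range (b ^ (L + n)) with z' % b ^ L = c, (1 : ℝ) := by
        refine sum_le_sum fun c _ => sum_le_sum fun z _ => sum_le_sum fun z' _ => ?_
        split_ifs
        · exact mul_le_one₀ (h1 z) (h0 z') (h1 z')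
        · norm_num
    _ ≤ ∑ c ∈ range (b ^ L), (b : ℝ) ^ n * (b : ℝ) ^ n := by
        refine sum_le_sum fun c hc => ?_
        have : (#{z ∈ range (b ^ (L + n)) | z % b ^ L = c} : ℝ) ≤ (b : ℝ) ^ n := by
          exact_mod_cast hfib c hc
        simp only [sum_const, nsmul_eq_mul, mul_one]
        gcongr
    _ = _ := by
        rw [sum_const, card_range, nsmul_eq_mul, pow_add]
        push_cast
        ring

lemma exists_energy_blockWeight_le (hb : 2 ≤ b) (hγ : 0 < γ) (hγ1 : γ < 1) (hbγ : 1 < γ * b)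
    {i H q : ℕ} {A s R : ℝ} (hA : 0 < A) (hs : 1 ≤ s) (hR : 1 ≤ R) (hRb : b * rate b γ i ≤ R)
    (hq : 4 * 3 ^ (i + 1) ≤ (R * s) ^ q) {B : Finset ℕ}
    (hB : FewClose b γ H (i + 1) q (A + 2 * (1 / (1 - γ)) + 1) B ((s ^ 2) ^ q)) (e : ℕ → ℝ)
    (he : ∀ w, e w = if w ∈ B then ((b : ℝ) ^ q)⁻¹ else (s ^ q)⁻¹) (r₀ : ℕ) :
    ∃ K : ℝ, 0 < K ∧ ∀ r ≤ r₀, ∀ J a : ℕ, (i + 1) * (q * J + r) ≤ a + H * q →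
      energy b γ i A (blockWeight b q ((H + 1) * q) e a J) (a + H * q) (q * J + r)
        ≤ K * ((b : ℝ) ^ (a + H * q + (q * J + r)) * (R * s) ^ (q * J + r)) := by
  obtain ⟨C, hC0, hC⟩ := exists_energy_add_le hb hγ hγ1 i A hA q
  have hb1 : (1 : ℝ) ≤ b := by exact_mod_cast (by omega : 1 ≤ b)
  have hRs : 1 ≤ R * s := one_le_mul_of_one_le_of_one_le hR hs
  have he0 : ∀ w, 0 ≤ e w := by
    intro w; rw [he]; split_ifs <;> positivity
  have he1 : ∀ w, e w ≤ 1 := by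
    intro w; rw [he]
    split_ifs
    · exact inv_le_one_of_one_le₀ (one_le_pow₀ hb1)
    · exact inv_le_one_of_one_le₀ (one_le_pow₀ hs)
  have hη := rate_pos hb hγ i
  set η := rate b γ i
  refine ⟨2 * C + (b : ℝ) ^ r₀, by positivity, fun r hr J => ?_⟩
  set K := 2 * C + (b : ℝ) ^ r₀ with hK
  have hbr : (0 : ℝ) < (b : ℝ) ^ r₀ := by positivity
  induction J with
  | zero =>
    intro a _
    refine (energy_le_trivial hb i A _ (blockWeight_nonneg he0 _ _)
      (blockWeight_le_one he0 he1 _ _) _ _).trans ?_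
    rw [mul_zero, zero_add, mul_comm K, mul_assoc]
    gcongr
    calc (b : ℝ) ^ r ≤ (b : ℝ) ^ r₀ := pow_le_pow_right₀ hb1 hr
      _ ≤ 1 * K := by linarith
      _ ≤ (R * s) ^ r * K := by
        gcongr
        exact one_le_pow₀ hRs
  | succ J ih =>
    intro a ha
    have hih := ih (a + q) (by
      refine le_trans (Nat.mul_le_mul_left _ ?_) (ha.trans (by omega))
      rw [Nat.mul_succ]; omega)
    set n := q * J + r with hn
    rw [show q * (J + 1) + r = q + n by rw [hn]; ring] at ha ⊢
    have hL1 : 1 ≤ η ^ (q + n) * (b : ℝ) ^ (a + H * q) := by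
      calc (1 : ℝ) ≤ (η * (b : ℝ) ^ (i + 1)) ^ (q + n) := one_le_pow₀ (one_le_rate_mul hb hbγ i)
        _ = η ^ (q + n) * (b : ℝ) ^ ((i + 1) * (q + n)) := by rw [mul_pow, ← pow_mul]
        _ ≤ _ := by gcongr
    have haQ : a + (H + 1) * q = a + H * q + q := by ring
    have hstep := hC (a + H * q) n hL1 (blockWeight b q ((H + 1) * q) e (a + q) J)
      (fun c => e (c / b ^ a)) (blockWeight_nonneg he0 _ _) (blockWeight_le_one he0 he1 _ _)
      (fun z => he0 _) (fun z => he1 _) (fun c hc => by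
        have := sum_tangent_le hb hs hB (L := a + H * q) (by omega) e he c hc
        rwa [Nat.add_sub_cancel] at this)
    have hw : (fun z => blockWeight b q ((H + 1) * q) e (a + q) J z
        * e (z % b ^ (a + H * q + q) / b ^ a)) = blockWeight b q ((H + 1) * q) e a (J + 1) := by
      funext z
      rw [blockWeight_succ, haQ]
    rw [hw] at hstep
    rw [show a + q + H * q = a + H * q + q by ring] at hih
    refine hstep.trans ?_
    set X := (b : ℝ) ^ (a + H * q + (q + n)) with hX
    have hX0 : 0 < X := by positivity
    rw [show a + H * q + q + n = a + H * q + (q + n) by ring] at hih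
    have h1 : 2 * 3 ^ (i + 1) * (K * (X * (R * s) ^ n)) ≤ K / 2 * (X * (R * s) ^ (q + n)) := by
      have h0 : 0 ≤ K * X * (R * s) ^ n := by positivity
      calc _ = K * X * (R * s) ^ n * (4 * 3 ^ (i + 1)) / 2 := by ring
        _ ≤ K * X * (R * s) ^ n * (R * s) ^ q / 2 := by gcongr
        _ = _ := by rw [pow_add (R * s)]; ring
    have h2 : C * (X * (b * η) ^ (q + n)) ≤ K / 2 * (X * (R * s) ^ (q + n)) := by
      have : (b * η) ^ (q + n) ≤ (R * s) ^ (q + n) :=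
        pow_le_pow_left₀ (by positivity) (hRb.trans (le_mul_of_one_le_right (by linarith) hs)) _
      gcongr
      linarith
    have h3 := mul_le_mul_of_nonneg_left hih (by positivity : (0 : ℝ) ≤ 2 * 3 ^ (i + 1))
    linarith

end

section
variable {b : ℕ} {γ : ℝ}

lemma one_le_rate_pow_mul (hb : 2 ≤ b) (hγ : 0 < γ) (hbγ : 1 < γ * b) {l H : ℕ} (hl : l + 1 ≤ H)
    (n : ℕ) : 1 ≤ rate b γ l ^ n * (b : ℝ) ^ (H * n) := by
  have := rate_pos hb hγ l
  have hb1 : (1 : ℝ) ≤ b := by exact_mod_cast (by omega : 1 ≤ b)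
  calc (1 : ℝ) ≤ (rate b γ l * (b : ℝ) ^ (l + 1)) ^ n := one_le_pow₀ (one_le_rate_mul hb hbγ l)
    _ = rate b γ l ^ n * (b : ℝ) ^ ((l + 1) * n) := by rw [mul_pow, ← pow_mul]
    _ ≤ _ := by gcongr

lemma floor_pow_mul_add (b L : ℕ) {y : ℝ} (hy : 0 ≤ y) (k : ℕ) :
    ⌊(b : ℝ) ^ L * (y + k)⌋₊ = ⌊(b : ℝ) ^ L * y⌋₊ + b ^ L * k := by
  rw [mul_add, show (b : ℝ) ^ L * (k : ℝ) = ((b ^ L * k : ℕ) : ℝ) by push_cast; rfl,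
    Nat.floor_add_natCast (by positivity)]

lemma floor_pow_mul_lt (hb : 2 ≤ b) (L : ℕ) {y : ℝ} (hy : 0 ≤ y) (hy1 : y < 1) :
    ⌊(b : ℝ) ^ L * y⌋₊ < b ^ L := by
  rw [Nat.floor_lt (by positivity)]
  push_cast
  exact mul_lt_of_lt_one_right (by positivity) hy1

lemma abs_floor_div_sub_le (hb : 2 ≤ b) (L : ℕ) {p : ℝ} (hp : 0 ≤ p) :
    |(⌊(b : ℝ) ^ L * p⌋₊ : ℝ) / (b : ℝ) ^ L - p| ≤ 1 / (b : ℝ) ^ L := by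
  have hb0 : (0 : ℝ) < (b : ℝ) ^ L := by positivity
  have h1 := Nat.floor_le (by positivity : 0 ≤ (b : ℝ) ^ L * p)
  have h2 := Nat.lt_floor_add_one ((b : ℝ) ^ L * p)
  rw [div_sub' hb0.ne', abs_div, abs_of_pos hb0, div_le_div_iff_of_pos_right hb0, abs_le]
  constructor <;> linarith

/-- Passing from two nearby pairs of points to the pairs of grid points below them. -/
lemma Close.floor (hb : 2 ≤ b) (hγ : 0 < γ) (hγ1 : γ < 1) (hbγ : 1 < γ * b) {H i n : ℕ}
    (hi : i + 1 ≤ H) {A p p' : ℝ} (hp : 0 ≤ p) (hp' : 0 ≤ p') (h : Close b γ i n A p p') :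
    Close b γ i n (A + 4 * Real.pi * (1 / (1 - γ)))
      (⌊(b : ℝ) ^ (H * n) * p⌋₊ / (b : ℝ) ^ (H * n))
      (⌊(b : ℝ) ^ (H * n) * p'⌋₊ / (b : ℝ) ^ (H * n)) := by
  intro l hl
  have hM : 0 < 1 / (1 - γ) := by apply div_pos <;> linarith
  have h0 := h l hl
  have h1 := abs_jet_sub_le hb hγ hγ1 l n (⌊(b : ℝ) ^ (H * n) * p⌋₊ / (b : ℝ) ^ (H * n)) p
  have h2 := abs_jet_sub_le hb hγ hγ1 l n (⌊(b : ℝ) ^ (H * n) * p'⌋₊ / (b : ℝ) ^ (H * n)) p'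
  have hη : 1 / (b : ℝ) ^ (H * n) ≤ rate b γ l ^ n := by
    rw [div_le_iff₀ (by positivity)]
    exact one_le_rate_pow_mul hb hγ hbγ (by omega) n
  have e1 := (abs_floor_div_sub_le hb (H * n) hp).trans hη
  have e2 := (abs_floor_div_sub_le hb (H * n) hp').trans hη
  have hc : 0 ≤ 2 * Real.pi * (1 / (1 - γ)) := by positivity
  have f1 := mul_le_mul_of_nonneg_left e1 hc
  have f2 := mul_le_mul_of_nonneg_left e2 hc
  rw [abs_le] at h0 ⊢
  have g1 := abs_le.1 (h1.trans f1)
  have g2 := abs_le.1 (h2.trans f2)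
  constructor <;> linarith [g1.1, g1.2, g2.1, g2.2, h0.1, h0.2]

lemma exists_fewClose_of_energy (hb : 2 ≤ b) (hγ : 0 < γ) (hγ1 : γ < 1) (hbγ : 1 < γ * b)
    {H i : ℕ} (n : ℕ) (hi : i + 1 ≤ H) (A : ℝ) {ω : ℕ → ℝ} (h0 : ∀ z, 0 ≤ ω z) {θ T : ℝ}
    (hθ : 0 < θ) (hT : 0 < T) :
    ∃ B ⊆ range (b ^ ((H + 1) * n)), FewClose b γ H i n A B T ∧
      (B.card : ℝ) ≤ #{z ∈ range (b ^ ((H + 1) * n)) | ω z < θ}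
        + energy b γ i (A + 4 * Real.pi * (1 / (1 - γ))) ω (H * n) n / (θ ^ 2 * T) := by
  classical
  have hbp : 0 < b := by omega
  set L := H * n with hL
  set A₁ := A + 4 * Real.pi * (1 / (1 - γ))
  have hD : (H + 1) * n = L + n := by rw [hL]; ring
  rw [hD]
  set F : ℕ → Finset ℕ := fun z => {z' ∈ range (b ^ (L + n)) | z % b ^ L = z' % b ^ L ∧
    Close b γ i n A₁ (z / (b : ℝ) ^ L) (z' / (b : ℝ) ^ L) ∧ θ ≤ ω z'} with hF
  set B₁ : Finset ℕ := {z ∈ range (b ^ (L + n)) | ω z < θ} with hB1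
  set B₂ : Finset ℕ := {z ∈ range (b ^ (L + n)) | θ ≤ ω z ∧ T < (F z).card} with hB2
  refine ⟨B₁ ∪ B₂, union_subset (filter_subset _ _) (filter_subset _ _), ?_, ?_⟩
  · intro y hy0 hy1 k hk hkB
    have hlt : ∀ k' < b ^ n, ⌊(b : ℝ) ^ L * (y + (k' : ℕ))⌋₊ < b ^ (L + n) := by
      intro k' hk'
      rw [floor_pow_mul_add b L hy0, pow_add]
      calc _ < b ^ L + b ^ L * k' := Nat.add_lt_add_right (floor_pow_mul_lt hb L hy0 hy1) _
        _ = b ^ L * (k' + 1) := by ring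
        _ ≤ _ := Nat.mul_le_mul_left _ hk'
    have hheavy : ∀ k' < b ^ n, ⌊(b : ℝ) ^ L * (y + (k' : ℕ))⌋₊ ∉ B₁ ∪ B₂ →
        θ ≤ ω ⌊(b : ℝ) ^ L * (y + (k' : ℕ))⌋₊ := by
      intro k' hk' h
      by_contra hlt'
      exact h (mem_union_left _ (mem_filter.2 ⟨mem_range.2 (hlt k' hk'), not_le.1 hlt'⟩))
    have hFT : ((F ⌊(b : ℝ) ^ L * (y + k)⌋₊).card : ℝ) ≤ T := by
      by_contra hgt
      exact hkB (mem_union_right _ (mem_filter.2 ⟨mem_range.2 (hlt k hk), hheavy k hk hkB,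
        not_le.1 hgt⟩))
    refine le_trans ?_ hFT
    refine Nat.cast_le.2
      (card_le_card_of_injOn (fun k' : ℕ => ⌊(b : ℝ) ^ L * (y + k')⌋₊) ?_ ?_)
    · intro k' hk'
      obtain ⟨hk1, hk2, hk3⟩ := mem_filter.1 hk'
      refine mem_filter.2 ⟨mem_range.2 (hlt k' (mem_range.1 hk1)), ?_, ?_,
        hheavy k' (mem_range.1 hk1) hk2⟩
      · simp only [floor_pow_mul_add b L hy0, Nat.add_mul_mod_self_left]
      · exact hk3.floor hb hγ hγ1 hbγ hi (by positivity) (by positivity)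
    · intro k1 _ k2 _ h
      simp only [floor_pow_mul_add b L hy0] at h
      exact Nat.eq_of_mul_eq_mul_left (pow_pos hbp L) (by omega)
  · have hu : ((B₁ ∪ B₂).card : ℝ) ≤ B₁.card + B₂.card := by exact_mod_cast card_union_le _ _
    refine hu.trans (add_le_add_right ?_ _)
    rw [le_div_iff₀ (by positivity)]
    have hterm : ∀ z ∈ B₂, θ ^ 2 * T ≤ ∑ z' ∈ range (b ^ (L + n)),
        if z % b ^ L = z' % b ^ L ∧ Close b γ i n A₁ (z / (b : ℝ) ^ L) (z' / (b : ℝ) ^ L)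
          then ω z * ω z' else 0 := by
      intro z hz
      obtain ⟨_, hz1, hz2⟩ := mem_filter.1 hz
      calc θ ^ 2 * T ≤ θ ^ 2 * (F z).card := by gcongr
        _ = ∑ z' ∈ F z, θ * θ := by rw [sum_const, nsmul_eq_mul]; ring
        _ ≤ ∑ z' ∈ F z, if z % b ^ L = z' % b ^ L ∧
              Close b γ i n A₁ (z / (b : ℝ) ^ L) (z' / (b : ℝ) ^ L) then ω z * ω z' else 0 := by
            refine sum_le_sum fun z' hz' => ?_
            obtain ⟨_, h1, h2, h3⟩ := mem_filter.1 hz'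
            rw [if_pos ⟨h1, h2⟩]
            exact mul_le_mul hz1 h3 hθ.le (h0 z)
        _ ≤ _ := by
            refine sum_le_sum_of_subset_of_nonneg (filter_subset _ _) fun z' _ _ => ?_
            split_ifs
            · exact mul_nonneg (h0 _) (h0 _)
            · exact le_rfl
    calc (B₂.card : ℝ) * (θ ^ 2 * T) = ∑ z ∈ B₂, θ ^ 2 * T := by rw [sum_const, nsmul_eq_mul]
      _ ≤ _ := sum_le_sum hterm
      _ ≤ energy b γ i A₁ ω L n := by
        refine sum_le_sum_of_subset_of_nonneg (filter_subset _ _) fun z _ _ =>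
          sum_nonneg fun z' _ => ?_
        split_ifs
        · exact mul_nonneg (h0 _) (h0 _)
        · exact le_rfl

end

/-- For all but an exponentially small proportion of the words, few words are close to them. -/
def Sparse (b : ℕ) (γ : ℝ) (H i : ℕ) (R : ℝ) : Prop :=
  ∀ A : ℝ, 0 < A → ∀ σ : ℝ, 1 < σ → ∃ τ : ℝ, 0 < τ ∧ τ < 1 ∧ ∃ n₀ : ℕ, ∀ n ≥ n₀,
    ∃ B ⊆ range (b ^ ((H + 1) * n)), (B.card : ℝ) ≤ (b : ℝ) ^ ((H + 1) * n) * τ ^ n ∧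
      FewClose b γ H i n A B ((R * σ) ^ n)

section
variable {b : ℕ} {γ : ℝ}

lemma le_blockWeight (hb : 2 ≤ b) {q Q M : ℕ} {s : ℝ} (hs : 1 ≤ s) (hsM : b ≤ s ^ M)
    (B : Finset ℕ) {e : ℕ → ℝ}
    (he : ∀ w, e w = if w ∈ B then ((b : ℝ) ^ q)⁻¹ else (s ^ q)⁻¹) {a J z n : ℕ} (hn : q * J ≤ n)
    (hJ : M * #{j ∈ range J | z / b ^ (a + q * j) % b ^ Q ∈ B} ≤ J) :
    (s ^ (2 * n))⁻¹ ≤ blockWeight b q Q e a J z := by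
  set N := #{j ∈ range J | z / b ^ (a + q * j) % b ^ Q ∈ B} with hN
  have hb1 : (1 : ℝ) ≤ b := by exact_mod_cast (by omega : 1 ≤ b)
  have h1 : ((s ^ q)⁻¹) ^ J * (((b : ℝ) ^ q)⁻¹) ^ N ≤ blockWeight b q Q e a J z := by
    have : ((s ^ q)⁻¹) ^ J * (((b : ℝ) ^ q)⁻¹) ^ N = ∏ j ∈ range J, ((s ^ q)⁻¹ *
        if z / b ^ (a + q * j) % b ^ Q ∈ B then ((b : ℝ) ^ q)⁻¹ else 1) := by
      rw [prod_mul_distrib, prod_const, card_range, prod_ite, prod_const, prod_const_one, mul_one]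
    rw [this]
    refine prod_le_prod (fun j _ => ?_) fun j _ => ?_
    · split_ifs <;> positivity
    · rw [he]
      split_ifs
      · exact mul_le_of_le_one_left (by positivity) (inv_le_one_of_one_le₀ (one_le_pow₀ hs))
      · rw [mul_one]
  refine le_trans ?_ h1
  rw [inv_pow, inv_pow, ← mul_inv]
  refine inv_anti₀ (by positivity) ?_
  calc (s ^ q) ^ J * ((b : ℝ) ^ q) ^ N ≤ (s ^ q) ^ J * ((s ^ M) ^ q) ^ N := by gcongr
    _ = s ^ (q * J + q * (M * N)) := by
      rw [pow_add, pow_mul, pow_mul, pow_mul, pow_right_comm (s ^ M), ← pow_mul s M,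
        pow_right_comm s q, ← pow_mul, ← pow_mul, ← pow_mul]
      ring
    _ ≤ s ^ (2 * n) := by
      refine pow_le_pow_right₀ hs ?_
      have := Nat.mul_le_mul_left q hJ
      omega

lemma exists_half_le_pow (Q : ℕ) (hQ : 1 ≤ Q) : ∃ τ : ℝ, 0 < τ ∧ τ < 1 ∧ 1 / 2 ≤ τ ^ Q := by
  have hQ' : (1 : ℝ) ≤ Q := by exact_mod_cast hQ
  have h2 : 1 / (2 * (Q : ℝ)) ≤ 1 / 2 := by
    apply div_le_div₀ <;> linarith
  have h3 : 0 < 1 / (2 * (Q : ℝ)) := by positivity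
  refine ⟨1 + -(1 / (2 * Q)), by linarith, by linarith, ?_⟩
  refine le_trans ?_ (one_add_mul_le_pow (by linarith) Q)
  field_simp
  norm_num

lemma Sparse.step (hb : 2 ≤ b) (hγ : 0 < γ) (hγ1 : γ < 1) (hbγ : 1 < γ * b) {H i : ℕ} {R : ℝ}
    (hi : i + 1 ≤ H) (hR : 1 ≤ R) (hRb : b * rate b γ i ≤ R) (h : Sparse b γ H (i + 1) 1) :
    Sparse b γ H i R := by
  intro A hA σ hσ
  have hM : 0 < 1 / (1 - γ) := by apply div_pos <;> linarith
  set A₁ := A + 4 * Real.pi * (1 / (1 - γ)) with hA1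
  have hA1p : 0 < A₁ := by positivity
  obtain ⟨s, hs1, hsσ⟩ : ∃ s : ℝ, 1 < s ∧ s ^ 6 = σ :=
    ⟨σ ^ ((6 : ℕ) : ℝ)⁻¹, Real.one_lt_rpow hσ (by norm_num),
      Real.rpow_inv_natCast_pow (by linarith) (by norm_num)⟩
  have hs0 : 0 < s := by linarith
  obtain ⟨M, hM'⟩ := pow_unbounded_of_one_lt (b : ℝ) hs1
  obtain ⟨τ₁, hτ0, hτ1, q₀, hq₀⟩ := h (A₁ + 2 * (1 / (1 - γ)) + 1) (by positivity) (s ^ 2)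
    (one_lt_pow₀ hs1 (by norm_num))
  obtain ⟨q₁, hq₁⟩ := exists_mul_pow_le (4 ^ M) hτ0.le hτ1
  obtain ⟨q₂, hq₂⟩ := exists_mul_pow_le (4 * 3 ^ (i + 1)) zero_le_one hs1
  set q := q₀ + q₁ + q₂ + 1 with hq
  obtain ⟨B, hBsub, hBcard, hBfew⟩ := hq₀ q (by omega)
  have hb1 : (1 : ℝ) ≤ b := by exact_mod_cast (by omega : 1 ≤ b)
  have hBM : 4 ^ M * B.card ≤ b ^ ((H + 1) * q) := by
    have h1 := hq₁ q (by omega)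
    have : (4 : ℝ) ^ M * B.card ≤ (b : ℝ) ^ ((H + 1) * q) := by
      calc (4 : ℝ) ^ M * B.card ≤ 4 ^ M * ((b : ℝ) ^ ((H + 1) * q) * τ₁ ^ q) := by gcongr
        _ = (b : ℝ) ^ ((H + 1) * q) * (4 ^ M * τ₁ ^ q) := by ring
        _ ≤ (b : ℝ) ^ ((H + 1) * q) * 1 := by gcongr; simpa using h1
        _ = _ := mul_one _
    exact_mod_cast this
  have hq4 : 4 * 3 ^ (i + 1) ≤ (R * s) ^ q := by
    have h1 := hq₂ q (by omega)
    rw [one_pow, mul_one] at h1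
    exact h1.trans (pow_le_pow_left₀ hs0.le (le_mul_of_one_le_left hs0.le hR) _)
  rw [one_mul] at hBfew
  set Q := (H + 1) * q with hQ
  set e : ℕ → ℝ := fun w => if w ∈ B then ((b : ℝ) ^ q)⁻¹ else (s ^ q)⁻¹ with he
  obtain ⟨K, hK0, hK⟩ := exists_energy_blockWeight_le hb hγ hγ1 hbγ hA1p hs1.le hR hRb hq4 hBfew e
    (fun w => rfl) Q
  have hQ1 : 1 ≤ Q := Nat.mul_pos (by omega) (by omega)
  obtain ⟨τ₂, hτ20, hτ21, hτ2Q⟩ := exists_half_le_pow Q hQ1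
  set τ₃ := max τ₂ s⁻¹ with hτ3
  have hτ30 : 0 < τ₃ := lt_max_of_lt_left hτ20
  have hτ31 : τ₃ < 1 := max_lt hτ21 (inv_lt_one_of_one_lt₀ hs1)
  obtain ⟨n₁, hn₁⟩ := exists_mul_pow_le (2 * (H + 1) + K) hτ30.le
    (show τ₃ < (1 + τ₃) / 2 by linarith)
  refine ⟨(1 + τ₃) / 2, by linarith, by linarith, n₁ + q, fun n hn => ?_⟩
  set m := n / Q with hm
  set r := n % Q with hr
  set J := (H + 1) * m with hJ
  have hnJ : q * J + r = n := by
    rw [hJ, hm, hr, show q * ((H + 1) * (n / Q)) = Q * (n / Q) by rw [hQ]; ring]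
    exact Nat.div_add_mod n Q
  set a := H * n - H * q with ha
  have haq : a + H * q = H * n := Nat.sub_add_cancel (Nat.mul_le_mul_left _ (by omega))
  set ω := blockWeight b q Q e a J with hω
  have he0 : ∀ w, 0 ≤ e w := fun w => by simp only [he]; split_ifs <;> positivity
  have hθ : 0 < (s ^ (2 * n))⁻¹ := by positivity
  have hRσ : 0 < (R * σ) ^ n := by positivity
  obtain ⟨B', hB'sub, hB'few, hB'card⟩ := exists_fewClose_of_energy hb hγ hγ1 hbγ n hi A
    (blockWeight_nonneg (b := b) (q := q) (Q := Q) he0 a J) hθ hRσ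
  refine ⟨B', hB'sub, hB'card.trans ?_, hB'few⟩
  set D := (H + 1) * n with hD
  have hDn : H * n + n = D := by rw [hD]; ring
  have hmn : (H + 1) * q * m ≤ n := by rw [← hQ, hm]; exact Nat.mul_div_le n Q
  have hfirst : (#{z ∈ range (b ^ D) | blockWeight b q Q e a J z < (s ^ (2 * n))⁻¹} : ℝ)
      ≤ (b : ℝ) ^ D * (2 * (H + 1) * τ₃ ^ n) := by
    have h1 := card_frequent_le b (by omega) q H m a D M (by omega) B hBM
    have h2 : #{z ∈ range (b ^ D) | blockWeight b q Q e a J z < (s ^ (2 * n))⁻¹}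
        ≤ #{z ∈ range (b ^ D) | (H + 1) * m
          < M * #{j ∈ range ((H + 1) * m) | z / b ^ (a + q * j) % b ^ ((H + 1) * q) ∈ B}} := by
      refine card_le_card fun z hz => ?_
      obtain ⟨hz1, hz2⟩ := mem_filter.1 hz
      refine mem_filter.2 ⟨hz1, ?_⟩
      by_contra hcon
      exact absurd (le_blockWeight hb hs1.le hM'.le B (fun w => rfl)
        (show q * J ≤ n by omega) (not_lt.1 hcon)) (not_le.2 hz2)
    have h3 := (Nat.mul_le_mul_right (2 ^ m) h2).trans h1
    have h4 : (#{z ∈ range (b ^ D) | blockWeight b q Q e a J z < (s ^ (2 * n))⁻¹} : ℝ) * 2 ^ m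
        ≤ (H + 1) * (b : ℝ) ^ D := by exact_mod_cast h3
    have h5 : (1 / 2 : ℝ) ^ m ≤ 2 * τ₃ ^ n := by
      have : n ≤ Q * (m + 1) := by
        rw [hm]; exact (Nat.lt_mul_div_succ n hQ1).le
      calc (1 / 2 : ℝ) ^ m = 2 * (1 / 2) ^ (m + 1) := by rw [pow_succ]; ring
        _ ≤ 2 * (τ₂ ^ Q) ^ (m + 1) := by gcongr
        _ = 2 * τ₂ ^ (Q * (m + 1)) := by rw [← pow_mul τ₂ Q]
        _ ≤ 2 * τ₂ ^ n := by
          have := pow_le_pow_of_le_one hτ20.le hτ21.le this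
          linarith
        _ ≤ 2 * τ₃ ^ n := by
          gcongr
          exact le_max_left _ _
    have h6 : (2 : ℝ) ^ m * (1 / 2) ^ m = 1 := by rw [← mul_pow]; norm_num
    calc _ = (#{z ∈ range (b ^ D) | blockWeight b q Q e a J z < (s ^ (2 * n))⁻¹} : ℝ) * 2 ^ m
          * (1 / 2) ^ m := by rw [mul_assoc, h6, mul_one]
      _ ≤ (H + 1) * (b : ℝ) ^ D * (2 * τ₃ ^ n) := by gcongr
      _ = _ := by ring
  have hsecond : energy b γ i A₁ ω (H * n) n / (((s ^ (2 * n))⁻¹) ^ 2 * (R * σ) ^ n)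
      ≤ (b : ℝ) ^ D * (K * τ₃ ^ n) := by
    have h1 := hK r (Nat.mod_lt n hQ1).le J a (by
      rw [hnJ, haq]; exact Nat.mul_le_mul_right _ hi)
    rw [hnJ, haq, hDn] at h1
    rw [div_le_iff₀ (by positivity)]
    refine h1.trans ?_
    have h2 : (s⁻¹) ^ n ≤ τ₃ ^ n := pow_le_pow_left₀ (by positivity) (le_max_right _ _) _
    calc K * ((b : ℝ) ^ D * (R * s) ^ n)
        = (b : ℝ) ^ D * (K * (s⁻¹) ^ n) * (((s ^ (2 * n))⁻¹) ^ 2 * (R * σ) ^ n) := by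
          rw [← hsσ, mul_pow, mul_pow, inv_pow, ← pow_mul, inv_pow]
          field_simp
          ring
      _ ≤ _ := by gcongr
  have hfin := hn₁ n (by omega)
  calc _ ≤ (b : ℝ) ^ D * (2 * (H + 1) * τ₃ ^ n) + (b : ℝ) ^ D * (K * τ₃ ^ n) :=
        add_le_add hfirst hsecond
    _ = (b : ℝ) ^ D * ((2 * (H + 1) + K) * τ₃ ^ n) := by ring
    _ ≤ _ := by gcongr

end

lemma exists_pos_forall_le {ι : Type*} (s : Finset ι) (f : ι → ℝ) (h : ∀ x ∈ s, 0 < f x) :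
    ∃ c : ℝ, 0 < c ∧ ∀ x ∈ s, c ≤ f x := by
  rcases s.eq_empty_or_nonempty with rfl | hs
  · exact ⟨1, one_pos, by simp⟩
  · obtain ⟨x, hx, hmin⟩ := s.exists_min_image f hs
    exact ⟨f x, h x hx, hmin⟩

/-- Two consecutive derivatives of the wave separate translates by distinct residues. -/
lemma exists_le_abs_wave_sub (b : ℕ) (hb : 2 ≤ b) : ∃ δ : ℝ, 0 < δ ∧ ∀ (l : ℕ) (u : ℝ) (κ κ' : ℕ),
    κ % b ≠ κ' % b → δ ≤ |wave l ((u + κ) / b) - wave l ((u + κ') / b)| ∨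
      δ ≤ |wave (l + 1) ((u + κ) / b) - wave (l + 1) ((u + κ') / b)| := by
  have hb0 : (0 : ℝ) < b := by positivity
  obtain ⟨c, hc, hmin⟩ := exists_pos_forall_le
    ((range b ×ˢ range b).filter fun p => p.1 ≠ p.2)
    (fun p => 2 - 2 * Real.cos (2 * Real.pi * (((p.1 : ℝ) - p.2) / b))) (by
      rintro ⟨r, r'⟩ h
      obtain ⟨h1, h2⟩ := mem_filter.1 h
      obtain ⟨h3, h4⟩ := mem_product.1 h1
      simp only [mem_range] at h3 h4
      have h3' : (r : ℝ) < b := by exact_mod_cast h3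
      have h4' : (r' : ℝ) < b := by exact_mod_cast h4
      have h5 : (r : ℝ) - r' ≠ 0 := sub_ne_zero.2 (by exact_mod_cast h2)
      have h6 : ((r : ℝ) - r') / b < 1 := by
        rw [div_lt_one hb0]; linarith [(Nat.cast_nonneg r' : (0 : ℝ) ≤ r')]
      have h7 : -1 < ((r : ℝ) - r') / b := by
        rw [lt_div_iff₀ hb0]; linarith [(Nat.cast_nonneg r : (0 : ℝ) ≤ r)]
      have hne : Real.cos (2 * Real.pi * (((r : ℝ) - r') / b)) ≠ 1 := by
        rw [Ne, Real.cos_eq_one_iff_of_lt_of_lt (by nlinarith [Real.pi_pos])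
          (by nlinarith [Real.pi_pos])]
        exact mul_ne_zero (by positivity) (div_ne_zero h5 hb0.ne')
      have := lt_of_le_of_ne (Real.cos_le_one _) hne
      simp only
      linarith)
  refine ⟨Real.sqrt (c / 2), by positivity, fun l u κ κ' h => ?_⟩
  have hred : ∀ (l κ : ℕ), wave l ((u + κ) / b) = wave l ((u + (κ % b : ℕ)) / b) := by
    intro l κ
    rw [← wave_add_nat l ((u + (κ % b : ℕ)) / b) (κ / b)]
    congr 1
    have : (κ : ℝ) = (κ % b : ℕ) + b * (κ / b : ℕ) := by exact_mod_cast (Nat.mod_add_div κ b).symm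
    rw [this]
    field_simp
    ring
  rw [hred l κ, hred l κ', hred (l + 1) κ, hred (l + 1) κ']
  have hm := hmin (κ % b, κ' % b) (mem_filter.2 ⟨mem_product.2
    ⟨mem_range.2 (Nat.mod_lt _ (by omega)), mem_range.2 (Nat.mod_lt _ (by omega))⟩, h⟩)
  have hw := wave_sq_add_sq l ((u + (κ % b : ℕ)) / b) ((u + (κ' % b : ℕ)) / b)
  rw [show (u + ((κ % b : ℕ) : ℝ)) / b - (u + ((κ' % b : ℕ) : ℝ)) / b
    = (((κ % b : ℕ) : ℝ) - (κ' % b : ℕ)) / b by ring] at hw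
  simp only at hm
  by_contra! hcon
  have h1 := (Real.lt_sqrt (abs_nonneg _)).1 hcon.1
  have h2 := (Real.lt_sqrt (abs_nonneg _)).1 hcon.2
  rw [sq_abs] at h1 h2
  linarith

section
variable {b : ℕ} {γ : ℝ}

lemma jet_add_nat_split (hb : 2 ≤ b) (l j m : ℕ) (y : ℝ) (k : ℕ) :
    jet b γ l (j + (1 + m)) (y + k) = jet b γ l j (y + (k % b ^ j : ℕ))
      + rate b γ l ^ (j + 1) * (wave l (((y + (k % b ^ j : ℕ)) / b ^ j + (k / b ^ j : ℕ)) / b)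
        + jet b γ l m (((y + (k % b ^ j : ℕ)) / b ^ j + (k / b ^ j : ℕ)) / b)) := by
  have hb0 : (b : ℝ) ≠ 0 := by positivity
  have hk : (k : ℝ) = (k % b ^ j : ℕ) + (b : ℝ) ^ j * (k / b ^ j : ℕ) := by
    exact_mod_cast (Nat.mod_add_div k (b ^ j)).symm
  have hdiv : (y + (k : ℝ)) / (b : ℝ) ^ j
      = (y + (k % b ^ j : ℕ)) / (b : ℝ) ^ j + (k / b ^ j : ℕ) := by
    conv_lhs => rw [hk]
    field_simp
    ring
  have h1 : jet b γ l j (y + k) = jet b γ l j (y + (k % b ^ j : ℕ)) := by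
    rw [← jet_add_mul hb l j (y + (k % b ^ j : ℕ)) (k / b ^ j)]
    conv_lhs => rw [hk]
    rw [add_assoc]
  rw [jet_add, jet_add b γ l 1 m, h1, hdiv]
  congr 1
  have : jet b γ l 1 ((y + (k % b ^ j : ℕ)) / (b : ℝ) ^ j + (k / b ^ j : ℕ))
      = rate b γ l * wave l (((y + (k % b ^ j : ℕ)) / b ^ j + (k / b ^ j : ℕ)) / b) := by
    simp [jet]
  rw [this, pow_one, pow_one]
  ring

lemma exists_not_close (hb : 2 ≤ b) (hγ : 0 < γ) (hγ1 : γ < 1) : ∃ N : ℕ, ∀ A : ℝ,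
    ∃ C : ℕ, ∀ (n : ℕ) (y : ℝ) (k k' : ℕ), Close b γ N n A (y + k) (y + k') →
      k % b ^ (n - C) = k' % b ^ (n - C) := by
  obtain ⟨δ, hδ, hsep⟩ := exists_le_abs_wave_sub b hb
  have hb2 : (2 : ℝ) ≤ b := by exact_mod_cast hb
  obtain ⟨l₀, hl₀⟩ := exists_mul_pow_le (4 * (γ / (1 - γ)) / δ) zero_le_one
    (show (1 : ℝ) < b by linarith)
  have h1γ : 0 < 1 - γ := by linarith
  have htail : ∀ l ≥ l₀, 2 * (rate b γ l / (1 - rate b γ l)) ≤ δ / 2 := by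
    intro l hl
    have h1 := hl₀ l hl
    rw [one_pow, mul_one, div_le_iff₀ hδ] at h1
    have hr := rate_le hb hγ l
    have hr0 := rate_pos hb hγ l
    have hbl : (0 : ℝ) < (b : ℝ) ^ l := by positivity
    calc 2 * (rate b γ l / (1 - rate b γ l)) ≤ 2 * (rate b γ l / (1 - γ)) := by
          gcongr
      _ = 4 * (γ / (1 - γ)) / (b : ℝ) ^ l / 2 := by unfold rate; field_simp; norm_num
      _ ≤ _ := by
        gcongr
        rw [div_le_iff₀ hbl]
        linarith
  refine ⟨l₀ + 1, fun A => ?_⟩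
  obtain ⟨C, hC⟩ := exists_mul_pow_le (4 * |A| / δ) hγ.le hγ1
  refine ⟨C + 1, fun n y k k' hclose => ?_⟩
  by_contra hne
  classical
  have hex : ∃ j, k % b ^ j ≠ k' % b ^ j := ⟨_, hne⟩
  obtain ⟨j, hj⟩ : ∃ j, Nat.find hex = j + 1 := by
    refine Nat.exists_eq_succ_of_ne_zero fun h0 => ?_
    have := Nat.find_spec hex
    rw [h0] at this
    simp [Nat.mod_one] at this
  have hj1 : k % b ^ (j + 1) ≠ k' % b ^ (j + 1) := hj ▸ Nat.find_spec hex
  have hj0 : k % b ^ j = k' % b ^ j := by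
    have := Nat.find_min hex (m := j) (by omega)
    tauto
  have hjn : j + 1 ≤ n - (C + 1) := hj ▸ Nat.find_min' hex hne
  have hκ : k / b ^ j % b ≠ k' / b ^ j % b := by
    intro h
    apply hj1
    rw [pow_succ, Nat.mod_mul, Nat.mod_mul, hj0, h]
  obtain ⟨m, hm⟩ : ∃ m, n = j + (1 + m) := ⟨n - (j + 1), by omega⟩
  have hmC : C ≤ m := by omega
  set u := (y + ((k % b ^ j : ℕ) : ℝ)) / (b : ℝ) ^ j with hu
  obtain ⟨l, hl0, hl1, hlsep⟩ : ∃ l, l₀ ≤ l ∧ l ≤ l₀ + 1 ∧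
      δ ≤ |wave l ((u + (k / b ^ j : ℕ)) / b) - wave l ((u + (k' / b ^ j : ℕ)) / b)| := by
    rcases hsep l₀ u _ _ hκ with h | h
    · exact ⟨l₀, le_rfl, by omega, h⟩
    · exact ⟨l₀ + 1, by omega, le_rfl, h⟩
  have hcl := hclose l hl1
  have hr := rate_pos hb hγ l
  rw [hm, jet_add_nat_split hb, jet_add_nat_split hb, ← hj0, ← hu, add_sub_add_left_eq_sub,
    ← mul_sub, abs_mul, abs_of_pos (by positivity), ← add_assoc, pow_add _ (j + 1), mul_left_comm]
    at hcl
  have hcl' := le_of_mul_le_mul_left hcl (by positivity)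
  have ht := htail l hl0
  have b1 := abs_jet_le hb hγ hγ1 l m ((u + (k / b ^ j : ℕ)) / b)
  have b2 := abs_jet_le hb hγ hγ1 l m ((u + (k' / b ^ j : ℕ)) / b)
  have hA : A * rate b γ l ^ m ≤ |A| * γ ^ m :=
    mul_le_mul (le_abs_self A) (pow_le_pow_left₀ hr.le (rate_le hb hγ l) m) (by positivity)
      (abs_nonneg A)
  have hCm := hC m hmC
  rw [one_pow, div_mul_eq_mul_div, div_le_one hδ] at hCm
  rw [abs_le] at b1 b2
  rw [abs_le] at hcl'
  rcases le_abs.1 hlsep with h | h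
  · linarith [b1.1, b1.2, b2.1, b2.2, hcl'.1, hcl'.2]
  · linarith [b1.1, b1.2, b2.1, b2.2, hcl'.1, hcl'.2]

lemma exists_sparse_base (hb : 2 ≤ b) (hγ : 0 < γ) (hγ1 : γ < 1) :
    ∃ N : ℕ, Sparse b γ N N 1 := by
  obtain ⟨N, hN⟩ := exists_not_close hb hγ hγ1
  refine ⟨N, fun A _ σ hσ => ?_⟩
  obtain ⟨C, hC⟩ := hN A
  obtain ⟨n₀, hn₀⟩ := exists_mul_pow_le ((b : ℝ) ^ C) zero_le_one hσ
  refine ⟨1 / 2, by norm_num, by norm_num, n₀ + C, fun n hn => ⟨∅, empty_subset _, ?_, ?_⟩⟩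
  · rw [card_empty, Nat.cast_zero]; positivity
  · intro y _ _ k _ _
    classical
    have h1 := hn₀ n (by omega)
    rw [one_pow, mul_one] at h1
    rw [one_mul]
    refine le_trans ?_ h1
    refine ((Nat.cast_le (n := b ^ C)).2 ?_).trans_eq (Nat.cast_pow b C)
    rw [← card_range (b ^ C)]
    refine card_le_card_of_injOn (fun k' => k' / b ^ (n - C)) ?_ ?_
    · intro k' hk'
      have hk1 := mem_range.1 (mem_filter.1 hk').1
      simp only [coe_range, Set.mem_Iio]
      refine Nat.div_lt_of_lt_mul ?_
      rwa [← pow_add, Nat.sub_add_cancel (by omega)]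
    · intro k1 h1 k2 h2 h
      have e1 := hC n y k k1 (mem_filter.1 h1).2.2
      have e2 := hC n y k k2 (mem_filter.1 h2).2.2
      simp only at h
      rw [← Nat.mod_add_div k1 (b ^ (n - C)), ← Nat.mod_add_div k2 (b ^ (n - C)), ← e1, ← e2, h]

lemma exists_sparse (hb : 2 ≤ b) (hγ : 0 < γ) (hγ1 : γ < 1) (hbγ : 1 < γ * b) :
    ∃ H : ℕ, Sparse b γ H 0 (b * γ) := by
  obtain ⟨N, hN⟩ := exists_sparse_base hb hγ hγ1
  have hdown : ∀ j, j + 1 ≤ N → Sparse b γ N (N - j) 1 := by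
    intro j
    induction j with
    | zero => intro _; exact hN
    | succ j ih =>
      intro hj
      have h := ih (by omega)
      rw [show N - j = N - (j + 1) + 1 by omega] at h
      refine h.step hb hγ hγ1 hbγ (by omega) le_rfl ?_
      obtain ⟨l, hl⟩ : ∃ l, N - (j + 1) = l + 1 := ⟨N - (j + 1) - 1, by omega⟩
      have hb0 : (b : ℝ) ≠ 0 := by positivity
      rw [hl, rate_succ, mul_div_cancel₀ _ hb0]
      exact (rate_le hb hγ l).trans hγ1.le
  rcases Nat.eq_zero_or_pos N with rfl | hpos
  · refine ⟨0, fun A hA σ hσ => ?_⟩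
    obtain ⟨τ, h0, h1, n₀, h⟩ := hN A hA σ hσ
    refine ⟨τ, h0, h1, n₀, fun n hn => ?_⟩
    obtain ⟨B, hB, hc, hf⟩ := h n hn
    refine ⟨B, hB, hc, fun y hy0 hy1 k hk hkB => (hf y hy0 hy1 k hk hkB).trans ?_⟩
    refine pow_le_pow_left₀ (by linarith) (mul_le_mul_of_nonneg_right ?_ (by linarith)) _
    rw [mul_comm]; exact hbγ.le
  · have h := hdown (N - 1) (by omega)
    rw [show N - (N - 1) = 0 + 1 by omega] at h
    refine ⟨N, h.step hb hγ hγ1 hbγ (by omega) ?_ ?_⟩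
    · rw [mul_comm]; exact hbγ.le
    · simp [rate]

end

section
variable {b : ℕ} {γ : ℝ}

lemma rate_zero (b : ℕ) (γ : ℝ) : rate b γ 0 = γ := by simp [rate]

/-- Frostman-type bound for the distribution of slopes at the good words. -/
lemma FewClose.card_abs_jet_sub_le (hγ : 0 < γ) {H n : ℕ} {B : Finset ℕ} {T : ℝ} (hT : 0 ≤ T)
    (hB : FewClose b γ H 0 n 1 B T) {y : ℝ} (hy0 : 0 ≤ y) (hy1 : y < 1) (c ρ : ℝ) (hρ : 0 ≤ ρ)
    (S : Finset ℕ) (hS : ∀ k ∈ S, k < b ^ n ∧ ⌊(b : ℝ) ^ (H * n) * (y + k)⌋₊ ∉ B ∧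
      |jet b γ 0 n (y + k) - c| ≤ ρ) :
    (S.card : ℝ) ≤ (2 * ρ / γ ^ n + 1) * T := by
  classical
  have hγn : 0 < γ ^ n := by positivity
  set f : ℕ → ℕ := fun k => ⌊(jet b γ 0 n (y + k) - (c - ρ)) / γ ^ n⌋₊ with hf
  have hpos : ∀ k ∈ S, 0 ≤ (jet b γ 0 n (y + k) - (c - ρ)) / γ ^ n := by
    intro k hk
    have := abs_le.1 (hS k hk).2.2
    apply div_nonneg _ hγn.le
    linarith [this.1]
  have himg : ((S.image f).card : ℝ) ≤ 2 * ρ / γ ^ n + 1 := by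
    have hsub : S.image f ⊆ range (⌊2 * ρ / γ ^ n⌋₊ + 1) := by
      intro w hw
      obtain ⟨k, hk, rfl⟩ := mem_image.1 hw
      rw [mem_range, Nat.lt_succ_iff]
      have := abs_le.1 (hS k hk).2.2
      apply Nat.floor_le_floor
      gcongr
      linarith [this.2]
    have h1 : ((S.image f).card : ℝ) ≤ (⌊2 * ρ / γ ^ n⌋₊ + 1 : ℕ) := by
      have := card_le_card hsub
      rw [card_range] at this
      exact_mod_cast this
    refine h1.trans ?_
    push_cast
    linarith [Nat.floor_le (by positivity : 0 ≤ 2 * ρ / γ ^ n)]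
  have hfib : ∀ w ∈ S.image f, ((S.filter fun k => f k = w).card : ℝ) ≤ T := by
    intro w hw
    obtain ⟨k, hk, rfl⟩ := mem_image.1 hw
    obtain ⟨hk1, hk2, hk3⟩ := hS k hk
    refine le_trans (Nat.cast_le.2 (card_le_card ?_)) (hB y hy0 hy1 k hk1 hk2)
    intro k' hk'
    obtain ⟨hk'1, hk'2⟩ := mem_filter.1 hk'
    obtain ⟨h1, h2, h3⟩ := hS k' hk'1
    refine mem_filter.2 ⟨mem_range.2 h1, h2, fun l hl => ?_⟩
    obtain rfl : l = 0 := by omega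
    rw [rate_zero, one_mul]
    have a1 := Nat.floor_le (hpos k hk)
    have a2 := Nat.lt_floor_add_one ((jet b γ 0 n (y + k) - (c - ρ)) / γ ^ n)
    have a3 := Nat.floor_le (hpos k' hk'1)
    have a4 := Nat.lt_floor_add_one ((jet b γ 0 n (y + k') - (c - ρ)) / γ ^ n)
    simp only [hf] at hk'2
    rw [hk'2] at a3 a4
    rw [le_div_iff₀ hγn] at a1 a3
    rw [div_lt_iff₀ hγn] at a2 a4
    rw [abs_le]
    constructor <;> linarith
  calc (S.card : ℝ) = ∑ w ∈ S.image f, ((S.filter fun k => f k = w).card : ℝ) := by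
        rw [card_eq_sum_card_image f S]; push_cast; rfl
    _ ≤ ∑ w ∈ S.image f, T := sum_le_sum hfib
    _ = (S.image f).card * T := by rw [sum_const, nsmul_eq_mul]
    _ ≤ _ := by gcongr
end

section
variable {α : ℝ} {b : ℕ}

lemma norm_weierstrass_term_le (hα0 : 0 < α) (n : ℕ) (x : ℝ) :
    ‖α ^ n * Real.cos (2 * Real.pi * (b : ℝ) ^ n * x)‖ ≤ α ^ n := by
  rw [norm_mul, Real.norm_eq_abs, abs_of_pos (pow_pos hα0 n)]
  exact mul_le_of_le_one_right (by positivity) (Real.abs_cos_le_one _)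

lemma summable_weierstrass (hα0 : 0 < α) (hα1 : α < 1) (x : ℝ) :
    Summable fun n : ℕ => α ^ n * Real.cos (2 * Real.pi * (b : ℝ) ^ n * x) :=
  Summable.of_norm_bounded (summable_geometric_of_lt_one hα0.le hα1)
    (norm_weierstrass_term_le hα0 · x)

lemma continuous_weierstrass (hα0 : 0 < α) (hα1 : α < 1) : Continuous (weierstrass α b) :=
  continuous_tsum (fun n => by fun_prop) (summable_geometric_of_lt_one hα0.le hα1)
    fun n x => norm_weierstrass_term_le hα0 n x

lemma weierstrass_add_nat (α : ℝ) (b : ℕ) (x : ℝ) (k : ℕ) :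
    weierstrass α b (x + k) = weierstrass α b x := by
  unfold weierstrass
  refine tsum_congr fun n => ?_
  rw [show 2 * Real.pi * (b : ℝ) ^ n * (x + k)
    = 2 * Real.pi * (b : ℝ) ^ n * x + ((b ^ n * k : ℕ) : ℝ) * (2 * Real.pi) by push_cast; ring,
    Real.cos_add_nat_mul_two_pi]

/-- The partial sum of the first `N` terms, at scale `b ^ N`. -/
noncomputable def partialSum (α : ℝ) (b N : ℕ) (v : ℝ) : ℝ :=
  ∑ i ∈ range N, α ^ (N - 1 - i) * Real.cos (2 * Real.pi * (v / (b : ℝ) ^ (i + 1)))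

lemma weierstrass_div_pow (hb : 2 ≤ b) (hα0 : 0 < α) (hα1 : α < 1) (N : ℕ) (v : ℝ) :
    weierstrass α b (v / (b : ℝ) ^ N) = partialSum α b N v + α ^ N * weierstrass α b v := by
  have hb0 : (b : ℝ) ≠ 0 := by positivity
  unfold weierstrass partialSum
  rw [← (summable_weierstrass hα0 hα1 _).sum_add_tsum_nat_add N, ← sum_range_reflect]
  congr 1
  · refine sum_congr rfl fun i hi => ?_
    have hi' := mem_range.1 hi
    congr 2
    have : (b : ℝ) ^ N = (b : ℝ) ^ (N - 1 - i) * (b : ℝ) ^ (i + 1) := by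
      rw [← pow_add]; congr 1; omega
    rw [this]
    field_simp
  · rw [← tsum_mul_left]
    refine tsum_congr fun n => ?_
    rw [pow_add, pow_add, mul_comm (α ^ n), mul_assoc]
    congr 3
    field_simp

lemma hasDerivAt_partialSum (hb : 2 ≤ b) (hα0 : 0 < α) (N : ℕ) (v : ℝ) :
    HasDerivAt (partialSum α b N) (-(2 * Real.pi * α ^ N * jet b (α * b)⁻¹ 0 N v)) v := by
  have hb0 : (b : ℝ) ≠ 0 := by positivity
  unfold partialSum jet
  rw [mul_sum, ← sum_neg_distrib]
  apply HasDerivAt.fun_sum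
  intro i hi
  have hi' := mem_range.1 hi
  have h1 : HasDerivAt (fun v : ℝ => 2 * Real.pi * (v / (b : ℝ) ^ (i + 1)))
      (2 * Real.pi * (1 / (b : ℝ) ^ (i + 1))) v :=
    ((hasDerivAt_id v).div_const _).const_mul _
  refine (h1.cos.const_mul (α ^ (N - 1 - i))).congr_deriv ?_
  have : α ^ N = α ^ (N - 1 - i) * α ^ (i + 1) := by
    rw [← pow_add]; congr 1; omega
  rw [this, rate_zero, inv_pow, mul_pow]
  unfold wave
  rw [Nat.cast_zero, zero_mul, add_zero]
  field_simp

/-- Second-order expansion of the Weierstrass function at scale `b ^ (-N)`. -/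
lemma abs_weierstrass_expansion_le (hb : 2 ≤ b) (hα0 : 0 < α) (hα1 : α < 1) (hαb : 1 < α * b)
    (N : ℕ) (v s : ℝ) :
    |weierstrass α b ((v + s) / (b : ℝ) ^ N) - weierstrass α b (v / (b : ℝ) ^ N)
        - α ^ N * (weierstrass α b (v + s) - weierstrass α b v
          - 2 * Real.pi * s * jet b (α * b)⁻¹ 0 N v)|
      ≤ α ^ N * ((2 * Real.pi) ^ 2 * (1 / (1 - (α * b)⁻¹)) * s ^ 2) := by
  set γ := (α * b : ℝ)⁻¹ with hγd
  have hγ : 0 < γ := by positivity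
  have hγ1 : γ < 1 := inv_lt_one_of_one_lt₀ hαb
  have hM : 0 < 1 / (1 - γ) := by apply div_pos <;> linarith
  rw [weierstrass_div_pow hb hα0 hα1, weierstrass_div_pow hb hα0 hα1]
  set h : ℝ → ℝ := fun u => partialSum α b N (v + u) + 2 * Real.pi * α ^ N * jet b γ 0 N v * u
    with hh
  have hderiv : ∀ u, HasDerivAt h
      (-(2 * Real.pi * α ^ N * jet b γ 0 N (v + u)) + 2 * Real.pi * α ^ N * jet b γ 0 N v) u := by
    intro u
    have h1 := (hasDerivAt_partialSum hb hα0 N (v + u)).comp_const_add v u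
    exact h1.add (((hasDerivAt_id u).const_mul _).congr_deriv (mul_one _))
  have hmv := Convex.norm_image_sub_le_of_norm_hasDerivWithin_le (𝕜 := ℝ)
    (s := Set.Icc (-|s|) |s|) (f := h) (C := α ^ N * ((2 * Real.pi) ^ 2 * (1 / (1 - γ)) * |s|))
    (x := 0) (y := s) (fun u _ => (hderiv u).hasDerivWithinAt) (fun u hu => by
      rw [Real.norm_eq_abs, show -(2 * Real.pi * α ^ N * jet b γ 0 N (v + u))
        + 2 * Real.pi * α ^ N * jet b γ 0 N v
        = 2 * Real.pi * α ^ N * (jet b γ 0 N v - jet b γ 0 N (v + u)) by ring, abs_mul,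
        abs_of_pos (by positivity)]
      have h1 := abs_jet_sub_le hb hγ hγ1 0 N v (v + u)
      rw [sub_add_cancel_left, abs_neg] at h1
      calc 2 * Real.pi * α ^ N * |jet b γ 0 N v - jet b γ 0 N (v + u)|
          ≤ 2 * Real.pi * α ^ N * (2 * Real.pi * (1 / (1 - γ)) * |s|) := by
            gcongr
            exact h1.trans (mul_le_mul_of_nonneg_left (abs_le.2 hu) (by positivity))
        _ = _ := by ring) (convex_Icc _ _)
    ⟨by linarith [abs_nonneg s], abs_nonneg s⟩ ⟨neg_abs_le s, le_abs_self s⟩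
  simp only [hh, Real.norm_eq_abs, sub_zero, mul_zero, add_zero] at hmv
  calc _ = |partialSum α b N (v + s) + 2 * Real.pi * α ^ N * jet b γ 0 N v * s
        - partialSum α b N v| := by
        congr 1
        ring
    _ ≤ _ := hmv
    _ = _ := by
      rw [← sq_abs s]
      ring

end

/-- The displacements staying, up to a constant, in the square of side `b ^ (-n)` around the
point of the graph above `x`. -/
def near (α : ℝ) (b : ℕ) (Q : ℝ) (n : ℕ) (x : ℝ) : Set ℝ :=
  {t | |t| ≤ 1 / (b : ℝ) ^ n ∧ |weierstrass α b (x + t) - weierstrass α b x| ≤ Q / (b : ℝ) ^ n}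

section
variable {α : ℝ} {b : ℕ}

lemma exists_shell (hb : 2 ≤ b) (m : ℕ) {s : ℝ} (h1 : s ≤ 1 / (b : ℝ) ^ m)
    (h2 : 1 / (b : ℝ) ^ (2 * m) < s) :
    ∃ j < m, s ≤ 1 / (b : ℝ) ^ (m + j) ∧ 1 / (b : ℝ) ^ (m + j + 1) < s := by
  classical
  have hex : ∃ j, 1 / (b : ℝ) ^ (m + j + 1) < s := by
    refine ⟨m, lt_of_le_of_lt ?_ h2⟩
    have hb1 : (1 : ℝ) ≤ b := by exact_mod_cast (by omega : 1 ≤ b)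
    exact one_div_le_one_div_of_le (by positivity) (pow_le_pow_right₀ hb1 (by omega))
  have hs := Nat.find_spec hex
  rcases Nat.eq_zero_or_pos (Nat.find hex) with h0 | hpos
  · rw [h0] at hs
    refine ⟨0, ?_, h1, hs⟩
    by_contra hm
    obtain rfl : m = 0 := by omega
    exact absurd h1 (not_le.2 (by simpa using h2))
  · have hmin := Nat.find_min hex (m := Nat.find hex - 1) (by omega)
    rw [not_lt, show m + (Nat.find hex - 1) + 1 = m + Nat.find hex by omega] at hmin
    refine ⟨Nat.find hex, ?_, hmin, hs⟩
    by_contra hm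
    refine absurd h2 (not_lt.2 (hmin.trans ?_))
    have hb1 : (1 : ℝ) ≤ b := by exact_mod_cast (by omega : 1 ≤ b)
    exact one_div_le_one_div_of_le (by positivity) (pow_le_pow_right₀ hb1 (by omega))

open Classical in
/-- For a displacement `s`, the number of good words whose graph comes back close to itself. -/
lemma exists_card_near_le (hb : 2 ≤ b) (hα0 : 0 < α) (hα1 : α < 1) (hαb : 1 < α * b) {Q : ℝ}
    (hQ : 0 < Q) : ∃ Q' C : ℝ, 0 < Q' ∧ 0 < C ∧ ∀ (H N m : ℕ) (B : Finset ℕ) (T : ℝ), 0 ≤ T →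
      FewClose b (α * b)⁻¹ H 0 N 1 B T → 1 ≤ ((α * b)⁻¹) ^ N * (b : ℝ) ^ m →
      ((α * b)⁻¹) ^ N * (b : ℝ) ^ m ≤ (b : ℝ) ^ 2 → ∀ y : ℝ, 0 ≤ y → y < 1 → ∀ s : ℝ,
      (#{k ∈ range (b ^ N) | ⌊(b : ℝ) ^ (H * N) * (y + (k : ℕ))⌋₊ ∉ B ∧
          s / (b : ℝ) ^ N ∈ near α b Q (N + m) ((y + k) / (b : ℝ) ^ N)} : ℝ)
        ≤ ∑ j ∈ range m, (if s ∈ near α b Q' (m + j) y then C * (b : ℝ) ^ j * T else 0)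
          + if s ∈ near α b Q' (m + m) y then (b : ℝ) ^ N else 0 := by
  set γ := (α * b : ℝ)⁻¹ with hγd
  have hb1 : (1 : ℝ) ≤ b := by exact_mod_cast (by omega : 1 ≤ b)
  have hb0 : (0 : ℝ) < b := by positivity
  have hγ : 0 < γ := by positivity
  have hγ1 : γ < 1 := inv_lt_one_of_one_lt₀ hαb
  set M := 1 / (1 - γ) with hMd
  have hM : 0 < M := by apply div_pos <;> linarith
  set E := (2 * Real.pi) ^ 2 * M with hE
  have hE0 : 0 < E := by positivity
  refine ⟨2 * Real.pi * M + Q * (b : ℝ) ^ 2 + E, 2 * ((Q + E) * b) + 1, by positivity,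
    by positivity, fun H N m B T hT hB h1 h2 y hy0 hy1 s => ?_⟩
  set Q' := 2 * Real.pi * M + Q * (b : ℝ) ^ 2 + E with hQ'
  set C := 2 * ((Q + E) * b) + 1 with hC
  set S := {k ∈ range (b ^ N) | ⌊(b : ℝ) ^ (H * N) * (y + (k : ℕ))⌋₊ ∉ B ∧
    s / (b : ℝ) ^ N ∈ near α b Q (N + m) ((y + k) / (b : ℝ) ^ N)} with hS
  have hsum0 : 0 ≤ ∑ j ∈ range m, (if s ∈ near α b Q' (m + j) y then C * (b : ℝ) ^ j * T else 0) :=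
    sum_nonneg fun j _ => by split_ifs <;> positivity
  have hlast0 : 0 ≤ if s ∈ near α b Q' (m + m) y then (b : ℝ) ^ N else 0 := by
    split_ifs <;> positivity
  rcases S.eq_empty_or_nonempty with hSe | ⟨k₀, hk₀⟩
  · rw [hSe, card_empty, Nat.cast_zero]; exact add_nonneg hsum0 hlast0
  have hbN : (0 : ℝ) < (b : ℝ) ^ N := by positivity
  have hbm : (0 : ℝ) < (b : ℝ) ^ m := by positivity
  have hαN : 0 < α ^ N := by positivity
  have hγN : 0 < γ ^ N := by positivity
  have hs0 : 0 ≤ |s| := abs_nonneg s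
  have hunit : α ^ N * (b : ℝ) ^ N * γ ^ N = 1 := by
    rw [← mul_pow, ← mul_pow, hγd, mul_inv_cancel₀ (by positivity), one_pow]
  have hsm : |s| ≤ 1 / (b : ℝ) ^ m := by
    have h := (mem_filter.1 hk₀).2.2.1
    rw [abs_div, abs_of_pos hbN, pow_add, div_le_div_iff₀ hbN (by positivity)] at h
    rw [le_div_iff₀ hbm]
    nlinarith
  have hs1 : |s| ≤ 1 := hsm.trans (div_le_one_of_le₀ (one_le_pow₀ hb1) hbm.le)
  have hsγ : |s| ≤ γ ^ N := hsm.trans (by rw [div_le_iff₀ hbm]; exact h1)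
  set Δ := weierstrass α b (y + s) - weierstrass α b y with hΔ
  have hmain : ∀ k ∈ S, |Δ - 2 * Real.pi * s * jet b γ 0 N (y + k)|
      ≤ Q * γ ^ N / (b : ℝ) ^ m + E * s ^ 2 := by
    intro k hk
    have h := (mem_filter.1 hk).2.2.2
    rw [← add_div] at h
    have hexp := abs_weierstrass_expansion_le hb hα0 hα1 hαb N (y + k) s
    rw [show y + (k : ℝ) + s = y + s + k by ring, weierstrass_add_nat, weierstrass_add_nat, ← hΔ,
      ← hγd] at hexp
    rw [show y + (k : ℝ) + s = y + s + k by ring] at h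
    have e1 : Q / (b : ℝ) ^ (N + m) = α ^ N * (Q * γ ^ N / (b : ℝ) ^ m) := by
      rw [pow_add, div_eq_iff (by positivity)]
      calc Q = Q * (α ^ N * (b : ℝ) ^ N * γ ^ N) := by rw [hunit, mul_one]
        _ = _ := by field_simp
    rw [e1] at h
    have h3 : |α ^ N * (Δ - 2 * Real.pi * s * jet b γ 0 N (y + k))|
        ≤ α ^ N * (Q * γ ^ N / (b : ℝ) ^ m + E * s ^ 2) := by
      rw [abs_le] at h hexp ⊢
      constructor <;> linarith [h.1, h.2, hexp.1, hexp.2]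
    rw [abs_mul, abs_of_pos hαN] at h3
    exact le_of_mul_le_mul_left h3 hαN
  have hmem : ∀ j ≤ m, |s| ≤ 1 / (b : ℝ) ^ (m + j) → s ∈ near α b Q' (m + j) y := by
    intro j hjm hj1
    refine ⟨hj1, ?_⟩
    have h := hmain k₀ hk₀
    have hX := abs_jet_le' hb hγ hγ1 0 N (y + k₀)
    have t1 : |2 * Real.pi * s * jet b γ 0 N (y + k₀)| ≤ 2 * Real.pi * M * |s| := by
      rw [abs_mul, abs_mul, abs_of_pos (by positivity : 0 < 2 * Real.pi)]
      calc 2 * Real.pi * |s| * |jet b γ 0 N (y + k₀)| ≤ 2 * Real.pi * |s| * M := by gcongr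
        _ = _ := by ring
    have t2 : E * s ^ 2 ≤ E * |s| := by
      rw [← sq_abs, sq]
      exact mul_le_mul_of_nonneg_left (mul_le_of_le_one_left hs0 hs1) hE0.le
    have t3 : Q * γ ^ N / (b : ℝ) ^ m ≤ Q * (b : ℝ) ^ 2 / (b : ℝ) ^ (m + j) := by
      rw [div_le_div_iff₀ hbm (by positivity), pow_add]
      calc Q * γ ^ N * ((b : ℝ) ^ m * (b : ℝ) ^ j)
          = Q * (γ ^ N * (b : ℝ) ^ m) * (b : ℝ) ^ j := by ring
        _ ≤ Q * (b : ℝ) ^ 2 * (b : ℝ) ^ m := by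
          gcongr
    have t4 : (2 * Real.pi * M + E) * |s| ≤ (2 * Real.pi * M + E) * (1 / (b : ℝ) ^ (m + j)) := by
      gcongr
    have t5 : Q' / (b : ℝ) ^ (m + j) = Q * (b : ℝ) ^ 2 / (b : ℝ) ^ (m + j)
        + (2 * Real.pi * M + E) * (1 / (b : ℝ) ^ (m + j)) := by
      rw [hQ']; ring
    rw [t5]
    rw [abs_le] at h t1 ⊢
    constructor <;> linarith [h.1, h.2, t1.1, t1.2]
  by_cases hsmall : |s| ≤ 1 / (b : ℝ) ^ (2 * m)
  · rw [if_pos (hmem m le_rfl (by rwa [← two_mul]))]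
    have : (S.card : ℝ) ≤ (b ^ N : ℕ) := Nat.cast_le.2
      ((card_le_card (filter_subset _ _)).trans_eq (card_range _))
    push_cast at this
    linarith
  refine le_trans ?_ (le_add_of_nonneg_right hlast0)
  have hs0' : 0 < |s| := lt_of_le_of_lt (by positivity) (not_le.1 hsmall)
  obtain ⟨j, hjm, hj1, hj2⟩ := exists_shell hb m hsm (not_le.1 hsmall)
  have hcard : (S.card : ℝ) ≤ C * (b : ℝ) ^ j * T := by
    have hs' : s ≠ 0 := abs_pos.1 hs0'
    have hcount := hB.card_abs_jet_sub_le hγ hT hy0 hy1 (Δ / (2 * Real.pi * s))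
      ((Q + E) * (b : ℝ) ^ (j + 1) * γ ^ N) (by positivity) S (fun k hk => by
        refine ⟨mem_range.1 (mem_filter.1 hk).1, (mem_filter.1 hk).2.1, ?_⟩
        have h := hmain k hk
        have e1 : jet b γ 0 N (y + k) - Δ / (2 * Real.pi * s)
            = -(Δ - 2 * Real.pi * s * jet b γ 0 N (y + k)) / (2 * Real.pi * s) := by
          field_simp
          ring
        rw [e1, abs_div, abs_neg, abs_mul, abs_of_pos (by positivity : 0 < 2 * Real.pi),
          div_le_iff₀ (by positivity)]
        refine h.trans ?_
        have hlow : 1 / (b : ℝ) ^ m ≤ (b : ℝ) ^ (j + 1) * |s| := by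
          have := hj2.le
          rw [add_assoc, pow_add, div_le_iff₀ (by positivity)] at this
          rw [div_le_iff₀ hbm]
          linarith
        have hbj : (1 : ℝ) ≤ (b : ℝ) ^ (j + 1) := one_le_pow₀ hb1
        have u1 : Q * γ ^ N / (b : ℝ) ^ m ≤ Q * γ ^ N * ((b : ℝ) ^ (j + 1) * |s|) := by
          rw [div_eq_mul_one_div]
          gcongr
        have u2 : E * s ^ 2 ≤ E * ((b : ℝ) ^ (j + 1) * γ ^ N * |s|) := by
          rw [← sq_abs, sq]
          gcongr
          exact hsγ.trans (le_mul_of_one_le_left hγN.le hbj)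
        have hpi : 1 ≤ 2 * Real.pi := by linarith [Real.pi_gt_three]
        calc _ ≤ (Q + E) * (b : ℝ) ^ (j + 1) * γ ^ N * |s| := by linarith
          _ ≤ (Q + E) * (b : ℝ) ^ (j + 1) * γ ^ N * (2 * Real.pi * |s|) := by
            gcongr
            exact le_mul_of_one_le_left hs0 hpi)
    refine hcount.trans (mul_le_mul_of_nonneg_right ?_ hT)
    have e2 : 2 * ((Q + E) * (b : ℝ) ^ (j + 1) * γ ^ N) / γ ^ N
        = 2 * ((Q + E) * b) * (b : ℝ) ^ j := by
      rw [pow_succ]; field_simp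
    rw [e2, hC]
    have : (1 : ℝ) ≤ (b : ℝ) ^ j := one_le_pow₀ hb1
    linarith
  refine hcard.trans ?_
  have := single_le_sum (f := fun j => if s ∈ near α b Q' (m + j) y then C * (b : ℝ) ^ j * T else 0)
    (fun j _ => by split_ifs <;> positivity) (mem_range.2 hjm)
  simpa only [if_pos (hmem j hjm.le hj1)] using this

end

end WeierstrassGraph

namespace WeierstrassGraph

open Finset MeasureTheory ENNReal

lemma lintegral_Ico_zero_nat (P : ℕ) (F : ℝ → ℝ≥0∞) :
    ∫⁻ x in Set.Ico (0 : ℝ) P, F x = ∑ k ∈ range P, ∫⁻ y in Set.Ico (0 : ℝ) 1, F (y + k) := by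
  induction P with
  | zero => simp
  | succ P ih =>
    rw [sum_range_succ, ← ih, ← Set.Ico_union_Ico_eq_Ico (b := (P : ℝ)) (by positivity)
      (by push_cast; linarith), lintegral_union measurableSet_Ico]
    · congr 1
      rw [← lintegral_indicator measurableSet_Ico, ← lintegral_indicator measurableSet_Ico,
        ← lintegral_add_right_eq_self _ (P : ℝ)]
      congr 1
      ext y
      by_cases h : y ∈ Set.Ico (0 : ℝ) 1
      · rw [Set.indicator_of_mem h, Set.indicator_of_mem]
        push_cast
        constructor <;> linarith [h.1, h.2]
      · rw [Set.indicator_of_notMem h, Set.indicator_of_notMem]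
        intro h'
        push_cast at h'
        exact h ⟨by linarith [h'.1], by linarith [h'.2]⟩
    · exact Set.Ico_disjoint_Ico_same

lemma lintegral_Ico_eq_sum {P : ℕ} (hP : 0 < P) (F : ℝ → ℝ≥0∞) (hF : Measurable F) :
    ∫⁻ x in Set.Ico (0 : ℝ) 1, F x
      = (P : ℝ≥0∞)⁻¹ * ∑ k ∈ range P, ∫⁻ y in Set.Ico (0 : ℝ) 1, F ((y + k) / P) := by
  have hP' : (0 : ℝ) < P := by exact_mod_cast hP
  rw [← lintegral_Ico_zero_nat P fun y => F (y / P), ← lintegral_indicator measurableSet_Ico,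
    ← lintegral_indicator measurableSet_Ico]
  have hind : ∀ y : ℝ, (Set.Ico (0 : ℝ) P).indicator (fun y => F (y / P)) y
      = (Set.Ico (0 : ℝ) 1).indicator F ((P : ℝ)⁻¹ * y) := by
    intro y
    have : y ∈ Set.Ico (0 : ℝ) P ↔ (P : ℝ)⁻¹ * y ∈ Set.Ico (0 : ℝ) 1 := by
      rw [Set.mem_Ico, Set.mem_Ico, inv_mul_lt_iff₀ hP', mul_one]
      simp [hP']
    by_cases h : y ∈ Set.Ico (0 : ℝ) P
    · rw [Set.indicator_of_mem h, Set.indicator_of_mem (this.1 h), div_eq_inv_mul]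
    · rw [Set.indicator_of_notMem h, Set.indicator_of_notMem (fun h' => h (this.2 h'))]
  simp_rw [hind]
  rw [← lintegral_map (f := (Set.Ico (0 : ℝ) 1).indicator F) (g := fun y => (P : ℝ)⁻¹ * y)
    (hF.indicator measurableSet_Ico) (by fun_prop), Real.map_volume_mul_left (by positivity),
    lintegral_smul_measure, inv_inv, abs_of_pos hP', ofReal_natCast, smul_eq_mul, ← mul_assoc,
    ENNReal.inv_mul_cancel (by exact_mod_cast hP.ne') (natCast_ne_top P), one_mul]

lemma volume_Ico_inter_preimage_mul {P : ℕ} (hP : 0 < P) {O : Set ℝ} (hO : MeasurableSet O)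
    (hper : ∀ (y : ℝ) (k : ℕ), y + k ∈ O ↔ y ∈ O) :
    volume (Set.Ico (0 : ℝ) 1 ∩ {x | P * x ∈ O}) = volume (Set.Ico (0 : ℝ) 1 ∩ O) := by
  have hP' : (P : ℝ) ≠ 0 := by exact_mod_cast hP.ne'
  have hmeas : MeasurableSet {x : ℝ | P * x ∈ O} := hO.preimage (by fun_prop)
  have h : ∀ S : Set ℝ, MeasurableSet S → volume (Set.Ico (0 : ℝ) 1 ∩ S)
      = ∫⁻ x in Set.Ico (0 : ℝ) 1, S.indicator 1 x := by
    intro S hS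
    rw [lintegral_indicator_one hS, Measure.restrict_apply hS, Set.inter_comm]
  rw [h _ hmeas, h _ hO, lintegral_Ico_eq_sum hP _ (measurable_one.indicator hmeas)]
  have : ∀ (k : ℕ) (y : ℝ), Set.indicator {x : ℝ | P * x ∈ O} (1 : ℝ → ℝ≥0∞) ((y + k) / P)
      = O.indicator 1 y := by
    intro k y
    have hiff : (y + k) / P ∈ {x : ℝ | P * x ∈ O} ↔ y ∈ O := by
      rw [Set.mem_ofPred_eq, mul_div_cancel₀ _ hP', hper]
    by_cases hy : y ∈ O
    · rw [Set.indicator_of_mem hy, Set.indicator_of_mem (hiff.2 hy)]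
      rfl
    · rw [Set.indicator_of_notMem hy, Set.indicator_of_notMem (mt hiff.1 hy)]
  simp_rw [this]
  rw [sum_const, card_range, nsmul_eq_mul, ← mul_assoc,
    ENNReal.inv_mul_cancel (by exact_mod_cast hP.ne') (natCast_ne_top P), one_mul]

lemma volume_floor_mem_le {P : ℕ} (hP : 0 < P) (B : Finset ℕ) :
    volume (Set.Ico (0 : ℝ) 1 ∩ {x | ⌊(P : ℝ) * x⌋₊ ∈ B}) ≤ ENNReal.ofReal (B.card / P) := by
  have hP' : (0 : ℝ) < P := by exact_mod_cast hP
  have hsub : Set.Ico (0 : ℝ) 1 ∩ {x | ⌊(P : ℝ) * x⌋₊ ∈ B}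
      ⊆ ⋃ w ∈ B, Set.Ico ((w : ℝ) / P) ((w + 1) / P) := by
    rintro x ⟨hx, hxB⟩
    refine Set.mem_biUnion hxB ⟨?_, ?_⟩
    · rw [div_le_iff₀ hP', mul_comm x]
      exact Nat.floor_le (mul_nonneg hP'.le hx.1)
    · rw [lt_div_iff₀ hP', mul_comm x]
      exact Nat.lt_floor_add_one _
  refine (measure_mono hsub).trans ((measure_biUnion_finset_le _ _).trans ?_)
  have : ∀ w : ℕ, volume (Set.Ico ((w : ℝ) / P) ((w + 1) / P)) = ENNReal.ofReal (1 / P) := by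
    intro w
    rw [Real.volume_Ico]
    congr 1
    ring
  simp_rw [this]
  rw [sum_const, nsmul_eq_mul, show (B.card : ℝ) / P = B.card * (1 / P) by ring,
    ofReal_mul (by positivity), ofReal_natCast]

section
variable {α : ℝ} {b : ℕ}

lemma isClosed_near (hα0 : 0 < α) (hα1 : α < 1) (Q : ℝ) (n : ℕ) :
    IsClosed {p : ℝ × ℝ | p.2 ∈ near α b Q n p.1} := by
  have hW := continuous_weierstrass (b := b) hα0 hα1
  have h1 : IsClosed {p : ℝ × ℝ | |p.2| ≤ 1 / (b : ℝ) ^ n} :=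
    isClosed_le (by fun_prop) (by fun_prop)
  have h2 : IsClosed {p : ℝ × ℝ |
      |weierstrass α b (p.1 + p.2) - weierstrass α b p.1| ≤ Q / (b : ℝ) ^ n} :=
    isClosed_le (by fun_prop) (by fun_prop)
  exact h1.inter h2

lemma measurableSet_near (hα0 : 0 < α) (hα1 : α < 1) (Q : ℝ) (n : ℕ) (x : ℝ) :
    MeasurableSet (near α b Q n x) :=
  ((isClosed_near hα0 hα1 Q n).preimage (Continuous.prodMk_right x)).measurableSet

lemma measurable_volume_near (hα0 : 0 < α) (hα1 : α < 1) (Q : ℝ) (n : ℕ) :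
    Measurable fun x => volume (near α b Q n x) :=
  measurable_measure_prodMk_left (isClosed_near hα0 hα1 Q n).measurableSet

lemma near_add_nat (Q : ℝ) (n : ℕ) (x : ℝ) (k : ℕ) :
    near α b Q n (x + k) = near α b Q n x := by
  unfold near
  simp only [add_right_comm x (k : ℝ), weierstrass_add_nat]

lemma volume_near_le (Q : ℝ) (n : ℕ) (x : ℝ) :
    volume (near α b Q n x) ≤ ENNReal.ofReal (2 * (1 / (b : ℝ) ^ n)) := by
  have : near α b Q n x ⊆ Set.Icc (-(1 / (b : ℝ) ^ n)) (1 / (b : ℝ) ^ n) :=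
    fun t ht => abs_le.1 ht.1
  refine (measure_mono this).trans_eq ?_
  rw [Real.volume_Icc]
  congr 1
  ring

lemma volume_near_eq (hb : 2 ≤ b) (Q : ℝ) (n N : ℕ) (x : ℝ) :
    volume (near α b Q n x)
      = ENNReal.ofReal (1 / (b : ℝ) ^ N) * volume {s | s / (b : ℝ) ^ N ∈ near α b Q n x} := by
  have hbN : (0 : ℝ) < (b : ℝ) ^ N := by positivity
  have h := Real.volume_preimage_mul_left (a := 1 / (b : ℝ) ^ N) (by positivity) (near α b Q n x)
  have : (fun s => 1 / (b : ℝ) ^ N * s) ⁻¹' near α b Q n x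
      = {s | s / (b : ℝ) ^ N ∈ near α b Q n x} := by
    ext s
    simp only [Set.mem_preimage, Set.mem_ofPred_eq]
    rw [one_div_mul_eq_div]
  rw [this] at h
  rw [h, ← mul_assoc, ← ofReal_mul (by positivity), abs_of_pos (by positivity),
    mul_inv_cancel₀ (by positivity), ofReal_one, one_mul]

open Classical in
lemma exists_sum_volume_near_le (hb : 2 ≤ b) (hα0 : 0 < α) (hα1 : α < 1) (hαb : 1 < α * b) {Q : ℝ}
    (hQ : 0 < Q) : ∃ Q' C : ℝ, 0 < Q' ∧ 0 < C ∧ ∀ (H N m : ℕ) (B : Finset ℕ) (T : ℝ), 0 ≤ T →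
      FewClose b (α * b)⁻¹ H 0 N 1 B T → 1 ≤ ((α * b)⁻¹) ^ N * (b : ℝ) ^ m →
      ((α * b)⁻¹) ^ N * (b : ℝ) ^ m ≤ (b : ℝ) ^ 2 → ∀ y : ℝ, 0 ≤ y → y < 1 → ∀ β : ℕ → ℝ,
      (∀ j, 0 ≤ β j) → (∀ j ≤ m, volume (near α b Q' (m + j) y) ≤ ENNReal.ofReal (β (m + j))) →
      ∑ k ∈ range (b ^ N) with ⌊(b : ℝ) ^ (H * N) * (y + (k : ℕ))⌋₊ ∉ B,
          volume (near α b Q (N + m) ((y + k) / (b : ℝ) ^ N))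
        ≤ ENNReal.ofReal (1 / (b : ℝ) ^ N * (∑ j ∈ range m, C * (b : ℝ) ^ j * T * β (m + j)
          + (b : ℝ) ^ N * β (m + m))) := by
  obtain ⟨Q', C, hQ', hC, hmain⟩ := exists_card_near_le hb hα0 hα1 hαb hQ
  refine ⟨Q', C, hQ', hC, fun H N m B T hT hB h1 h2 y hy0 hy1 β hβ0 hβ => ?_⟩
  have hcount := hmain H N m B T hT hB h1 h2 y hy0 hy1
  set G := {k ∈ range (b ^ N) | ⌊(b : ℝ) ^ (H * N) * (y + (k : ℕ))⌋₊ ∉ B} with hG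
  set S : ℕ → Set ℝ := fun k => {s | s / (b : ℝ) ^ N ∈ near α b Q (N + m) ((y + k) / (b : ℝ) ^ N)}
    with hS
  have hSm : ∀ k, MeasurableSet (S k) := fun k =>
    (measurableSet_near hα0 hα1 Q (N + m) _).preimage (by fun_prop)
  have hUm : ∀ j, MeasurableSet (near α b Q' (m + j) y) := fun j =>
    measurableSet_near hα0 hα1 Q' (m + j) y
  have hpoint : ∀ s, ∑ k ∈ G, (S k).indicator (1 : ℝ → ℝ≥0∞) s
      ≤ ∑ j ∈ range m, (near α b Q' (m + j) y).indicator
          (fun _ => ENNReal.ofReal (C * (b : ℝ) ^ j * T)) s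
        + (near α b Q' (m + m) y).indicator (fun _ => ENNReal.ofReal ((b : ℝ) ^ N)) s := by
    intro s
    have e1 : ∑ k ∈ G, (S k).indicator (1 : ℝ → ℝ≥0∞) s =
        ENNReal.ofReal (G.filter (s ∈ S ·)).card := by
      rw [ofReal_natCast, card_filter]
      push_cast
      refine sum_congr rfl fun k _ => ?_
      rw [Set.indicator_apply]
      rfl
    have e2 : G.filter (s ∈ S ·) = {k ∈ range (b ^ N) | ⌊(b : ℝ) ^ (H * N) * (y + (k : ℕ))⌋₊ ∉ B ∧
        s / (b : ℝ) ^ N ∈ near α b Q (N + m) ((y + k) / (b : ℝ) ^ N)} := by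
      rw [hG, filter_filter]
      rfl
    rw [e1, e2]
    refine (ENNReal.ofReal_le_ofReal (hcount s)).trans (ENNReal.ofReal_add_le.trans ?_)
    refine add_le_add ?_ ?_
    · rw [ofReal_sum_of_nonneg fun j _ => by split_ifs <;> positivity]
      refine sum_le_sum fun j _ => ?_
      rw [Set.indicator_apply]
      split_ifs <;> simp
    · rw [Set.indicator_apply]
      split_ifs <;> simp
  have hcmp := lintegral_mono (μ := volume) hpoint
  rw [lintegral_finsetSum _ fun k _ => measurable_one.indicator (hSm k),
    lintegral_add_left (by
      refine Finset.measurable_fun_sum _ fun j _ => measurable_const.indicator (hUm j)),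
    lintegral_finsetSum _ fun j _ => measurable_const.indicator (hUm j)] at hcmp
  simp_rw [lintegral_indicator_one (hSm _), lintegral_indicator_const (hUm _)] at hcmp
  calc ∑ k ∈ G, volume (near α b Q (N + m) ((y + k) / (b : ℝ) ^ N))
      = ENNReal.ofReal (1 / (b : ℝ) ^ N) * ∑ k ∈ G, volume (S k) := by
        rw [mul_sum]
        exact sum_congr rfl fun k _ => volume_near_eq hb Q (N + m) N _
    _ ≤ ENNReal.ofReal (1 / (b : ℝ) ^ N) * (∑ j ∈ range m, ENNReal.ofReal (C * (b : ℝ) ^ j * T)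
          * ENNReal.ofReal (β (m + j)) + ENNReal.ofReal ((b : ℝ) ^ N)
          * ENNReal.ofReal (β (m + m))) := by
        gcongr
        refine hcmp.trans (add_le_add (sum_le_sum fun j hj => ?_) ?_)
        · gcongr
          exact hβ j (mem_range.1 hj).le
        · gcongr
          exact hβ m le_rfl
    _ = _ := by
        rw [ofReal_mul (p := 1 / (b : ℝ) ^ N) (by positivity), ofReal_add
          (sum_nonneg fun j _ => mul_nonneg (by positivity) (hβ0 _))
          (mul_nonneg (by positivity) (hβ0 _)), ofReal_sum_of_nonneg
          fun j _ => mul_nonneg (by positivity) (hβ0 _),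
          ofReal_mul (p := (b : ℝ) ^ N) (by positivity)]
        congr 2
        exact sum_congr rfl fun j _ => (ofReal_mul (by positivity)).symm

end

section
variable {α : ℝ} {b : ℕ}

/-- Self-similar estimate for the set of points at which the graph is concentrated. -/
lemma exists_volume_lt_near_le (hb : 2 ≤ b) (hα0 : 0 < α) (hα1 : α < 1) (hαb : 1 < α * b) {Q : ℝ}
    (hQ : 0 < Q) : ∃ Q' C : ℝ, 0 < Q' ∧ 0 < C ∧ ∀ (H N m : ℕ) (B : Finset ℕ) (T : ℝ), 0 ≤ T →
      FewClose b (α * b)⁻¹ H 0 N 1 B T → 1 ≤ ((α * b)⁻¹) ^ N * (b : ℝ) ^ m →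
      ((α * b)⁻¹) ^ N * (b : ℝ) ^ m ≤ (b : ℝ) ^ 2 → ∀ β : ℕ → ℝ, (∀ j, 0 ≤ β j) →
      ∀ ε : ℝ, 0 < ε →
      volume (Set.Ico (0 : ℝ) 1 ∩ {x | ENNReal.ofReal ε < volume (near α b Q (N + m) x)})
        ≤ ∑ j ∈ range (m + 1), volume (Set.Ico (0 : ℝ) 1 ∩
            {y | ENNReal.ofReal (β (m + j)) < volume (near α b Q' (m + j) y)})
          + ENNReal.ofReal (B.card / (b : ℝ) ^ ((H + 1) * N))
          + ENNReal.ofReal ((1 / (b : ℝ) ^ N * (1 / (b : ℝ) ^ N *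
            (∑ j ∈ range m, C * (b : ℝ) ^ j * T * β (m + j) + (b : ℝ) ^ N * β (m + m)))) / ε) := by
  classical
  obtain ⟨Q', C, hQ', hC, hmain⟩ := exists_sum_volume_near_le hb hα0 hα1 hαb hQ
  refine ⟨Q', C, hQ', hC, fun H N m B T hT hB h1 h2 β hβ0 ε hε => ?_⟩
  set Z := ∑ j ∈ range m, C * (b : ℝ) ^ j * T * β (m + j) + (b : ℝ) ^ N * β (m + m) with hZ
  have hbN : 0 < b ^ N := by positivity
  have hbN' : (0 : ℝ) < (b : ℝ) ^ N := by positivity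
  set U : ℕ → Set ℝ := fun j => {y | ENNReal.ofReal (β (m + j)) < volume (near α b Q' (m + j) y)}
    with hU
  have hUm : ∀ j, MeasurableSet (U j) := fun j =>
    measurableSet_lt measurable_const (measurable_volume_near hα0 hα1 Q' (m + j))
  set O : Set ℝ := ⋃ j ∈ range (m + 1), U j with hO
  have hOm : MeasurableSet O := Finset.measurableSet_biUnion _ fun j _ => hUm j
  have hper : ∀ (y : ℝ) (k : ℕ), y + k ∈ O ↔ y ∈ O := by
    intro y k
    simp only [hO, hU, Set.mem_iUnion, Set.mem_ofPred_eq, near_add_nat]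
  set V : Set ℝ := {x | ⌊((b ^ ((H + 1) * N) : ℕ) : ℝ) * x⌋₊ ∈ B} with hV
  have hVm : MeasurableSet V := by
    have h : Measurable fun x : ℝ => ⌊((b ^ ((H + 1) * N) : ℕ) : ℝ) * x⌋₊ :=
      Nat.measurable_floor.comp (by fun_prop)
    exact h (Set.Countable.measurableSet B.countable_toSet)
  set O' : Set ℝ := {x | ((b ^ N : ℕ) : ℝ) * x ∈ O} with hO'
  have hO'm : MeasurableSet O' := hOm.preimage (by fun_prop)
  set F : ℝ → ℝ≥0∞ := (O'ᶜ ∩ Vᶜ).indicator fun x => volume (near α b Q (N + m) x) with hF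
  have hFm : Measurable F :=
    (measurable_volume_near hα0 hα1 Q (N + m)).indicator (hO'm.compl.inter hVm.compl)
  have hcmp : ∫⁻ x in Set.Ico (0 : ℝ) 1, F x
      ≤ ENNReal.ofReal (1 / (b : ℝ) ^ N * (1 / (b : ℝ) ^ N * Z)) := by
    have hFk : ∀ k : ℕ, Measurable fun y : ℝ => F ((y + k) / ((b ^ N : ℕ) : ℝ)) := fun k =>
      hFm.comp (by fun_prop)
    rw [lintegral_Ico_eq_sum hbN F hFm, ← lintegral_finsetSum _ fun k _ => hFk k,
      ofReal_mul (by positivity)]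
    have e : ((b ^ N : ℕ) : ℝ≥0∞)⁻¹ = ENNReal.ofReal (1 / (b : ℝ) ^ N) := by
      rw [one_div, ofReal_inv_of_pos hbN', ← Nat.cast_pow, ofReal_natCast]
    rw [e]
    refine mul_le_mul_right ?_ _
    refine (setLIntegral_mono measurable_const (g := fun _ => ENNReal.ofReal (1 / (b : ℝ) ^ N * Z))
      fun y hy => ?_).trans_eq ?_
    · by_cases hyO : y ∈ O
      · refine le_trans (le_of_eq ?_) zero_le
        refine sum_eq_zero fun k _ => ?_
        refine Set.indicator_of_notMem (fun h => h.1 ?_) _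
        rw [hO', Set.mem_ofPred_eq, mul_div_cancel₀ _ (by positivity), hper]
        exact hyO
      · refine le_trans ?_ (hmain H N m B T hT hB h1 h2 y hy.1 hy.2 β hβ0 fun j hj => ?_)
        · rw [sum_filter]
          refine sum_le_sum fun k _ => ?_
          have e : ((b ^ ((H + 1) * N) : ℕ) : ℝ) * ((y + k) / ((b ^ N : ℕ) : ℝ))
              = (b : ℝ) ^ (H * N) * (y + k) := by
            push_cast
            rw [add_mul, one_mul, pow_add]
            field_simp
          split_ifs with h
          · refine le_of_eq (Set.indicator_of_notMem (fun h' => h'.2 ?_) _)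
            rw [hV, Set.mem_ofPred_eq, e]
            exact h
          · rw [← Nat.cast_pow b N]
            exact Set.indicator_le_self _ _ _
        · by_contra! hlt
          exact hyO (Set.mem_biUnion (by simpa using Nat.lt_succ_of_le hj) hlt)
    · simp
  have hsub : Set.Ico (0 : ℝ) 1 ∩ {x | ENNReal.ofReal ε < volume (near α b Q (N + m) x)}
      ⊆ ((Set.Ico (0 : ℝ) 1 ∩ O') ∪ (Set.Ico (0 : ℝ) 1 ∩ V)) ∪
        (Set.Ico (0 : ℝ) 1 ∩ {x | ENNReal.ofReal ε ≤ F x}) := by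
    rintro x ⟨hx, hxε⟩
    by_cases h1 : x ∈ O'
    · exact Or.inl (Or.inl ⟨hx, h1⟩)
    by_cases h2 : x ∈ V
    · exact Or.inl (Or.inr ⟨hx, h2⟩)
    refine Or.inr ⟨hx, ?_⟩
    rw [Set.mem_ofPred_eq, hF, Set.indicator_of_mem (show x ∈ O'ᶜ ∩ Vᶜ from ⟨h1, h2⟩)]
    exact hxε.le
  refine (measure_mono hsub).trans ((measure_union_le _ _).trans (add_le_add
    ((measure_union_le _ _).trans (add_le_add ?_ ?_)) ?_))
  · rw [volume_Ico_inter_preimage_mul hbN hOm hper, hO, Set.inter_iUnion₂]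
    exact measure_biUnion_finset_le _ _
  · refine (volume_floor_mem_le (by positivity) B).trans_eq ?_
    rw [Nat.cast_pow]
  · have hmarkov := mul_meas_ge_le_lintegral (μ := volume.restrict (Set.Ico (0 : ℝ) 1)) hFm
      (ENNReal.ofReal ε)
    rw [Measure.restrict_apply (measurableSet_le measurable_const hFm), Set.inter_comm] at hmarkov
    rw [ofReal_div_of_pos hε, ENNReal.le_div_iff_mul_le (Or.inl (by simpa using hε))
      (Or.inl ofReal_ne_top), mul_comm]
    exact hmarkov.trans hcmp

end

lemma exists_add_mul_pow_le (K : ℝ) {x y : ℝ} (hx : 0 ≤ x) (hxy : x < y) :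
    ∃ n₀ : ℕ, ∀ n ≥ n₀, (n + K) * x ^ n ≤ y ^ n := by
  have hy : 0 < y := by linarith
  have hr1 : x / y < 1 := (div_lt_one hy).2 hxy
  have hr0 : 0 ≤ x / y := by positivity
  have h := (tendsto_self_mul_const_pow_of_lt_one hr0 hr1).add
    ((tendsto_pow_atTop_nhds_zero_of_lt_one hr0 hr1).const_mul K)
  rw [mul_zero, add_zero] at h
  obtain ⟨n₀, hn₀⟩ := Filter.eventually_atTop.1 (h.eventually_le_const zero_lt_one)
  refine ⟨n₀, fun n hn => ?_⟩
  have := hn₀ n hn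
  rw [← add_mul, div_pow, mul_div_assoc', div_le_one (by positivity)] at this
  exact this

lemma exists_le_pow {τ : ℝ} (h0 : 0 ≤ τ) (h1 : τ < 1) (P : ℕ) (hP : 1 ≤ P) :
    ∃ τ' : ℝ, 0 < τ' ∧ τ' < 1 ∧ τ ≤ τ' ^ P := by
  have hP' : (1 : ℝ) ≤ P := by exact_mod_cast hP
  have h2 : (1 - τ) / (2 * P) ≤ 1 / 2 := by
    apply div_le_div₀ <;> linarith
  have h3 : 0 < (1 - τ) / (2 * P) := by
    apply div_pos <;> linarith
  refine ⟨1 + -((1 - τ) / (2 * P)), by linarith, by linarith, ?_⟩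
  refine le_trans ?_ (one_add_mul_le_pow (by linarith) P)
  field_simp
  linarith

lemma exists_split {γ : ℝ} {b : ℕ} (hγ : 0 < γ) (hγ1 : γ < 1) (hb : 2 ≤ b) (hbγ : 1 < γ * b) :
    ∃ P : ℕ, 1 ≤ P ∧ ∀ n ≥ 2, ∃ N m : ℕ, N + m = n ∧ m ≤ N + 1 ∧ 1 ≤ γ ^ N * (b : ℝ) ^ m ∧
      γ ^ N * (b : ℝ) ^ m ≤ (b : ℝ) ^ 2 ∧ n ≤ P * m ∧ n ≤ P * N := by
  classical
  have hb0 : (0 : ℝ) < b := by positivity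
  have hb1 : (1 : ℝ) < b := by exact_mod_cast hb
  obtain ⟨p, hp⟩ := exists_pow_lt_of_lt_one (inv_pos.2 hb0) hγ1
  have hp' : γ ^ p * b ≤ 1 := by
    rw [← le_div_iff₀ hb0, one_div]
    exact hp.le
  refine ⟨p + 3, by omega, fun n hn => ?_⟩
  have hex : ∃ m, 1 ≤ γ ^ (n - m) * (b : ℝ) ^ m := ⟨n, by simpa using one_le_pow₀ hb1.le⟩
  set m := Nat.find hex with hm
  have hm1 : 1 ≤ γ ^ (n - m) * (b : ℝ) ^ m := Nat.find_spec hex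
  have hmn : m ≤ n := Nat.find_min' hex (by simpa using one_le_pow₀ hb1.le)
  have hm0 : m ≠ 0 := by
    intro h0
    rw [h0, pow_zero, mul_one, Nat.sub_zero] at hm1
    exact absurd hm1 (not_le.2 (pow_lt_one₀ hγ.le hγ1 (by omega)))
  obtain ⟨m', hm'⟩ := Nat.exists_eq_succ_of_ne_zero hm0
  obtain ⟨N, hN⟩ := Nat.exists_eq_add_of_le hmn
  have hmin := Nat.find_min hex (show m' < m by omega)
  rw [show n - m' = N + 1 by omega, not_le] at hmin
  rw [show n - m = N by omega] at hm1
  have hmN : m' ≤ N := by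
    by_contra! hlt
    refine absurd hmin (not_lt.2 ?_)
    calc 1 ≤ (γ * b) ^ (N + 1) := one_le_pow₀ hbγ.le
      _ = γ ^ (N + 1) * (b : ℝ) ^ (N + 1) := mul_pow _ _ _
      _ ≤ γ ^ (N + 1) * (b : ℝ) ^ m' := by
        gcongr
        · exact hb1.le
        · omega
  have hNp : N ≤ p * m := by
    by_contra! hlt
    refine absurd hm1 (not_le.2 ?_)
    calc γ ^ N * (b : ℝ) ^ m ≤ γ ^ (p * m + 1) * (b : ℝ) ^ m := by
          refine mul_le_mul_of_nonneg_right ?_ (by positivity)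
          exact pow_le_pow_of_le_one hγ.le hγ1.le hlt
      _ = γ * (γ ^ p * b) ^ m := by rw [mul_pow, ← pow_mul]; ring
      _ ≤ γ * 1 := by gcongr; exact pow_le_one₀ (by positivity) hp'
      _ < 1 := by linarith
  refine ⟨N, m, by omega, by omega, hm1, ?_, by nlinarith, by nlinarith⟩
  have h1 : γ ^ N * (b : ℝ) ^ m = (γ ^ (N + 1) * (b : ℝ) ^ m') * (b / γ) := by
    rw [hm', pow_succ (b : ℝ)]
    field_simp
    ring
  have h2 : (b : ℝ) / γ ≤ (b : ℝ) ^ 2 := by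
    rw [div_le_iff₀ hγ]
    nlinarith
  rw [h1]
  calc _ ≤ 1 * ((b : ℝ) / γ) := by
        refine mul_le_mul_of_nonneg_right hmin.le (by positivity)
    _ ≤ _ := by rw [one_mul]; exact h2

/-- The occupation measures of the graph are of exponential order at most `Γ / b` at all points
off an exponentially small set. -/
def NearBound (α : ℝ) (b : ℕ) (Γ : ℝ) : Prop :=
  ∀ Q : ℝ, 0 < Q → ∀ σ : ℝ, 1 < σ → ∃ τ : ℝ, 0 < τ ∧ τ < 1 ∧ ∃ n₀ : ℕ, ∀ n ≥ n₀,
    volume (Set.Ico (0 : ℝ) 1 ∩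
      {x | ENNReal.ofReal ((Γ * σ) ^ n / (b : ℝ) ^ n) < volume (near α b Q n x)})
      ≤ ENNReal.ofReal (τ ^ n)

section
variable {α : ℝ} {b : ℕ}

lemma nearBound_one : NearBound α b 1 := by
  intro Q hQ σ hσ
  obtain ⟨n₀, hn₀⟩ := exists_mul_pow_le 2 zero_le_one hσ
  refine ⟨1 / 2, by norm_num, by norm_num, n₀, fun n hn => ?_⟩
  have hempty : {x | ENNReal.ofReal ((1 * σ) ^ n / (b : ℝ) ^ n) < volume (near α b Q n x)} = ∅ := by
    rw [Set.eq_empty_iff_forall_notMem]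
    refine fun x => not_lt.2 ((volume_near_le Q n x).trans (ENNReal.ofReal_le_ofReal ?_))
    have := hn₀ n hn
    rw [one_pow, mul_one] at this
    rw [one_mul, mul_one_div]
    gcongr
  rw [hempty, Set.inter_empty, measure_empty]
  exact zero_le

lemma near_sum_le {γ Γ Γ₁ C s : ℝ} {N m : ℕ} (hb : 2 ≤ b) (hγ : 0 < γ) (hγΓ : γ ≤ Γ) (hΓ : Γ ≤ 1)
    (hγΓ₁ : γ ≤ Γ₁) (hΓ₁ : Γ₁ ≤ 1) (hΓΓ₁ : γ * Γ ≤ Γ₁ ^ 2) (hC : 0 < C) (hs : 1 < s)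
    (hmN : m ≤ N + 1) (h1 : 1 ≤ γ ^ N * (b : ℝ) ^ m) :
    1 / (b : ℝ) ^ N * (1 / (b : ℝ) ^ N * (∑ j ∈ range m, C * (b : ℝ) ^ j * (b * γ * s) ^ N *
        ((Γ * s) ^ (m + j) / (b : ℝ) ^ (m + j)) + (b : ℝ) ^ N *
        ((Γ * s) ^ (m + m) / (b : ℝ) ^ (m + m)))) /
        ((Γ₁ * s ^ 4) ^ (N + m) / (b : ℝ) ^ (N + m))
      ≤ (C / (s - 1) + 1) / γ * (s⁻¹) ^ (N + m) := by
  have hb0 : (0 : ℝ) < b := by positivity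
  have hs0 : 0 < s := by linarith
  have hΓ0 : 0 < Γ := by linarith
  have hΓ₁0 : 0 < Γ₁ := by linarith
  set E := (b : ℝ) ^ N / (b : ℝ) ^ m * (γ ^ N * Γ ^ m * s ^ (2 * (N + m))) with hE
  have hterm : ∀ j ∈ range m, C * (b : ℝ) ^ j * (b * γ * s) ^ N *
      ((Γ * s) ^ (m + j) / (b : ℝ) ^ (m + j)) ≤ C * E := by
    intro j hj
    have hj := mem_range.1 hj
    calc C * (b : ℝ) ^ j * (b * γ * s) ^ N * ((Γ * s) ^ (m + j) / (b : ℝ) ^ (m + j))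
        = C * ((b : ℝ) ^ N / (b : ℝ) ^ m * (γ ^ N * Γ ^ (m + j) * s ^ (N + (m + j)))) := by
          rw [pow_add (b : ℝ), mul_pow, mul_pow, mul_pow, pow_add s N, pow_add s]
          field_simp
      _ ≤ C * E := by
          refine mul_le_mul_of_nonneg_left (mul_le_mul_of_nonneg_left ?_ (by positivity)) hC.le
          refine mul_le_mul (mul_le_mul_of_nonneg_left
            (pow_le_pow_of_le_one hΓ0.le hΓ (by omega)) (by positivity))
            (pow_le_pow_right₀ hs.le (by omega)) (by positivity) (by positivity)
  have hlast : (b : ℝ) ^ N * ((Γ * s) ^ (m + m) / (b : ℝ) ^ (m + m)) ≤ E := by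
    calc (b : ℝ) ^ N * ((Γ * s) ^ (m + m) / (b : ℝ) ^ (m + m))
        = (b : ℝ) ^ N / (b : ℝ) ^ m * ((1 / (b : ℝ) ^ m * Γ ^ (m + m)) * s ^ (m + m)) := by
          rw [pow_add (b : ℝ), mul_pow]
          field_simp
      _ ≤ E := by
          refine mul_le_mul_of_nonneg_left (mul_le_mul (mul_le_mul ?_
            (pow_le_pow_of_le_one hΓ0.le hΓ (by omega)) (by positivity) (by positivity))
            (pow_le_pow_right₀ hs.le (by omega)) (by positivity) (by positivity)) (by positivity)
          rwa [div_le_iff₀ (by positivity)]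
  have hΓN : γ ^ N * Γ ^ m ≤ Γ₁ ^ (N + m) / γ := by
    rw [le_div_iff₀ hγ]
    obtain ⟨d, hd⟩ := Nat.exists_eq_add_of_le hmN
    calc γ ^ N * Γ ^ m * γ = γ ^ (N + 1) * Γ ^ m := by ring
      _ = γ ^ d * (γ * Γ) ^ m := by rw [hd, mul_pow]; ring
      _ ≤ Γ₁ ^ d * (Γ₁ ^ 2) ^ m := by gcongr
      _ = Γ₁ ^ (N + 1 + m) := by rw [hd]; ring
      _ ≤ Γ₁ ^ (N + m) := pow_le_pow_of_le_one hΓ₁0.le hΓ₁ (by omega)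
  have hms : m ≤ s ^ (N + m) / (s - 1) := by
    rw [le_div_iff₀ (by linarith)]
    have h := one_add_mul_le_pow (a := s - 1) (by linarith) (N + m)
    rw [add_sub_cancel] at h
    push_cast at h
    have : (0 : ℝ) ≤ N * (s - 1) := mul_nonneg (by positivity) (by linarith)
    linarith
  have hs1 : 1 ≤ s ^ (N + m) := one_le_pow₀ hs.le
  have hCm : m * C + 1 ≤ (C / (s - 1) + 1) * s ^ (N + m) := by
    calc m * C + 1 ≤ s ^ (N + m) / (s - 1) * C + s ^ (N + m) := by gcongr
      _ = _ := by ring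
  have hsum : ∑ j ∈ range m, C * (b : ℝ) ^ j * (b * γ * s) ^ N *
      ((Γ * s) ^ (m + j) / (b : ℝ) ^ (m + j)) + (b : ℝ) ^ N *
      ((Γ * s) ^ (m + m) / (b : ℝ) ^ (m + m)) ≤ (m * C + 1) * E := by
    have := sum_le_sum hterm
    rw [sum_const, card_range, nsmul_eq_mul] at this
    linarith
  rw [div_le_iff₀ (by positivity)]
  calc _ ≤ 1 / (b : ℝ) ^ N * (1 / (b : ℝ) ^ N * ((m * C + 1) * E)) := by gcongr
    _ = (m * C + 1) * (γ ^ N * Γ ^ m) * s ^ (2 * (N + m)) / (b : ℝ) ^ (N + m) := by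
      rw [hE, pow_add (b : ℝ)]
      field_simp
    _ ≤ ((C / (s - 1) + 1) * s ^ (N + m)) * (Γ₁ ^ (N + m) / γ) * s ^ (2 * (N + m))
        / (b : ℝ) ^ (N + m) := by gcongr
    _ = _ := by
      rw [inv_pow, mul_pow]
      field_simp
      ring

lemma NearBound.step (hb : 2 ≤ b) (hα0 : 0 < α) (hα1 : α < 1) (hαb : 1 < α * b) {Γ Γ₁ : ℝ}
    (h : NearBound α b Γ) (hγΓ : (α * b)⁻¹ ≤ Γ) (hΓ : Γ ≤ 1) (hγΓ₁ : (α * b)⁻¹ ≤ Γ₁) (hΓ₁ : Γ₁ ≤ 1)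
    (hΓΓ₁ : (α * b)⁻¹ * Γ ≤ Γ₁ ^ 2) : NearBound α b Γ₁ := by
  intro Q hQ σ hσ
  have hb0 : (0 : ℝ) < b := by positivity
  set γ := (α * b)⁻¹ with hγd
  have hγ : 0 < γ := by positivity
  have hγ1 : γ < 1 := inv_lt_one_of_one_lt₀ hαb
  have hγb : 1 < γ * b := by
    rw [hγd, mul_inv, mul_assoc, inv_mul_cancel₀ hb0.ne', mul_one]
    exact (one_lt_inv₀ hα0).2 hα1
  obtain ⟨s, hs1, hsσ⟩ : ∃ s : ℝ, 1 < s ∧ s ^ 4 = σ :=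
    ⟨σ ^ ((4 : ℕ) : ℝ)⁻¹, Real.one_lt_rpow hσ (by norm_num),
      Real.rpow_inv_natCast_pow (by linarith) (by norm_num)⟩
  have hs0 : 0 < s := by linarith
  have hΓ0 : 0 < Γ := by linarith
  have hΓ₁0 : 0 < Γ₁ := by linarith
  obtain ⟨Q', C, hQ', hC, hmain⟩ := exists_volume_lt_near_le hb hα0 hα1 hαb hQ
  obtain ⟨H, hH⟩ := exists_sparse hb hγ hγ1 hγb
  obtain ⟨τ₁, hτ₁0, hτ₁1, n₁, hn₁⟩ := hH 1 one_pos s hs1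
  obtain ⟨τ₂, hτ₂0, hτ₂1, n₂, hn₂⟩ := h Q' hQ' s hs1
  obtain ⟨P, hP, hsplit⟩ := exists_split hγ hγ1 hb hγb
  obtain ⟨τ₃, hτ₃0, hτ₃1, hτ₃⟩ := exists_le_pow (le_max_of_le_left hτ₁0.le) (max_lt hτ₁1 hτ₂1) P hP
  set ρ := max τ₃ s⁻¹ with hρ
  have hρ0 : 0 < ρ := lt_max_of_lt_left hτ₃0
  have hρ1 : ρ < 1 := max_lt hτ₃1 (inv_lt_one_of_one_lt₀ hs1)
  set K := (C / (s - 1) + 1) / γ with hK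
  have hK0 : 0 ≤ K := by
    have : 0 < s - 1 := by linarith
    positivity
  obtain ⟨n₃, hn₃⟩ := exists_add_mul_pow_le (2 + K) hρ0.le (show ρ < (1 + ρ) / 2 by linarith)
  refine ⟨(1 + ρ) / 2, by linarith, by linarith, P * n₁ + P * n₂ + n₃ + 2, fun n hn => ?_⟩
  obtain ⟨N, m, hNm, hmN, h1, h2, hPm, hPN⟩ := hsplit n (by omega)
  have hNn₁ : n₁ ≤ N := by
    by_contra! hlt
    have := Nat.mul_le_mul_left P hlt.le
    omega
  have hmn₂ : n₂ ≤ m := by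
    by_contra! hlt
    have := Nat.mul_le_mul_left P hlt.le
    omega
  obtain ⟨B, -, hBcard, hBfew⟩ := hn₁ N hNn₁
  have hpow : ∀ τ : ℝ, 0 < τ → τ ≤ max τ₁ τ₂ → ∀ l : ℕ, n ≤ P * l → τ ^ l ≤ ρ ^ n := by
    intro τ hτ0 hτ l hl
    calc τ ^ l ≤ (τ₃ ^ P) ^ l := by
          gcongr
          exact hτ.trans hτ₃
      _ = τ₃ ^ (P * l) := (pow_mul _ _ _).symm
      _ ≤ τ₃ ^ n := pow_le_pow_of_le_one hτ₃0.le hτ₃1.le hl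
      _ ≤ ρ ^ n := by gcongr; exact le_max_left _ _
  have hbound := hmain H N m B ((b * γ * s) ^ N) (by positivity) hBfew h1 h2
    (fun j => (Γ * s) ^ j / (b : ℝ) ^ j) (fun j => by positivity)
    ((Γ₁ * σ) ^ (N + m) / (b : ℝ) ^ (N + m)) (by positivity)
  rw [← hNm]
  refine hbound.trans ?_
  calc _ ≤ ∑ j ∈ range (m + 1), ENNReal.ofReal (ρ ^ n) + ENNReal.ofReal (ρ ^ n)
        + ENNReal.ofReal (K * ρ ^ n) := by
        refine add_le_add (add_le_add (sum_le_sum fun j _ => ?_) (ofReal_le_ofReal ?_))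
          (ofReal_le_ofReal ?_)
        · exact (hn₂ (m + j) (by omega)).trans (ofReal_le_ofReal
            (hpow τ₂ hτ₂0 (le_max_right _ _) (m + j)
              (hPm.trans (Nat.mul_le_mul_left P (by omega)))))
        · rw [div_le_iff₀ (by positivity)]
          have := hpow τ₁ hτ₁0 (le_max_left _ _) N hPN
          refine hBcard.trans ?_
          rw [mul_comm]
          gcongr
        · rw [← hsσ]
          refine (near_sum_le hb hγ hγΓ hΓ hγΓ₁ hΓ₁ hΓΓ₁ hC hs1 hmN h1).trans ?_
          rw [hNm]
          gcongr
          exact le_max_right _ _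
    _ = ENNReal.ofReal ((m + 2 + K) * ρ ^ n) := by
        rw [sum_const, card_range, nsmul_eq_mul, ← ofReal_natCast, ← ofReal_mul (by positivity),
          ← ofReal_add (by positivity) (by positivity),
          ← ofReal_add (by positivity) (by positivity)]
        congr 1
        push_cast
        ring
    _ ≤ ENNReal.ofReal (((1 + ρ) / 2) ^ (N + m)) := by
        refine ofReal_le_ofReal ?_
        rw [hNm]
        refine le_trans ?_ (hn₃ n (by omega))
        have : (m : ℝ) ≤ n := by exact_mod_cast (by omega : m ≤ n)
        refine mul_le_mul_of_nonneg_right (by linarith) (by positivity)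

lemma nearBound_inv (hb : 2 ≤ b) (hα0 : 0 < α) (hα1 : α < 1) (hαb : 1 < α * b) :
    NearBound α b (α * b)⁻¹ := by
  have hb0 : (0 : ℝ) < b := by positivity
  have hγ : 0 < (α * b)⁻¹ := by positivity
  have hγ1 : (α * b)⁻¹ < 1 := inv_lt_one_of_one_lt₀ hαb
  have hle : ∀ k : ℕ, (α * b)⁻¹ ≤ (α * b)⁻¹ ^ (1 - (1 / 2 : ℝ) ^ k) := fun k => by
    conv_lhs => rw [← Real.rpow_one (α * b)⁻¹]
    refine Real.rpow_le_rpow_of_exponent_ge hγ hγ1.le ?_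
    have : (0 : ℝ) ≤ (1 / 2) ^ k := by positivity
    linarith
  have hle1 : ∀ k : ℕ, (α * b)⁻¹ ^ (1 - (1 / 2 : ℝ) ^ k) ≤ 1 := fun k => by
    refine Real.rpow_le_one hγ.le hγ1.le ?_
    have : (1 / 2 : ℝ) ^ k ≤ 1 := pow_le_one₀ (by norm_num) (by norm_num)
    linarith
  have hstep : ∀ k : ℕ, NearBound α b ((α * b)⁻¹ ^ (1 - (1 / 2 : ℝ) ^ k)) := by
    intro k
    induction k with
    | zero => simpa using nearBound_one
    | succ k ih =>
      refine ih.step hb hα0 hα1 hαb (hle k) (hle1 k) (hle _) (hle1 _) (le_of_eq ?_)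
      rw [← Real.rpow_natCast _ 2, ← Real.rpow_mul hγ.le]
      nth_rewrite 1 [← Real.rpow_one (α * b)⁻¹]
      rw [← Real.rpow_add hγ]
      congr 1
      push_cast
      ring
  intro Q hQ σ hσ
  have hlim : Filter.Tendsto (fun k : ℕ => (α * b)⁻¹ ^ (1 - (1 / 2 : ℝ) ^ k)) Filter.atTop
      (nhds (α * b)⁻¹) := by
    have h := (tendsto_pow_atTop_nhds_zero_of_lt_one (r := (1 / 2 : ℝ)) (by norm_num)
      (by norm_num)).const_sub 1
    have h2 := (Real.continuous_const_rpow hγ.ne').tendsto (1 - 0) |>.comp h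
    rw [sub_zero, Real.rpow_one] at h2
    exact h2
  have hsq : 1 < √σ := by rwa [Real.lt_sqrt zero_le_one, one_pow]
  obtain ⟨k, hk⟩ := (hlim.eventually_lt_const
    (show (α * b)⁻¹ < (α * b)⁻¹ * √σ from lt_mul_of_one_lt_right hγ hsq)).exists
  obtain ⟨τ, hτ0, hτ1, n₀, hn₀⟩ := hstep k Q hQ (√σ) hsq
  refine ⟨τ, hτ0, hτ1, n₀, fun n hn => (measure_mono ?_).trans (hn₀ n hn)⟩
  rintro x ⟨hx, hxn⟩
  refine ⟨hx, lt_of_le_of_lt (ENNReal.ofReal_le_ofReal ?_) hxn⟩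
  have hmul : (α * b)⁻¹ ^ (1 - (1 / 2 : ℝ) ^ k) * √σ ≤ (α * b)⁻¹ * σ := by
    have := mul_le_mul_of_nonneg_right hk.le (Real.sqrt_nonneg σ)
    rwa [mul_assoc, Real.mul_self_sqrt (by linarith)] at this
  have hpos : 0 ≤ (α * b)⁻¹ ^ (1 - (1 / 2 : ℝ) ^ k) := (hle k).trans' hγ.le
  exact div_le_div_of_nonneg_right (pow_le_pow_left₀ (by positivity) hmul n) (by positivity)

end

end WeierstrassGraph

namespace WeierstrassGraph

open Finset MeasureTheory ENNReal NNReal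

section
variable {α : ℝ} {b : ℕ}

lemma le_hausdorffMeasure_graph (hb : 2 ≤ b) (hα0 : 0 < α) (hα1 : α < 1) (d : ℝ≥0) {A : Set ℝ}
    (n₀ : ℕ) (h : ∀ x ∈ A, ∀ n ≥ n₀,
      volume (near α b 1 n x) ≤ ENNReal.ofReal (((b : ℝ) ^ (-(d : ℝ))) ^ (n + 1))) :
    (volume.restrict A).map (fun x => (x, weierstrass α b x)) ≤ μH[(d : ℝ)] := by
  have hW := continuous_weierstrass (b := b) hα0 hα1
  have hb0 : (0 : ℝ) < b := by positivity
  have hb1 : (1 : ℝ) < b := by exact_mod_cast hb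
  set g : ℝ → ℝ × ℝ := fun x => (x, weierstrass α b x) with hg
  have hgc : Continuous g := by fun_prop
  refine Measure.le_hausdorffMeasure d _ (ENNReal.ofReal ((b : ℝ)⁻¹ ^ n₀))
    (by simpa using by positivity) fun s hs => ?_
  refine (measure_mono subset_closure).trans ?_
  rw [Measure.map_apply hgc.measurable isClosed_closure.measurableSet,
    Measure.restrict_apply (isClosed_closure.preimage hgc).measurableSet]
  have hdist : ∀ x y, g x ∈ closure s → g y ∈ closure s → edist (g x) (g y) ≤ Metric.ediam s := by
    intro x y hx hy
    rw [← Metric.ediam_closure]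
    exact Metric.edist_le_ediam_of_mem hx hy
  have htop : Metric.ediam s ≠ ∞ := ne_top_of_le_ne_top ofReal_ne_top hs
  rcases (g ⁻¹' closure s ∩ A).eq_empty_or_nonempty with he | ⟨x₀, hx₀, hx₀A⟩
  · rw [he, measure_empty]
    exact zero_le
  set δ := (Metric.ediam s).toReal with hδ
  have hδs : Metric.ediam s = ENNReal.ofReal δ := (ofReal_toReal htop).symm
  have hdist' : ∀ x, g x ∈ closure s → |x - x₀| ≤ δ ∧
      |weierstrass α b x - weierstrass α b x₀| ≤ δ := by
    intro x hx
    have := hdist x x₀ hx hx₀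
    rw [hδs, edist_dist, ofReal_le_ofReal_iff toReal_nonneg, Prod.dist_eq, max_le_iff] at this
    exact this
  rcases (toReal_nonneg (a := Metric.ediam s)).eq_or_lt with hz | hpos
  · have hsub : g ⁻¹' closure s ∩ A ⊆ {x₀} := by
      rintro x ⟨hx, -⟩
      have := (hdist' x hx).1
      rw [hδ, ← hz, abs_nonpos_iff, sub_eq_zero] at this
      exact this
    refine (measure_mono hsub).trans ?_
    rw [Real.volume_singleton]
    exact zero_le
  have hδn : δ ≤ (b : ℝ)⁻¹ ^ n₀ := by
    rw [hδs] at hs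
    exact (ofReal_le_ofReal_iff (by positivity)).1 hs
  have hinv : (b : ℝ)⁻¹ < 1 := inv_lt_one_of_one_lt₀ hb1
  obtain ⟨n, hn1, hn2⟩ := exists_nat_pow_near_of_lt_one hpos
    (hδn.trans (pow_le_one₀ (by positivity) hinv.le)) (inv_pos.2 hb0) hinv
  have hn : n₀ ≤ n := Nat.lt_succ_iff.1
    ((pow_lt_pow_iff_right_of_lt_one₀ (inv_pos.2 hb0) hinv).1 (hn1.trans_le hδn))
  have hsub : g ⁻¹' closure s ∩ A ⊆ (fun x => x + -x₀) ⁻¹' near α b 1 n x₀ := by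
    rintro x ⟨hx, -⟩
    obtain ⟨h1, h2⟩ := hdist' x hx
    rw [inv_pow, ← one_div] at hn2
    refine ⟨?_, ?_⟩
    · simpa only [← sub_eq_add_neg] using h1.trans hn2
    · have e : x₀ + (x + -x₀) = x := by ring
      simpa only [e] using h2.trans hn2
  refine (measure_mono hsub).trans ?_
  rw [measure_preimage_add_right]
  refine (h x₀ hx₀A n hn).trans ?_
  rw [hδs, ofReal_rpow_of_pos hpos]
  refine ofReal_le_ofReal ?_
  calc ((b : ℝ) ^ (-(d : ℝ))) ^ (n + 1) = ((b : ℝ)⁻¹ ^ (n + 1)) ^ (d : ℝ) := by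
        rw [Real.rpow_neg hb0.le, ← Real.inv_rpow hb0.le, ← Real.rpow_natCast, ← Real.rpow_natCast,
          ← Real.rpow_mul (by positivity), ← Real.rpow_mul (by positivity), mul_comm]
    _ ≤ δ ^ (d : ℝ) := by gcongr

lemma exists_volume_pos (hb : 2 ≤ b) (hα0 : 0 < α) (hα1 : α < 1) (hαb : 1 < α * b) {σ : ℝ}
    (hσ : 1 < σ) : ∃ n₀ : ℕ, 0 < volume (Set.Ico (0 : ℝ) 1 ∩ ⋂ k : ℕ, {x |
      volume (near α b 1 (n₀ + k) x)
        ≤ ENNReal.ofReal (((α * b)⁻¹ * σ) ^ (n₀ + k) / (b : ℝ) ^ (n₀ + k))}) := by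
  obtain ⟨τ, hτ0, hτ1, n₁, hn₁⟩ := nearBound_inv hb hα0 hα1 hαb 1 one_pos σ hσ
  obtain ⟨n₂, hn₂⟩ := exists_pow_lt_of_lt_one (show 0 < 1 - τ by linarith) hτ1
  set n₀ := n₁ + n₂ with hn₀
  refine ⟨n₀, pos_iff_ne_zero.2 fun hzero => ?_⟩
  set U : ℕ → Set ℝ := fun k => {x |
    volume (near α b 1 (n₀ + k) x)
      ≤ ENNReal.ofReal (((α * b)⁻¹ * σ) ^ (n₀ + k) / (b : ℝ) ^ (n₀ + k))} with hU
  have hsub : Set.Ico (0 : ℝ) 1 ⊆ (Set.Ico (0 : ℝ) 1 ∩ ⋂ k, U k) ∪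
      ⋃ k, Set.Ico (0 : ℝ) 1 ∩ (U k)ᶜ := by
    intro x hx
    by_cases hxU : x ∈ ⋂ k, U k
    · exact Or.inl ⟨hx, hxU⟩
    · rw [Set.mem_iInter, not_forall] at hxU
      obtain ⟨k, hk⟩ := hxU
      exact Or.inr (Set.mem_iUnion.2 ⟨k, hx, hk⟩)
  have hle : ∀ k, volume (Set.Ico (0 : ℝ) 1 ∩ (U k)ᶜ) ≤ ENNReal.ofReal (τ ^ (n₀ + k)) := by
    intro k
    refine (measure_mono ?_).trans (hn₁ (n₀ + k) (by omega))
    rintro x ⟨hx, hxk⟩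
    refine ⟨hx, ?_⟩
    rw [Set.mem_ofPred_eq]
    exact lt_of_not_ge hxk
  have hsum : ∑' k, ENNReal.ofReal (τ ^ (n₀ + k)) = ENNReal.ofReal (τ ^ n₀ * (1 - τ)⁻¹) := by
    simp_rw [pow_add]
    rw [← ofReal_tsum_of_nonneg (fun k => by positivity)
      ((summable_geometric_of_lt_one hτ0.le hτ1).mul_left _), _root_.tsum_mul_left,
      tsum_geometric_of_lt_one hτ0.le hτ1]
  have h1 : (1 : ℝ≥0∞) ≤ ENNReal.ofReal (τ ^ n₀ * (1 - τ)⁻¹) := by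
    calc (1 : ℝ≥0∞) = volume (Set.Ico (0 : ℝ) 1) := by simp
      _ ≤ volume (Set.Ico (0 : ℝ) 1 ∩ ⋂ k, U k) + ∑' k, volume (Set.Ico (0 : ℝ) 1 ∩ (U k)ᶜ) :=
        (measure_mono hsub).trans ((measure_union_le _ _).trans
          (add_le_add_right (measure_iUnion_le _) _))
      _ ≤ _ := by
        rw [hzero, zero_add, ← hsum]
        exact ENNReal.tsum_le_tsum hle
  rw [one_le_ofReal, ← div_eq_mul_inv, le_div_iff₀ (by linarith), one_mul] at h1
  have : τ ^ n₀ ≤ τ ^ n₂ := pow_le_pow_of_le_one hτ0.le hτ1.le (by omega)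
  linarith

lemma le_dimH_graph (hb : 2 ≤ b) (hα0 : 0 < α) (hα1 : α < 1) (hαb : 1 < α * b) :
    ENNReal.ofReal (2 + Real.log α / Real.log b)
      ≤ dimH {p : ℝ × ℝ | ∃ x ∈ Set.Icc (0 : ℝ) 1, p = (x, weierstrass α b x)} := by
  have hb0 : (0 : ℝ) < b := by positivity
  have hb1 : (1 : ℝ) < b := by exact_mod_cast hb
  have hlogb : 0 < Real.log b := Real.log_pos hb1
  refine ENNReal.le_of_forall_nnreal_lt fun d hd => ?_
  have hd' : (d : ℝ) < 2 + Real.log α / Real.log b := by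
    rwa [← ofReal_coe_nnreal, ofReal_lt_ofReal_iff_of_nonneg d.coe_nonneg] at hd
  set z := (b : ℝ) ^ (-(d : ℝ)) with hz
  have hz0 : 0 < z := by positivity
  have hγz : (α * b)⁻¹ / b < z := by
    rw [← Real.log_lt_log_iff (by positivity) hz0, hz, Real.log_rpow hb0,
      Real.log_div (by positivity) hb0.ne', Real.log_inv, Real.log_mul hα0.ne' hb0.ne']
    have := mul_lt_mul_of_pos_right hd' hlogb
    rw [add_mul, div_mul_cancel₀ _ hlogb.ne'] at this
    linarith
  have hγ : 0 < (α * b)⁻¹ / b := by positivity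
  obtain ⟨σ, hσ1, hσz⟩ : ∃ σ : ℝ, 1 < σ ∧ (α * b)⁻¹ / b * σ < z := by
    obtain ⟨σ, h1, h2⟩ := exists_between ((one_lt_div hγ).2 hγz)
    exact ⟨σ, h1, by rwa [lt_div_iff₀ hγ, mul_comm] at h2⟩
  obtain ⟨n₀, hpos⟩ := exists_volume_pos hb hα0 hα1 hαb hσ1
  obtain ⟨n₁, hn₁⟩ := exists_mul_pow_le z⁻¹ (show 0 ≤ (α * b)⁻¹ / b * σ by positivity) hσz
  set A := Set.Ico (0 : ℝ) 1 ∩ ⋂ k : ℕ, {x | volume (near α b 1 (n₀ + k) x)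
        ≤ ENNReal.ofReal (((α * b)⁻¹ * σ) ^ (n₀ + k) / (b : ℝ) ^ (n₀ + k))} with hA
  have hAm : MeasurableSet A := measurableSet_Ico.inter (MeasurableSet.iInter fun k =>
    measurableSet_le (measurable_volume_near hα0 hα1 1 (n₀ + k)) measurable_const)
  have hmass := le_hausdorffMeasure_graph hb hα0 hα1 d (A := A) (n₀ + n₁) fun x hx n hn => by
    obtain ⟨k, rfl⟩ := Nat.exists_eq_add_of_le (show n₀ ≤ n by omega)
    refine (Set.mem_iInter.1 hx.2 k).trans (ofReal_le_ofReal ?_)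
    have := hn₁ (n₀ + k) (by omega)
    rw [inv_mul_le_iff₀ hz0, ← pow_succ'] at this
    refine le_trans (le_of_eq ?_) this
    rw [← div_pow]
    congr 1
    ring
  refine le_dimH_of_hausdorffMeasure_ne_zero (pos_iff_ne_zero.1 (hpos.trans_le ?_))
  refine le_trans ?_ (Measure.le_iff'.1 hmass _)
  refine le_trans ?_ (Measure.le_map_apply
    (continuous_id.prodMk (continuous_weierstrass hα0 hα1)).aemeasurable _)
  rw [Measure.restrict_apply' hAm]
  exact measure_mono fun x hx => ⟨⟨x, ⟨hx.1.1, hx.1.2.le⟩, rfl⟩, hx⟩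

end

end WeierstrassGraph

namespace WeierstrassGraph

open Finset MeasureTheory ENNReal

section
variable {α : ℝ} {b : ℕ}

lemma exists_abs_weierstrass_sub_le (hb : 2 ≤ b) (hα0 : 0 < α) (hα1 : α < 1) (hαb : 1 < α * b) :
    ∃ C : ℝ, 0 < C ∧ ∀ (n : ℕ) (x y : ℝ), |x - y| ≤ 1 / (b : ℝ) ^ n →
      |weierstrass α b x - weierstrass α b y| ≤ C * α ^ n := by
  have hb0 : (0 : ℝ) < b := by positivity
  have h1 : 0 < α * b - 1 := by linarith
  have h2 : 0 < 1 - α := by linarith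
  refine ⟨2 * Real.pi / (α * b - 1) + 2 / (1 - α), by positivity, fun n x y hxy => ?_⟩
  have hs := (summable_weierstrass (b := b) hα0 hα1 x).sub (summable_weierstrass (b := b) hα0 hα1 y)
  unfold weierstrass
  rw [← (summable_weierstrass hα0 hα1 x).tsum_sub (summable_weierstrass hα0 hα1 y),
    ← hs.sum_add_tsum_nat_add n, add_mul]
  refine (abs_add_le _ _).trans (add_le_add ?_ ?_)
  · calc _ ≤ ∑ k ∈ range n, 2 * Real.pi * (1 / (b : ℝ) ^ n) * (α * b) ^ k := by
          refine (abs_sum_le_sum_abs _ _).trans (sum_le_sum fun k _ => ?_)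
          rw [← mul_sub, abs_mul, abs_of_pos (pow_pos hα0 k)]
          calc _ ≤ α ^ k * |2 * Real.pi * (b : ℝ) ^ k * x - 2 * Real.pi * (b : ℝ) ^ k * y| := by
                exact mul_le_mul_of_nonneg_left (Real.abs_cos_sub_cos_le _ _) (by positivity)
            _ = α ^ k * (2 * Real.pi * (b : ℝ) ^ k * |x - y|) := by
                rw [← mul_sub, abs_mul, abs_of_pos (by positivity)]
            _ ≤ α ^ k * (2 * Real.pi * (b : ℝ) ^ k * (1 / (b : ℝ) ^ n)) := by gcongr
            _ = _ := by rw [mul_pow]; ring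
      _ = 2 * Real.pi * (1 / (b : ℝ) ^ n) * (((α * b) ^ n - 1) / (α * b - 1)) := by
          rw [← mul_sum, geom_sum_eq hαb.ne']
      _ ≤ 2 * Real.pi * (1 / (b : ℝ) ^ n) * ((α * b) ^ n / (α * b - 1)) := by
          gcongr
          linarith
      _ = _ := by
          rw [mul_pow]
          field_simp
  · have hsum : HasSum (fun k : ℕ => 2 * α ^ n * α ^ k) (2 * α ^ n * (1 - α)⁻¹) :=
      (hasSum_geometric_of_lt_one hα0.le hα1).mul_left _
    have e : 2 / (1 - α) * α ^ n = 2 * α ^ n * (1 - α)⁻¹ := by ring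
    rw [e]
    rw [← Real.norm_eq_abs]
    refine tsum_of_norm_bounded hsum fun k => ?_
    refine (norm_sub_le _ _).trans ?_
    have hx := norm_weierstrass_term_le (b := b) hα0 (k + n) x
    have hy := norm_weierstrass_term_le (b := b) hα0 (k + n) y
    calc _ ≤ α ^ (k + n) + α ^ (k + n) := add_le_add hx hy
      _ = _ := by ring

lemma dimH_graph_le (hb : 2 ≤ b) (hα0 : 0 < α) (hα1 : α < 1) (hαb : 1 < α * b) :
    dimH {p : ℝ × ℝ | ∃ x ∈ Set.Icc (0 : ℝ) 1, p = (x, weierstrass α b x)}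
      ≤ ENNReal.ofReal (2 + Real.log α / Real.log b) := by
  have hb0 : (0 : ℝ) < b := by positivity
  have hb1 : (1 : ℝ) < b := by exact_mod_cast hb
  have hlogb : 0 < Real.log b := Real.log_pos hb1
  obtain ⟨C, hC, hW⟩ := exists_abs_weierstrass_sub_le hb hα0 hα1 hαb
  set D := 2 + Real.log α / Real.log b with hD
  have hD0 : 0 ≤ D := by
    have h1 := Real.log_pos hαb
    rw [Real.log_mul hα0.ne' hb0.ne'] at h1
    have h2 : -1 ≤ Real.log α / Real.log b := by
      rw [le_div_iff₀ hlogb]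
      linarith
    linarith
  have hbD : (b : ℝ) ^ D = α * b ^ 2 := by
    rw [hD, Real.rpow_add hb0, Real.rpow_two, div_eq_inv_mul, mul_comm α]
    congr 1
    rw [Real.rpow_def_of_pos hb0, mul_inv_cancel_left₀ hlogb.ne', Real.exp_log hα0]
  refine dimH_le_of_hausdorffMeasure_ne_top (d := D.toNNReal) ?_
  rw [Real.coe_toNNReal D hD0]
  set M : ℕ → ℕ := fun n => ⌊2 * (C * (α * b) ^ n)⌋₊ + 1 with hM
  set r : ℕ → ℝ := fun n => 1 / (b : ℝ) ^ n with hr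
  have hr0 : ∀ n, 0 < r n := fun n => by positivity
  set t : ∀ n : ℕ, Fin (b ^ n + 1) × Fin (M n) → Set (ℝ × ℝ) := fun n p =>
    Set.Icc ((p.1 : ℕ) * r n) (((p.1 : ℕ) + 1) * r n) ×ˢ
      Set.Icc (weierstrass α b ((p.1 : ℕ) * r n) - C * α ^ n + (p.2 : ℕ) * r n)
        (weierstrass α b ((p.1 : ℕ) * r n) - C * α ^ n + ((p.2 : ℕ) + 1) * r n) with ht
  have hdiam : ∀ n p, Metric.ediam (t n p) ≤ ENNReal.ofReal (r n) := by
    intro n p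
    refine Metric.ediam_le fun q hq q' hq' => ?_
    rw [edist_dist, Prod.dist_eq, Real.dist_eq, Real.dist_eq]
    obtain ⟨⟨h1, h2⟩, h3, h4⟩ := hq
    obtain ⟨⟨h1', h2'⟩, h3', h4'⟩ := hq'
    refine ofReal_le_ofReal (max_le (abs_sub_le_iff.2 ⟨?_, ?_⟩) (abs_sub_le_iff.2 ⟨?_, ?_⟩)) <;>
      linarith
  have hcover : ∀ n, {p : ℝ × ℝ | ∃ x ∈ Set.Icc (0 : ℝ) 1, p = (x, weierstrass α b x)}
      ⊆ ⋃ p, t n p := by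
    rintro n _ ⟨x, ⟨hx0, hx1⟩, rfl⟩
    have hbn : (0 : ℝ) < (b : ℝ) ^ n := by positivity
    set i := ⌊(b : ℝ) ^ n * x⌋₊ with hi
    have hi1 : i * r n ≤ x := by
      rw [hr, mul_one_div, div_le_iff₀ hbn, mul_comm x]
      exact Nat.floor_le (by positivity)
    have hi2 : x ≤ (i + 1) * r n := by
      rw [hr, mul_one_div, le_div_iff₀ hbn, mul_comm x]
      exact (Nat.lt_floor_add_one _).le
    have hi3 : i < b ^ n + 1 := by
      refine Nat.lt_succ_of_le (Nat.floor_le_of_le ?_)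
      push_cast
      exact mul_le_of_le_one_right hbn.le hx1
    have hWi := abs_le.1 (hW n x (i * r n) (by rw [abs_of_nonneg] <;> linarith))
    set u := weierstrass α b x - (weierstrass α b (i * r n) - C * α ^ n) with hu
    have hu0 : 0 ≤ u := by linarith
    have hu1 : (b : ℝ) ^ n * u ≤ 2 * (C * (α * b) ^ n) := by
      calc (b : ℝ) ^ n * u ≤ (b : ℝ) ^ n * (2 * (C * α ^ n)) := by gcongr; linarith
        _ = _ := by rw [mul_pow]; ring
    set j := ⌊(b : ℝ) ^ n * u⌋₊ with hj
    have hj1 : j * r n ≤ u := by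
      rw [hr, mul_one_div, div_le_iff₀ hbn, mul_comm u]
      exact Nat.floor_le (by positivity)
    have hj2 : u ≤ (j + 1) * r n := by
      rw [hr, mul_one_div, le_div_iff₀ hbn, mul_comm u]
      exact (Nat.lt_floor_add_one _).le
    have hj3 : j < M n := Nat.lt_succ_of_le (Nat.floor_le_floor hu1)
    refine Set.mem_iUnion.2 ⟨(⟨i, hi3⟩, ⟨j, hj3⟩), ⟨hi1, hi2⟩, ?_, ?_⟩
    · show _ ≤ weierstrass α b x
      linarith
    · show weierstrass α b x ≤ _
      linarith
  have hsum : ∀ n, ∑ p, Metric.ediam (t n p) ^ D ≤ ENNReal.ofReal (2 * (2 * C + 1)) := by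
    intro n
    have hMn : (M n : ℝ) ≤ (2 * C + 1) * (α * b) ^ n := by
      have h1 : (1 : ℝ) ≤ (α * b) ^ n := one_le_pow₀ hαb.le
      have h2 := Nat.floor_le (show 0 ≤ 2 * (C * (α * b) ^ n) by positivity)
      rw [hM]
      push_cast
      linarith
    have hrD : r n ^ D = ((α * b ^ 2) ^ n)⁻¹ := by
      simp only [hr]
      rw [← hbD, one_div, Real.inv_rpow (by positivity), ← Real.rpow_natCast,
        ← Real.rpow_natCast, ← Real.rpow_mul hb0.le, ← Real.rpow_mul hb0.le, mul_comm]
    calc ∑ p, Metric.ediam (t n p) ^ D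
        ≤ ∑ p : Fin (b ^ n + 1) × Fin (M n), ENNReal.ofReal (r n ^ D) := by
          refine sum_le_sum fun p _ => ?_
          rw [← ofReal_rpow_of_pos (hr0 n)]
          exact ENNReal.rpow_le_rpow (hdiam n p) hD0
      _ = ENNReal.ofReal (((b : ℝ) ^ n + 1) * M n * r n ^ D) := by
          rw [sum_const, card_univ, Fintype.card_prod, Fintype.card_fin, Fintype.card_fin,
            nsmul_eq_mul, ← ofReal_natCast, ← ofReal_mul (by positivity)]
          push_cast
          rfl
      _ ≤ _ := by
          refine ofReal_le_ofReal ?_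
          have h1 : (1 : ℝ) ≤ (b : ℝ) ^ n := one_le_pow₀ hb1.le
          calc ((b : ℝ) ^ n + 1) * M n * r n ^ D
              ≤ (2 * (b : ℝ) ^ n) * ((2 * C + 1) * (α * b) ^ n) * ((α * b ^ 2) ^ n)⁻¹ := by
                rw [hrD]
                gcongr
                linarith
            _ = _ := by
                rw [mul_pow, mul_pow, ← pow_mul, mul_comm 2 n, pow_mul]
                field_simp
  have hlim : Filter.Tendsto (fun n => ENNReal.ofReal (r n)) Filter.atTop (nhds 0) := by
    rw [← ofReal_zero]
    refine ENNReal.tendsto_ofReal ?_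
    simp_rw [hr, one_div, ← inv_pow]
    exact tendsto_pow_atTop_nhds_zero_of_lt_one (by positivity) (inv_lt_one_of_one_lt₀ hb1)
  refine ne_top_of_le_ne_top (ofReal_ne_top (r := 2 * (2 * C + 1)))
    ((Measure.hausdorffMeasure_le_liminf_sum D _ _ hlim t
    (Filter.Eventually.of_forall fun n => hdiam n) (Filter.Eventually.of_forall hcover)).trans ?_)
  exact Filter.liminf_le_of_frequently_le' (Filter.Eventually.of_forall hsum).frequently

end

end WeierstrassGraph

/-- For every integer `b ≥ 2` and `α ∈ (1/b,1)`, the Hausdorff dimension of the graph of the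
Weierstrass function over `[0,1]` equals `2 + log α / log b`. -/
theorem weierstrass_graph_dimH (b : ℕ) (hb : 2 ≤ b) (α : ℝ)
    (hα₁ : 1 / (b : ℝ) < α) (hα₂ : α < 1) :
    dimH {p : ℝ × ℝ | ∃ x ∈ Set.Icc (0:ℝ) 1, p = (x, weierstrass α b x)} =
      ENNReal.ofReal (2 + Real.log α / Real.log b) := by
  have hb0 : (0 : ℝ) < b := by positivity
  have hα0 : 0 < α := lt_trans (by positivity) hα₁
  have hαb : 1 < α * b := (div_lt_iff₀ hb0).1 hα₁
  exact le_antisymm (WeierstrassGraph.dimH_graph_le hb hα0 hα₂ hαb)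
    (WeierstrassGraph.le_dimH_graph hb hα0 hα₂ hαb)
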